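/- arXiv:0712.2193 — 2 statements merged into one kernel-verified Lean document; each statement's English description precedes it below -/
import Mathlib

section
/- (Theorem 1.2, circle-fiber case, for bundles over compact hyperbolic surfaces.) Let Γ be a cocompact Fuchsian group and let Γ also act on the unit circle S¹ by homeomorphisms (via an arbitrary homomorphism Γ → Homeo(S¹)). Then every Γ-invariant leafwise harmonic function f̃ : 𝔻 × S¹ → ℝ is independent of the disc variable: f̃(z,x) = f̃(0,x) for all z ∈ 𝔻 and all x ∈ S¹. (Equivalently, the foliated circle bundle (𝔻 × S¹)/Γ over the compact hyperbolic surface 𝔻/Γ has the Liouville property: every continuous leafwise harmonic function on it is leafwise constant.) -/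
open Metric Set Filter

noncomputable section

/-- The open unit disc in `ℂ`. -/
def unitDisc : Set ℂ := Metric.ball 0 1

/-- A function `f : ℂ → ℝ` is harmonic on a set `U ⊆ ℂ` if, locally on `U`, it is
the real part of a holomorphic function (for open `U` this is equivalent to being
`C²` with vanishing Laplacian). -/
def HarmonicOnSet (f : ℂ → ℝ) (U : Set ℂ) : Prop :=
  ∀ z ∈ U, ∃ r > 0, Metric.ball z r ⊆ U ∧
    ∃ g : ℂ → ℂ, DifferentiableOn ℂ g (Metric.ball z r) ∧
      ∀ w ∈ Metric.ball z r, f w = (g w).re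

/-- `ρ` is a cocompact Fuchsian group action of `Γ` on the open unit disc: a faithful,
properly discontinuous, cocompact action by Möbius transformations
`z ↦ (αz+β)/(β̄z+ᾱ)` with `|α|² - |β|² = 1`. -/
structure IsCocompactFuchsian (Γ : Type*) [Group Γ] (ρ : Γ → ℂ → ℂ) : Prop where
  one_act : ∀ z ∈ unitDisc, ρ 1 z = z
  mul_act : ∀ γ₁ γ₂ : Γ, ∀ z ∈ unitDisc, ρ (γ₁ * γ₂) z = ρ γ₁ (ρ γ₂ z)
  maps_disc : ∀ γ : Γ, ∀ z ∈ unitDisc, ρ γ z ∈ unitDisc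
  moebius : ∀ γ : Γ, ∃ α β : ℂ, ‖α‖ ^ 2 - ‖β‖ ^ 2 = 1 ∧
    ∀ z ∈ unitDisc, ρ γ z = (α * z + β) / ((starRingEnd ℂ) β * z + (starRingEnd ℂ) α)
  faithful : ∀ γ : Γ, (∀ z ∈ unitDisc, ρ γ z = z) → γ = 1
  properly_discontinuous : ∀ K : Set ℂ, K ⊆ unitDisc → IsCompact K →
    {γ : Γ | ((ρ γ '' K) ∩ K).Nonempty}.Finite
  cocompact : ∃ K : Set ℂ, K ⊆ unitDisc ∧ IsCompact K ∧ ∀ z ∈ unitDisc, ∃ γ : Γ, ρ γ z ∈ K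

/-- `σ` is an action of the group `Γ` on the topological space `X` by homeomorphisms. -/
structure IsActionByHomeomorphisms (Γ : Type*) [Group Γ] (X : Type*) [TopologicalSpace X]
    (σ : Γ → X → X) : Prop where
  one_act : ∀ x : X, σ 1 x = x
  mul_act : ∀ γ₁ γ₂ : Γ, ∀ x : X, σ (γ₁ * γ₂) x = σ γ₁ (σ γ₂ x)
  continuous_act : ∀ γ : Γ, Continuous (σ γ)

/-- The unit circle in `ℂ`, as a topological space. -/
abbrev UnitCircle : Type := ↥(Metric.sphere (0 : ℂ) 1)

section
open scoped Topology ENNReal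


lemma HarmonicOnSet.nhd {h : ℂ → ℝ} (hh : HarmonicOnSet h unitDisc) :
    InnerProductSpace.HarmonicOnNhd h (ball (0:ℂ) 1) := by
  intro z hz
  obtain ⟨r, hr, hsub, g, hg, hgw⟩ := hh z hz
  have ha : AnalyticAt ℂ g z := hg.analyticAt (ball_mem_nhds z hr)
  have h1 := ha.harmonicAt_re
  refine (InnerProductSpace.harmonicAt_congr_nhds ?_).2 h1
  filter_upwards [ball_mem_nhds z hr] with w hw
  exact hgw w hw

/-- A harmonic function on the disc is globally the real part of a holomorphic function. -/
lemma HarmonicOnSet.exists_global {h : ℂ → ℝ} (hh : HarmonicOnSet h unitDisc) :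
    ∃ g : ℂ → ℂ, DifferentiableOn ℂ g unitDisc ∧ ∀ w ∈ unitDisc, h w = (g w).re := by
  obtain ⟨g, hg, he⟩ := hh.nhd.exists_analyticOnNhd_ball_re_eq
  refine ⟨g, hg.differentiableOn, fun w hw => ?_⟩
  have := he hw
  simpa using this.symm

lemma harmonicOnSet_of_global {h : ℂ → ℝ} {g : ℂ → ℂ} (hg : DifferentiableOn ℂ g unitDisc)
    (he : ∀ w ∈ unitDisc, h w = (g w).re) : HarmonicOnSet h unitDisc := by
  intro z hz
  obtain ⟨r, hr, hs⟩ := Metric.isOpen_iff.1 (isOpen_ball : IsOpen (ball (0:ℂ) 1)) z hz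
  exact ⟨r, hr, hs, g, hg.mono hs, fun w hw => he w (hs hw)⟩

lemma HarmonicOnSet.sub {h k : ℂ → ℝ} (hh : HarmonicOnSet h unitDisc)
    (hk : HarmonicOnSet k unitDisc) : HarmonicOnSet (fun z => h z - k z) unitDisc := by
  obtain ⟨g, hg, he⟩ := hh.exists_global
  obtain ⟨g', hg', he'⟩ := hk.exists_global
  exact harmonicOnSet_of_global (hg.sub hg') (fun w hw => by simp [he w hw, he' w hw])

lemma HarmonicOnSet.affine {h : ℂ → ℝ} (hh : HarmonicOnSet h unitDisc) (a b : ℝ) :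
    HarmonicOnSet (fun z => a * h z + b) unitDisc := by
  obtain ⟨g, hg, he⟩ := hh.exists_global
  refine harmonicOnSet_of_global (g := fun z => (a:ℂ) * g z + b) ?_ (fun w hw => by simp [he w hw])
  exact (hg.const_mul _).add_const _

lemma HarmonicOnSet.max_principle {h : ℂ → ℝ} (hh : HarmonicOnSet h unitDisc) {c : ℂ}
    (hc : c ∈ unitDisc) (hmax : ∀ z ∈ unitDisc, h z ≤ h c) : ∀ z ∈ unitDisc, h z = h c := by
  obtain ⟨g, hg, he⟩ := hh.exists_global
  have h1 : EqOn (norm ∘ fun z => Complex.exp (g z)) (Function.const ℂ ‖Complex.exp (g c)‖) unitDisc := by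
    refine Complex.norm_eqOn_of_isPreconnected_of_isMaxOn ?_ ?_ ?_ hc ?_
    · exact (convex_ball (0:ℂ) 1).isPreconnected
    · exact isOpen_ball
    · exact hg.cexp
    · intro z hz
      simp only [Function.comp_apply, mem_ofPred_eq, Complex.norm_exp]
      rw [← he z hz, ← he c hc]
      exact Real.exp_le_exp.2 (hmax z hz)
  intro z hz
  have := h1 hz
  simp only [Function.comp_apply, Complex.norm_exp, Function.const_apply] at this
  rw [he z hz, he c hc]
  exact Real.exp_injective this

lemma zero_mem_unitDisc : (0:ℂ) ∈ unitDisc := by simp [unitDisc]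

/-- On every nonempty closed invariant set, the supremum of `f` is attained at a point where
`f` is leafwise constant. -/
lemma exists_const_max {Γ : Type*} [Group Γ] {ρ : Γ → ℂ → ℂ} (hΓ : IsCocompactFuchsian Γ ρ)
    {X : Type*} [TopologicalSpace X] [CompactSpace X] (σ : Γ → X → X)
    (f : ℂ → X → ℝ)
    (hcont : ContinuousOn (fun p : ℂ × X => f p.1 p.2) (unitDisc ×ˢ (univ : Set X)))
    (hharm : ∀ x : X, HarmonicOnSet (fun z => f z x) unitDisc)
    (hinv : ∀ γ : Γ, ∀ z ∈ unitDisc, ∀ x : X, f (ρ γ z) (σ γ x) = f z x)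
    (A : Set X) (hA : IsClosed A) (hne : A.Nonempty) (hAinv : ∀ γ, ∀ x ∈ A, σ γ x ∈ A) :
    ∃ y ∈ A, (∀ z ∈ unitDisc, f z y = f 0 y) ∧ ∀ x ∈ A, ∀ z ∈ unitDisc, f z x ≤ f 0 y := by
  obtain ⟨K, hKD, hK, hcov⟩ := hΓ.cocompact
  have hKA : IsCompact (K ×ˢ A) := hK.prod hA.isCompact
  obtain ⟨γ0, hγ0⟩ := hcov 0 zero_mem_unitDisc
  obtain ⟨x0, hx0⟩ := hne
  obtain ⟨⟨w, y⟩, ⟨hw, hy⟩, hmax⟩ := hKA.exists_isMaxOn (f := fun p : ℂ × X => f p.1 p.2)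
    ⟨(ρ γ0 0, x0), hγ0, hx0⟩ (hcont.mono (prod_mono hKD (subset_univ _)))
  have key : ∀ x ∈ A, ∀ z ∈ unitDisc, f z x ≤ f w y := by
    intro x hx z hz
    obtain ⟨γ, hγ⟩ := hcov z hz
    rw [← hinv γ z hz x]
    exact hmax (show (ρ γ z, σ γ x) ∈ K ×ˢ A from ⟨hγ, hAinv γ x hx⟩)
  have hc := (hharm y).max_principle (hKD hw) (fun z hz => key y hy z hz)
  have h0 := hc 0 zero_mem_unitDisc
  refine ⟨y, hy, fun z hz => ?_, fun x hx z hz => ?_⟩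
  · exact (hc z hz).trans h0.symm
  · exact (key x hx z hz).trans h0.symm.le

lemma exists_const_min {Γ : Type*} [Group Γ] {ρ : Γ → ℂ → ℂ} (hΓ : IsCocompactFuchsian Γ ρ)
    {X : Type*} [TopologicalSpace X] [CompactSpace X] (σ : Γ → X → X)
    (f : ℂ → X → ℝ)
    (hcont : ContinuousOn (fun p : ℂ × X => f p.1 p.2) (unitDisc ×ˢ (univ : Set X)))
    (hharm : ∀ x : X, HarmonicOnSet (fun z => f z x) unitDisc)
    (hinv : ∀ γ : Γ, ∀ z ∈ unitDisc, ∀ x : X, f (ρ γ z) (σ γ x) = f z x)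
    (A : Set X) (hA : IsClosed A) (hne : A.Nonempty) (hAinv : ∀ γ, ∀ x ∈ A, σ γ x ∈ A) :
    ∃ y ∈ A, (∀ z ∈ unitDisc, f z y = f 0 y) ∧ ∀ x ∈ A, ∀ z ∈ unitDisc, f 0 y ≤ f z x := by
  obtain ⟨y, hy, h1, h2⟩ := exists_const_max hΓ σ (fun z x => - f z x) hcont.neg
    (fun x => by simpa using (hharm x).affine (-1) 0)
    (fun γ z hz x => by rw [hinv γ z hz x]) A hA hne hAinv
  exact ⟨y, hy, fun z hz => by simpa using h1 z hz, fun x hx z hz => by simpa using h2 x hx z hz⟩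

end

section
open scoped Topology ENNReal ComplexConjugate


def mob (α β z : ℂ) : ℂ := (α * z + β) / (conj β * z + conj α)

lemma mem_unitDisc {z : ℂ} : z ∈ unitDisc ↔ ‖z‖ < 1 := by simp [unitDisc]

lemma mob_den_ne {α β z : ℂ} (h : ‖α‖ ^ 2 - ‖β‖ ^ 2 = 1) (hz : z ∈ unitDisc) :
    conj β * z + conj α ≠ 0 := by
  rw [mem_unitDisc] at hz
  intro h0
  have h1 : ‖conj β * z‖ = ‖conj α‖ := by
    rw [eq_neg_of_add_eq_zero_left h0, norm_neg]
  rw [norm_mul, RCLike.norm_conj, RCLike.norm_conj] at h1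
  have := norm_nonneg β
  have := norm_nonneg z
  have : ‖β‖ * ‖z‖ ≤ ‖β‖ := by nlinarith
  nlinarith [norm_nonneg α]

lemma mob_cross {α β z w : ℂ} (h : ‖α‖ ^ 2 - ‖β‖ ^ 2 = 1) (hz : z ∈ unitDisc) (hw : w ∈ unitDisc) :
    1 - conj (mob α β w) * mob α β z =
      (1 - conj w * z) / (conj (conj β * w + conj α) * (conj β * z + conj α)) := by
  have h1 := mob_den_ne h hz
  have h2 := mob_den_ne h hw
  have h2' : conj (conj β * w + conj α) ≠ 0 := by rwa [Ne, map_eq_zero]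
  have hab : α * conj α - β * conj β = 1 := by
    rw [Complex.mul_conj, Complex.mul_conj, Complex.normSq_eq_norm_sq, Complex.normSq_eq_norm_sq]
    exact_mod_cast h
  unfold mob
  rw [map_div₀]
  generalize hd1 : conj β * z + conj α = d1 at *
  generalize hd2 : conj (conj β * w + conj α) = d2 at *
  field_simp
  rw [← hd1, ← hd2]
  simp only [map_add, map_mul, Complex.conj_conj]
  linear_combination (1 - conj w * z) * hab

lemma mob_sub {α β z w : ℂ} (h : ‖α‖ ^ 2 - ‖β‖ ^ 2 = 1) (hz : z ∈ unitDisc) (hw : w ∈ unitDisc) :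
    mob α β z - mob α β w = (z - w) / ((conj β * w + conj α) * (conj β * z + conj α)) := by
  have h1 := mob_den_ne h hz
  have h2 := mob_den_ne h hw
  have hab : α * conj α - β * conj β = 1 := by
    rw [Complex.mul_conj, Complex.mul_conj, Complex.normSq_eq_norm_sq, Complex.normSq_eq_norm_sq]
    exact_mod_cast h
  unfold mob
  generalize hd1 : conj β * z + conj α = d1 at *
  generalize hd2 : conj β * w + conj α = d2 at *
  field_simp
  rw [← hd1, ← hd2]
  linear_combination (z - w) * hab

lemma mob_norm {α β z : ℂ} (h : ‖α‖ ^ 2 - ‖β‖ ^ 2 = 1) (hz : z ∈ unitDisc) :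
    1 - ‖mob α β z‖ ^ 2 = (1 - ‖z‖ ^ 2) / ‖conj β * z + conj α‖ ^ 2 := by
  have := mob_cross h hz hz
  rw [mul_comm (conj _), mul_comm (conj _), mul_comm (conj _), Complex.mul_conj, Complex.mul_conj,
    Complex.mul_conj, Complex.normSq_eq_norm_sq, Complex.normSq_eq_norm_sq,
    Complex.normSq_eq_norm_sq] at this
  exact_mod_cast this

lemma mob_mem {α β z : ℂ} (h : ‖α‖ ^ 2 - ‖β‖ ^ 2 = 1) (hz : z ∈ unitDisc) :
    mob α β z ∈ unitDisc := by
  have h1 := mob_norm h hz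
  have h2 := norm_pos_iff.2 (mob_den_ne h hz)
  rw [mem_unitDisc] at *
  have : 0 < (1 - ‖z‖ ^ 2) / ‖conj β * z + conj α‖ ^ 2 := by
    apply div_pos _ (by positivity)
    nlinarith [norm_nonneg z]
  nlinarith [norm_nonneg (mob α β z)]

lemma mob_inv {α β z : ℂ} (h : ‖α‖ ^ 2 - ‖β‖ ^ 2 = 1) (hz : z ∈ unitDisc) :
    mob (conj α) (-β) (mob α β z) = z := by
  have h1 := mob_den_ne h hz
  have hab : α * conj α - β * conj β = 1 := by
    rw [Complex.mul_conj, Complex.mul_conj, Complex.normSq_eq_norm_sq, Complex.normSq_eq_norm_sq]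
    exact_mod_cast h
  have h3 := mob_den_ne (α := conj α) (β := -β) (by simpa using h) (mob_mem h hz)
  have hn : conj α * mob α β z + -β = z / (conj β * z + conj α) := by
    unfold mob
    generalize hd1 : conj β * z + conj α = d1 at *
    field_simp
    rw [← hd1]
    linear_combination z * hab
  have hd : conj (-β) * mob α β z + conj (conj α) = 1 / (conj β * z + conj α) := by
    unfold mob; simp only [map_neg, Complex.conj_conj]
    generalize hd1 : conj β * z + conj α = d1 at *
    field_simp
    rw [← hd1]
    linear_combination hab
  have : mob (conj α) (-β) (mob α β z) = (conj α * mob α β z + -β) / (conj (-β) * mob α β z + conj (conj α)) := rfl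
  rw [this, hn, hd, div_div_div_cancel_right₀ h1, div_one]

lemma mob_injOn {α β : ℂ} (h : ‖α‖ ^ 2 - ‖β‖ ^ 2 = 1) : InjOn (mob α β) unitDisc := by
  intro z hz w hw he
  rw [← mob_inv h hz, ← mob_inv h hw, he]

lemma mob_image {α β : ℂ} (h : ‖α‖ ^ 2 - ‖β‖ ^ 2 = 1) : mob α β '' unitDisc = unitDisc := by
  apply Subset.antisymm
  · rintro _ ⟨z, hz, rfl⟩; exact mob_mem h hz
  · intro z hz
    have h' : ‖conj α‖ ^ 2 - ‖-β‖ ^ 2 = 1 := by simpa using h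
    refine ⟨mob (conj α) (-β) z, mob_mem h' hz, ?_⟩
    simpa using mob_inv h' hz

lemma mob_hasDerivAt {α β z : ℂ} (h : ‖α‖ ^ 2 - ‖β‖ ^ 2 = 1) (hz : z ∈ unitDisc) :
    HasDerivAt (mob α β) (1 / (conj β * z + conj α) ^ 2) z := by
  have h1 := mob_den_ne h hz
  have hab : α * conj α - β * conj β = 1 := by
    rw [Complex.mul_conj, Complex.mul_conj, Complex.normSq_eq_norm_sq, Complex.normSq_eq_norm_sq]
    exact_mod_cast h
  have hn : HasDerivAt (fun z => α * z + β) α z := by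
    simpa using ((hasDerivAt_id z).const_mul α).add_const β
  have hd : HasDerivAt (fun z => conj β * z + conj α) (conj β) z := by
    simpa using ((hasDerivAt_id z).const_mul (conj β)).add_const (conj α)
  have := hn.div hd h1
  have e : (1:ℂ) = α * (conj β * z + conj α) - (α * z + β) * conj β := by linear_combination -hab
  rw [← e] at this
  exact this

lemma mob_measurable (α β : ℂ) : Measurable (mob α β) := by
  unfold mob; fun_prop

open MeasureTheory

def dens (z : ℂ) : ℝ≥0∞ := ENNReal.ofReal (((1 - ‖z‖ ^ 2) ^ 2)⁻¹)

lemma dens_measurable : Measurable dens := by unfold dens; fun_prop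

def hyp : Measure ℂ := (volume.restrict unitDisc).withDensity dens

lemma measurableSet_unitDisc : MeasurableSet unitDisc := measurableSet_ball

lemma hyp_lintegral {k : ℂ → ℝ≥0∞} (hk : Measurable k) :
    ∫⁻ z, k z ∂hyp = ∫⁻ z in unitDisc, dens z * k z := by
  rw [hyp, lintegral_withDensity_eq_lintegral_mul _ dens_measurable hk]; rfl

instance : SFinite hyp := by unfold hyp; infer_instance

lemma hyp_ae_mem : ∀ᵐ z ∂hyp, z ∈ unitDisc := by
  have : ∀ᵐ z ∂(volume.restrict unitDisc), z ∈ unitDisc := ae_restrict_mem measurableSet_unitDisc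
  exact (withDensity_absolutelyContinuous _ _).ae_le this

lemma det_mul_complex (c : ℂ) :
    (c • (1 : ℂ →L[ℝ] ℂ)).det = ‖c‖ ^ 2 := by
  have : ((c • (1 : ℂ →L[ℝ] ℂ) : ℂ →L[ℝ] ℂ) : ℂ →ₗ[ℝ] ℂ) = LinearMap.mulLeft ℝ c := by
    ext <;> simp
  rw [ContinuousLinearMap.det, this, ← Complex.normSq_eq_norm_sq]
  have h2 := congrArg (fun f => f c) Algebra.norm_complex_eq
  exact h2

lemma hyp_mob {α β : ℂ} (h : ‖α‖ ^ 2 - ‖β‖ ^ 2 = 1) {k : ℂ → ℝ≥0∞} (hk : Measurable k) :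
    ∫⁻ z, k (mob α β z) ∂hyp = ∫⁻ z, k z ∂hyp := by
  rw [hyp_lintegral hk, hyp_lintegral (k := fun z => k (mob α β z)) (hk.comp (mob_measurable α β))]
  conv_rhs => rw [← mob_image h]
  rw [lintegral_image_eq_lintegral_abs_det_fderiv_mul volume measurableSet_unitDisc
    (fun z hz => (mob_hasDerivAt h hz).complexToReal_fderiv.hasFDerivWithinAt) (mob_injOn h)]
  refine setLIntegral_congr_fun measurableSet_unitDisc (fun z hz => ?_)
  rw [det_mul_complex, ← mul_assoc]
  congr 1
  unfold dens
  rw [← ENNReal.ofReal_mul (abs_nonneg _), mob_norm h hz, abs_of_nonneg (by positivity)]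
  congr 1
  have h2 := norm_pos_iff.2 (mob_den_ne h hz)
  have h3 : 0 < 1 - ‖z‖ ^ 2 := by rw [mem_unitDisc] at hz; nlinarith [norm_nonneg z]
  rw [norm_div, norm_pow, norm_one]
  field_simp

open Classical in
def pk (r : ℝ) (z w : ℂ) : ℝ≥0∞ := if ‖z - w‖ < r * ‖1 - conj w * z‖ then 1 else 0

lemma pk_symm (r : ℝ) (z w : ℂ) : pk r z w = pk r w z := by
  unfold pk
  have : ‖1 - conj w * z‖ = ‖1 - conj z * w‖ := by
    rw [← RCLike.norm_conj (1 - conj w * z)]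
    congr 1
    simp [mul_comm]
  rw [this, norm_sub_rev]

lemma pk_mob {α β z w : ℂ} (h : ‖α‖ ^ 2 - ‖β‖ ^ 2 = 1) (hz : z ∈ unitDisc) (hw : w ∈ unitDisc)
    (r : ℝ) : pk r (mob α β z) (mob α β w) = pk r z w := by
  unfold pk
  rw [mob_cross h hz hw, mob_sub h hz hw, norm_div, norm_div, norm_mul, norm_mul, RCLike.norm_conj,
    mul_div_assoc']
  have h2 := norm_pos_iff.2 (mob_den_ne h hz)
  have h3 := norm_pos_iff.2 (mob_den_ne h hw)
  simp only [div_lt_div_iff_of_pos_right (mul_pos h3 h2)]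

lemma pk_zero (r : ℝ) (w : ℂ) : pk r 0 w = (Iio r).indicator 1 ‖w‖ := by
  classical
  simp [pk, indicator_apply]

lemma pk_measurable (r : ℝ) : Measurable (fun p : ℂ × ℂ => pk r p.1 p.2) := by
  unfold pk
  refine Measurable.ite (measurableSet_lt ?_ ?_) measurable_const measurable_const
  · fun_prop
  · apply Measurable.const_mul
    apply Measurable.norm
    apply Measurable.sub measurable_const
    exact (Complex.continuous_conj.measurable.comp measurable_snd).mul measurable_fst

lemma circle_lintegral {H : ℂ → ℝ} (hH : HarmonicOnSet H unitDisc) (h0 : ∀ z ∈ unitDisc, 0 ≤ H z)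
    {ρ : ℝ} (hρ : 0 < ρ) (hρ1 : ρ < 1) :
    ∫⁻ θ in Ioo (-Real.pi) Real.pi, ENNReal.ofReal (H (Complex.polarCoord.symm (ρ, θ))) =
      ENNReal.ofReal (2 * Real.pi) * ENNReal.ofReal (H 0) := by
  have hsub : closedBall (0:ℂ) |ρ| ⊆ ball 0 1 := closedBall_subset_ball (by rwa [abs_of_pos hρ])
  have hm := InnerProductSpace.HarmonicOnNhd.circleAverage_eq (hH.nhd.mono hsub)
  rw [Real.circleAverage_eq_integral_add (-Real.pi)] at hm
  have hcm : ∀ θ : ℝ, Complex.polarCoord.symm (ρ, θ) = circleMap 0 ρ θ := by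
    intro θ
    rw [Complex.polarCoord_symm_apply, circleMap, Complex.exp_mul_I]; simp
  have hinteg : (∫ θ in (0:ℝ)..2 * Real.pi, H (circleMap 0 ρ (θ + -Real.pi))) =
      ∫ θ in (-Real.pi)..Real.pi, H (circleMap 0 ρ θ) := by
    rw [intervalIntegral.integral_comp_add_right (fun θ => H (circleMap 0 ρ θ))]
    congr 1 <;> ring
  rw [hinteg] at hm
  have hmem : ∀ θ, circleMap 0 ρ θ ∈ unitDisc := fun θ => by
    rw [mem_unitDisc]; simp [abs_of_pos hρ, hρ1]
  have hcontH : ContinuousOn H (ball 0 1) := hH.nhd.continuousOn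
  have hc : Continuous (fun θ => H (circleMap 0 ρ θ)) :=
    hcontH.comp_continuous (continuous_circleMap 0 ρ) hmem
  simp only [hcm]
  have hpi := Real.pi_pos
  rw [← ofReal_integral_eq_lintegral_ofReal, ← integral_Ioc_eq_integral_Ioo,
    ← intervalIntegral.integral_of_le (by linarith)]
  · rw [← ENNReal.ofReal_mul (by positivity), ← hm, smul_eq_mul]
    congr 1
    field_simp
  · exact (hc.integrableOn_Icc (a := -Real.pi) (b := Real.pi)).mono_set Ioo_subset_Icc_self
  · exact Eventually.of_forall fun θ => h0 _ (hmem θ)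

lemma radial_mean {H : ℂ → ℝ} (hH : HarmonicOnSet H unitDisc) (h0 : ∀ z ∈ unitDisc, 0 ≤ H z)
    (hHm : Measurable H) {ω : ℝ → ℝ≥0∞} (hω : Measurable ω) (hω1 : ∀ t, 1 ≤ t → ω t = 0) :
    ∫⁻ u, ω ‖u‖ * ENNReal.ofReal (H u) =
      (∫⁻ t in Ioi (0:ℝ), ENNReal.ofReal t * ω t) * (ENNReal.ofReal (2 * Real.pi) * ENNReal.ofReal (H 0)) := by
  have hpm : Measurable (fun p : ℝ × ℝ => Complex.polarCoord.symm p) := by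
    simp only [Complex.polarCoord_symm_apply]; fun_prop
  rw [← Complex.lintegral_comp_polarCoord_symm, polarCoord_target,
    Measure.volume_eq_prod, ← Measure.prod_restrict, lintegral_prod]
  · rw [← lintegral_mul_const _ (by fun_prop)]
    refine setLIntegral_congr_fun measurableSet_Ioi (fun t ht => ?_)
    have ht : 0 < t := ht
    simp only [smul_eq_mul, Complex.norm_polarCoord_symm, abs_of_pos ht]
    rcases lt_or_ge t 1 with h1 | h1
    · rw [← circle_lintegral hH h0 ht h1, ← lintegral_const_mul]
      · simp only [mul_assoc]
      · fun_prop
    · simp [hω1 t h1]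
  · fun_prop

def ck (r : ℝ) : ℝ≥0∞ := ∫⁻ w, pk r 0 w ∂hyp

lemma pk_mean_zero {H : ℂ → ℝ} (hH : HarmonicOnSet H unitDisc) (h0 : ∀ z ∈ unitDisc, 0 ≤ H z)
    (hHm : Measurable H) (r : ℝ) :
    ∫⁻ u, pk r 0 u * ENNReal.ofReal (H u) ∂hyp = ck r * ENNReal.ofReal (H 0) := by
  let ω : ℝ → ℝ≥0∞ := (Iio 1).indicator
    (fun t => ENNReal.ofReal (((1 - t ^ 2) ^ 2)⁻¹) * (Iio r).indicator 1 t)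
  have hω : Measurable ω := by
    refine Measurable.indicator ?_ measurableSet_Iio
    refine Measurable.mul (by fun_prop) (Measurable.indicator measurable_one measurableSet_Iio)
  have hω1 : ∀ t, 1 ≤ t → ω t = 0 := fun t ht => indicator_of_notMem (by simpa using ht) _
  have key : ∀ H : ℂ → ℝ, Measurable H →
      ∫⁻ u, pk r 0 u * ENNReal.ofReal (H u) ∂hyp = ∫⁻ u, ω ‖u‖ * ENNReal.ofReal (H u) := by
    intro H hHm
    have hpm : Measurable (fun u => pk r 0 u) := (pk_measurable r).comp measurable_prodMk_left
    rw [hyp_lintegral (by fun_prop), ← lintegral_indicator measurableSet_unitDisc]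
    congr 1
    ext u
    by_cases hu : u ∈ unitDisc
    · rw [indicator_of_mem hu]
      have hu' := mem_unitDisc.1 hu
      simp only [ω, indicator_of_mem (show ‖u‖ ∈ Iio (1:ℝ) from hu'), pk_zero, dens, mul_assoc]
    · rw [indicator_of_notMem hu, hω1, zero_mul]
      rw [mem_unitDisc] at hu; linarith
  have e1 := radial_mean hH h0 hHm hω hω1
  have e2 := radial_mean (H := fun _ => 1) (harmonicOnSet_of_global (g := fun _ => 1)
    (differentiableOn_const _) (by simp)) (by simp) measurable_const hω hω1
  rw [← key _ measurable_const] at e2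
  rw [key H hHm, e1, ck]
  simp only [ENNReal.ofReal_one, mul_one] at e2
  rw [e2, mul_assoc]

lemma HarmonicOnSet.comp_mob {H : ℂ → ℝ} (hH : HarmonicOnSet H unitDisc) {α β : ℂ}
    (h : ‖α‖ ^ 2 - ‖β‖ ^ 2 = 1) : HarmonicOnSet (fun z => H (mob α β z)) unitDisc := by
  obtain ⟨g, hg, he⟩ := hH.exists_global
  refine harmonicOnSet_of_global (g := fun z => g (mob α β z)) ?_ (fun w hw => he _ (mob_mem h hw))
  exact hg.comp (fun z hz => (mob_hasDerivAt h hz).differentiableAt.differentiableWithinAt)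
    (fun z hz => mob_mem h hz)

lemma exists_mob {z : ℂ} (hz : z ∈ unitDisc) :
    ∃ α β : ℂ, ‖α‖ ^ 2 - ‖β‖ ^ 2 = 1 ∧ mob α β 0 = z := by
  have hz' := mem_unitDisc.1 hz
  have hp : 0 < 1 - ‖z‖ ^ 2 := by nlinarith [norm_nonneg z]
  set s := Real.sqrt (1 - ‖z‖ ^ 2) with hs
  have hs0 : 0 < s := Real.sqrt_pos.2 hp
  have hs2 : s ^ 2 = 1 - ‖z‖ ^ 2 := Real.sq_sqrt hp.le
  refine ⟨(s⁻¹ : ℝ), (s⁻¹ : ℝ) * z, ?_, ?_⟩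
  · rw [norm_mul, Complex.norm_real, Real.norm_eq_abs, abs_of_pos (inv_pos.2 hs0)]
    field_simp
    linarith
  · have : ((s⁻¹ : ℝ) : ℂ) ≠ 0 := by exact_mod_cast (inv_pos.2 hs0).ne'
    unfold mob
    rw [mul_zero, mul_zero, zero_add, zero_add, Complex.conj_ofReal, mul_div_cancel_left₀ _ this]

lemma pk_mean {H : ℂ → ℝ} (hH : HarmonicOnSet H unitDisc) (h0 : ∀ z ∈ unitDisc, 0 ≤ H z)
    (hHm : Measurable H) (r : ℝ) {z : ℂ} (hz : z ∈ unitDisc) :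
    ∫⁻ w, pk r z w * ENNReal.ofReal (H w) ∂hyp = ck r * ENNReal.ofReal (H z) := by
  obtain ⟨α, β, h, rfl⟩ := exists_mob hz
  have hpm : Measurable (fun u => pk r (mob α β 0) u) := (pk_measurable r).comp measurable_prodMk_left
  rw [← hyp_mob h (by fun_prop), ← pk_mean_zero (hH.comp_mob h) (fun z hz => h0 _ (mob_mem h hz))
    (hHm.comp (mob_measurable α β))]
  refine lintegral_congr_ae ?_
  filter_upwards [hyp_ae_mem] with w hw
  rw [pk_mob h zero_mem_unitDisc hw]

lemma ck_lt_top {r : ℝ} (hr : r < 1) : ck r < ∞ := by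
  have hpm : Measurable (fun u => pk r 0 u) := (pk_measurable r).comp measurable_prodMk_left
  rw [ck, hyp_lintegral hpm]
  calc ∫⁻ z in unitDisc, dens z * pk r 0 z
      ≤ ∫⁻ z in unitDisc, ENNReal.ofReal (((1 - r ^ 2) ^ 2)⁻¹) := by
        refine lintegral_mono fun z => ?_
        rw [pk_zero]
        by_cases hz : ‖z‖ < r
        · rw [indicator_of_mem (show ‖z‖ ∈ Iio r from hz)]
          simp only [Pi.one_apply, mul_one, dens]
          apply ENNReal.ofReal_le_ofReal
          have := norm_nonneg z
          have h1 : 0 < 1 - r ^ 2 := by nlinarith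
          gcongr
        · rw [indicator_of_notMem (show ‖z‖ ∉ Iio r from hz)]; simp
    _ < ∞ := by
        rw [setLIntegral_const]
        exact ENNReal.mul_lt_top ENNReal.ofReal_lt_top (by rw [unitDisc]; exact measure_ball_lt_top)

lemma hyp_compact_lt_top {K : Set ℂ} (hK : IsCompact K) (hKD : K ⊆ unitDisc) : hyp K < ∞ := by
  rcases K.eq_empty_or_nonempty with rfl | hne
  · simp
  obtain ⟨m, hm, hmax⟩ := hK.exists_isMaxOn hne continuous_norm.continuousOn
  have hm1 := mem_unitDisc.1 (hKD hm)
  have hr : (1 + ‖m‖) / 2 < 1 := by linarith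
  refine lt_of_le_of_lt ?_ (ck_lt_top hr)
  rw [ck, ← lintegral_indicator_one hK.measurableSet]
  refine lintegral_mono fun z => ?_
  by_cases hz : z ∈ K
  · have : ‖z‖ ≤ ‖m‖ := hmax hz
    rw [pk_zero, indicator_of_mem hz, indicator_of_mem (show ‖z‖ ∈ Iio _ by simp only [mem_Iio]; linarith)]
    simp
  · rw [indicator_of_notMem hz]; exact zero_le

lemma hyp_pos_of_volume_pos {K : Set ℂ} (hKm : MeasurableSet K) (hKD : K ⊆ unitDisc)
    (h0 : hyp K = 0) : volume K = 0 := by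
  have h1 : ∫⁻ z in K, dens z = 0 := by
    rw [hyp, withDensity_apply _ hKm, Measure.restrict_restrict hKm,
      inter_eq_left.2 hKD] at h0
    exact h0
  rw [lintegral_eq_zero_iff dens_measurable] at h1
  have h2 : ∀ᵐ z ∂(volume.restrict K), False := by
    filter_upwards [h1, ae_restrict_mem hKm] with z hz hzK
    have := mem_unitDisc.1 (hKD hzK)
    have h3 : 0 < 1 - ‖z‖ ^ 2 := by nlinarith [norm_nonneg z]
    simp only [dens, Pi.zero_apply, ENNReal.ofReal_eq_zero] at hz
    have : 0 < ((1 - ‖z‖ ^ 2) ^ 2)⁻¹ := by positivity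
    linarith
  simpa using h2

end

section
open scoped Topology ENNReal ComplexConjugate

open MeasureTheory

lemma IsCocompactFuchsian.countable {Γ : Type*} [Group Γ] {ρ : Γ → ℂ → ℂ}
    (hΓ : IsCocompactFuchsian Γ ρ) : Countable Γ := by
  have hfin : ∀ n : ℕ, {γ : Γ | ((ρ γ '' closedBall 0 (1 - 1 / ((n:ℝ) + 1))) ∩
      closedBall 0 (1 - 1 / ((n:ℝ) + 1))).Nonempty}.Finite := by
    intro n
    apply hΓ.properly_discontinuous _ _ (isCompact_closedBall _ _)
    apply closedBall_subset_ball
    have : 0 < 1 / ((n:ℝ) + 1) := by positivity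
    linarith
  rw [← countable_univ_iff]
  refine (countable_iUnion fun n => (hfin n).countable).mono ?_
  intro γ _
  have h1 := mem_unitDisc.1 (hΓ.maps_disc γ 0 zero_mem_unitDisc)
  obtain ⟨n, hn⟩ := exists_nat_one_div_lt (sub_pos.2 h1)
  refine mem_iUnion.2 ⟨n, ρ γ 0, ⟨0, ?_, rfl⟩, ?_⟩
  · simp only [mem_closedBall, dist_self]
    have := norm_nonneg (ρ γ 0)
    linarith
  · simp only [mem_closedBall, dist_zero_right]
    linarith

lemma exists_unfold_weight {Γ : Type*} [Group Γ] {ρ : Γ → ℂ → ℂ} (hΓ : IsCocompactFuchsian Γ ρ) :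
    ∃ ψ : ℂ → ℝ≥0∞, Measurable ψ ∧ ∫⁻ z, ψ z ∂hyp ≠ ∞ ∧ ¬ (∀ᵐ z ∂hyp, ψ z = 0) ∧
      ∀ k : ℂ → ℂ → ℝ≥0∞, Measurable (Function.uncurry k) →
        (∀ γ, ∀ z ∈ unitDisc, ∀ w ∈ unitDisc, k (ρ γ z) (ρ γ w) = k z w) →
        ∫⁻ z, ψ z * ∫⁻ w, k z w ∂hyp ∂hyp = ∫⁻ z, ψ z * ∫⁻ w, k w z ∂hyp ∂hyp := by
  have := hΓ.countable
  choose a b hab hρ using hΓ.moebius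
  let A : Γ → ℂ → ℂ := fun γ => mob (a γ) (b γ)
  have hA : ∀ γ, ∀ z ∈ unitDisc, ρ γ z = A γ z := hρ
  have hAm : ∀ γ, Measurable (A γ) := fun γ => mob_measurable _ _
  have hAD : ∀ γ, ∀ z ∈ unitDisc, A γ z ∈ unitDisc := fun γ z hz => mob_mem (hab γ) hz
  have hAmul : ∀ γ₁ γ₂, ∀ z ∈ unitDisc, A (γ₁ * γ₂) z = A γ₁ (A γ₂ z) := by
    intro γ₁ γ₂ z hz
    rw [← hA _ z hz, hΓ.mul_act _ _ z hz, hA _ z hz, hA _ _ (hAD _ z hz)]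
  have hAone : ∀ z ∈ unitDisc, A 1 z = z := fun z hz => by rw [← hA _ z hz, hΓ.one_act z hz]
  obtain ⟨K₀, hK₀D, hK₀, hcov₀⟩ := hΓ.cocompact
  let K := K₀ ∪ closedBall 0 (1/2)
  have hK : IsCompact K := hK₀.union (isCompact_closedBall _ _)
  have hKD : K ⊆ unitDisc := union_subset hK₀D (closedBall_subset_ball (by norm_num))
  have hcov : ∀ z ∈ unitDisc, ∃ γ, A γ z ∈ K := by
    intro z hz
    obtain ⟨γ, h⟩ := hcov₀ z hz
    exact ⟨γ, Or.inl (by rwa [← hA γ z hz])⟩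
  let χ : ℂ → ℝ≥0∞ := K.indicator 1
  have hχm : Measurable χ := measurable_one.indicator hK.measurableSet
  let N : ℂ → ℝ≥0∞ := fun z => ∑' γ, χ (A γ z)
  have hNm : Measurable N := Measurable.tsum fun γ => hχm.comp (hAm γ)
  have hN1 : ∀ z ∈ unitDisc, 1 ≤ N z := by
    intro z hz
    obtain ⟨γ, h⟩ := hcov z hz
    have : χ (A γ z) = 1 := by simp [χ, h]
    rw [← this]
    exact ENNReal.le_tsum γ
  have hNtop : ∀ z ∈ unitDisc, N z ≠ ∞ := by
    intro z hz
    have hfin := hΓ.properly_discontinuous (insert z K)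
      (insert_subset hz hKD) (hK.insert z)
    have : N z = ∑ γ ∈ hfin.toFinset, χ (A γ z) := by
      refine tsum_eq_sum fun γ hγ => ?_
      simp only [χ]
      rw [indicator_of_notMem]
      intro hmem
      apply hγ
      rw [Set.Finite.mem_toFinset]
      exact ⟨ρ γ z, ⟨z, mem_insert _ _, rfl⟩, mem_insert_of_mem _ (by rwa [hA γ z hz])⟩
    rw [this]
    refine (ENNReal.sum_lt_top.2 fun γ _ => ?_).ne
    by_cases h : A γ z ∈ K <;> simp [χ, h]
  have hNinv : ∀ γ, ∀ z ∈ unitDisc, N (A γ z) = N z := by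
    intro γ z hz
    simp only [N]
    rw [← (Equiv.mulRight γ).tsum_eq (fun γ' => χ (A γ' z))]
    refine tsum_congr fun γ' => ?_
    rw [Equiv.coe_mulRight, hAmul _ _ z hz]
  let ψ : ℂ → ℝ≥0∞ := fun z => χ z / N z
  have hψm : Measurable ψ := hχm.div hNm
  have hsum : ∀ z ∈ unitDisc, ∑' γ, ψ (A γ z) = 1 := by
    intro z hz
    have : ∀ γ, ψ (A γ z) = χ (A γ z) * (N z)⁻¹ := fun γ => by
      simp only [ψ, hNinv γ z hz, div_eq_mul_inv]
    simp only [this]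
    rw [ENNReal.tsum_mul_right]
    exact ENNReal.mul_inv_cancel (zero_lt_one.trans_le (hN1 z hz)).ne' (hNtop z hz)
  refine ⟨ψ, hψm, ?_, ?_, ?_⟩
  · have : ∫⁻ z, ψ z ∂hyp ≤ ∫⁻ z, K.indicator 1 z ∂hyp := by
      refine lintegral_mono_ae ?_
      filter_upwards [hyp_ae_mem] with z hz
      exact ENNReal.div_le_of_le_mul (le_mul_of_one_le_right zero_le (hN1 z hz))
    rw [lintegral_indicator_one hK.measurableSet] at this
    exact (this.trans_lt (hyp_compact_lt_top hK hKD)).ne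
  · intro h0
    have h1 : hyp K = 0 := by
      rw [← nonpos_iff_eq_zero]
      have : ∀ᵐ z ∂hyp, z ∉ K := by
        filter_upwards [h0, hyp_ae_mem] with z hz hzD hzK
        simp only [ψ, χ, indicator_of_mem hzK, Pi.one_apply, ENNReal.div_eq_zero_iff] at hz
        rcases hz with hz | hz
        · exact one_ne_zero hz
        · exact hNtop z hzD hz
      rw [ae_iff] at this
      simpa using this.le
    have h2 := hyp_pos_of_volume_pos hK.measurableSet hKD h1
    have h3 : volume (ball (0:ℂ) (1/2)) ≤ volume K :=
      measure_mono (ball_subset_closedBall.trans subset_union_right)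
    have h4 := measure_ball_pos volume (0:ℂ) (show (0:ℝ) < 1/2 by norm_num)
    rw [h2] at h3
    exact absurd (h4.trans_le h3) (lt_irrefl _)
  · intro k hk hkinv
    have hkinv' : ∀ γ, ∀ z ∈ unitDisc, ∀ w ∈ unitDisc, k (A γ z) (A γ w) = k z w := by
      intro γ z hz w hw
      rw [← hA γ z hz, ← hA γ w hw, hkinv γ z hz w hw]
    have hk' : Measurable fun p : ℂ × ℂ => k p.1 p.2 := hk
    have hkz : ∀ z, Measurable (k z) := fun z => hk'.comp measurable_prodMk_left
    -- measurability of the summands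
    have m1 : ∀ γ, Measurable fun p : ℂ × ℂ => ψ p.1 * (ψ (A γ p.2) * k p.1 p.2) := fun γ =>
      (hψm.comp measurable_fst).mul (((hψm.comp (hAm γ)).comp measurable_snd).mul hk')
    have m2 : ∀ γ, Measurable fun p : ℂ × ℂ => ψ (A γ p.1) * (ψ p.2 * k p.1 p.2) := fun γ =>
      ((hψm.comp (hAm γ)).comp measurable_fst).mul ((hψm.comp measurable_snd).mul hk')
    have step1 : ∫⁻ z, ψ z * ∫⁻ w, k z w ∂hyp ∂hyp =
        ∑' γ, ∫⁻ z, ∫⁻ w, ψ z * (ψ (A γ w) * k z w) ∂hyp ∂hyp := by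
      rw [← lintegral_tsum (fun γ => (m1 γ).lintegral_prod_right'.aemeasurable)]
      refine lintegral_congr fun z => ?_
      change ψ z * ∫⁻ w, k z w ∂hyp = ∑' γ, ∫⁻ w, ψ z * (ψ (A γ w) * k z w) ∂hyp
      rw [← lintegral_tsum (f := fun γ w => ψ z * (ψ (A γ w) * k z w))
          (fun γ => ((m1 γ).comp measurable_prodMk_left).aemeasurable),
        ← lintegral_const_mul _ (hkz z)]
      refine lintegral_congr_ae ?_
      filter_upwards [hyp_ae_mem] with w hw
      rw [ENNReal.tsum_mul_left, ENNReal.tsum_mul_right, hsum w hw, one_mul]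
    have step2 : ∫⁻ z, ψ z * ∫⁻ w, k w z ∂hyp ∂hyp =
        ∑' γ, ∫⁻ z, ∫⁻ w, ψ (A γ z) * (ψ w * k z w) ∂hyp ∂hyp := by
      rw [← lintegral_tsum (fun γ => (m2 γ).lintegral_prod_right'.aemeasurable)]
      have : ∫⁻ z, ψ z * ∫⁻ w, k w z ∂hyp ∂hyp = ∫⁻ z, ∫⁻ w, ψ w * k z w ∂hyp ∂hyp := by
        rw [lintegral_lintegral_swap]
        · refine lintegral_congr fun z => ?_
          rw [lintegral_const_mul]
          exact hk'.comp measurable_prodMk_right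
        · exact ((hψm.comp measurable_snd).mul hk').aemeasurable
      rw [this]
      refine lintegral_congr_ae ?_
      filter_upwards [hyp_ae_mem] with z hz
      change _ = ∑' γ, ∫⁻ w, ψ (A γ z) * (ψ w * k z w) ∂hyp
      rw [← lintegral_tsum (f := fun γ w => ψ (A γ z) * (ψ w * k z w))
        (fun γ => ((m2 γ).comp measurable_prodMk_left).aemeasurable)]
      refine lintegral_congr fun w => ?_
      rw [ENNReal.tsum_mul_right, hsum z hz, one_mul]
    rw [step1, step2, ← (Equiv.inv Γ).tsum_eq]
    refine tsum_congr fun γ => ?_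
    simp only [Equiv.inv_apply]
    rw [← hyp_mob (hab γ) (m1 γ⁻¹).lintegral_prod_right']
    refine lintegral_congr_ae ?_
    filter_upwards [hyp_ae_mem] with z hz
    change ∫⁻ w, ψ (A γ z) * (ψ (A γ⁻¹ w) * k (A γ z) w) ∂hyp = _
    rw [← hyp_mob (hab γ) (k := fun w => ψ (A γ z) * (ψ (A γ⁻¹ w) * k (A γ z) w))
      ((m1 γ⁻¹).comp measurable_prodMk_left)]
    refine lintegral_congr_ae ?_
    filter_upwards [hyp_ae_mem] with w hw
    change ψ (A γ z) * (ψ (A γ⁻¹ (A γ w)) * k (A γ z) (A γ w)) = _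
    rw [hkinv' γ z hz w hw, ← hAmul _ _ w hw, inv_mul_cancel, hAone w hw]

end

section
open scoped Topology ENNReal ComplexConjugate

open MeasureTheory

lemma IsActionByHomeomorphisms.injective {Γ : Type*} [Group Γ] {X : Type*} [TopologicalSpace X]
    {σ : Γ → X → X} (hσ : IsActionByHomeomorphisms Γ X σ) (γ : Γ) : Function.Injective (σ γ) := by
  intro x y h
  have := congrArg (σ γ⁻¹) h
  rwa [← hσ.mul_act, ← hσ.mul_act, inv_mul_cancel, hσ.one_act, hσ.one_act] at this

lemma interval_strictMono {Γ : Type*} [Group Γ] {τ : Γ → unitInterval → unitInterval}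
    (hτ : IsActionByHomeomorphisms Γ unitInterval τ) (h0 : ∀ γ, τ γ 0 = 0)
    (h1 : ∀ γ, τ γ 1 = 1) (γ : Γ) : StrictMono (τ γ) := by
  apply (hτ.continuous_act γ).strictMono_of_inj_boundedOrder _ (hτ.injective γ)
  change τ γ 0 ≤ τ γ 1
  rw [h0, h1]
  exact zero_le_one

lemma interval_monotone {Γ : Type*} [Group Γ] {ρ : Γ → ℂ → ℂ} (hΓ : IsCocompactFuchsian Γ ρ)
    {τ : Γ → unitInterval → unitInterval}
    (hτ : IsActionByHomeomorphisms Γ unitInterval τ) (h0 : ∀ γ, τ γ 0 = 0)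
    (h1 : ∀ γ, τ γ 1 = 1) {F : ℂ → unitInterval → ℝ}
    (hcont : ContinuousOn (fun p : ℂ × unitInterval => F p.1 p.2)
      (unitDisc ×ˢ (univ : Set unitInterval)))
    (hharm : ∀ x, HarmonicOnSet (fun z => F z x) unitDisc)
    (hinv : ∀ γ : Γ, ∀ z ∈ unitDisc, ∀ x, F (ρ γ z) (τ γ x) = F z x)
    (hF0 : ∀ z ∈ unitDisc, F z 0 = 0) (hF1 : ∀ z ∈ unitDisc, F z 1 = 1)
    (hconst : ∀ x, (∀ z ∈ unitDisc, F z x = F 0 x) → x = 0 ∨ x = 1) :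
    ∀ z ∈ unitDisc, Monotone (F z) := by
  have hmono := interval_strictMono hτ h0 h1
  let τ2 : Γ → unitInterval × unitInterval → unitInterval × unitInterval := fun γ p => (τ γ p.1, τ γ p.2)
  let G : ℂ → unitInterval × unitInterval → ℝ := fun z p => F z p.2 - F z p.1
  have hc1 : ContinuousOn (fun p : ℂ × unitInterval × unitInterval => F p.1 p.2.1) (unitDisc ×ˢ (univ : Set (unitInterval × unitInterval))) :=
    hcont.comp (f := fun p : ℂ × unitInterval × unitInterval => (p.1, p.2.1)) (by fun_prop)
      (fun p hp => ⟨hp.1, mem_univ _⟩)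
  have hc2 : ContinuousOn (fun p : ℂ × unitInterval × unitInterval => F p.1 p.2.2) (unitDisc ×ˢ (univ : Set (unitInterval × unitInterval))) :=
    hcont.comp (f := fun p : ℂ × unitInterval × unitInterval => (p.1, p.2.2)) (by fun_prop)
      (fun p hp => ⟨hp.1, mem_univ _⟩)
  have hGc : ContinuousOn (fun p : ℂ × unitInterval × unitInterval => G p.1 p.2) (unitDisc ×ˢ (univ : Set (unitInterval × unitInterval))) :=
    hc2.sub hc1
  have hGinv : ∀ γ : Γ, ∀ z ∈ unitDisc, ∀ x, G (ρ γ z) (τ2 γ x) = G z x := by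
    intro γ z hz x
    simp only [G, τ2, hinv γ z hz]
  obtain ⟨y, hyA, hyc, hymin⟩ := exists_const_min hΓ τ2 G hGc
    (fun x => (hharm x.2).sub (hharm x.1)) hGinv {p | p.1 ≤ p.2}
    (isClosed_le continuous_fst continuous_snd) ⟨(0, 0), le_refl (0 : unitInterval)⟩
    (fun γ x hx => (hmono γ).monotone hx)
  have hm : 0 ≤ G 0 y := by
    by_contra hneg
    push Not at hneg
    let A2 : Set (unitInterval × unitInterval) := {p | p.1 ≤ p.2} ∩ ⋂ z ∈ unitDisc, {p | G z p = G 0 y}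
    have hA2c : IsClosed A2 := by
      refine (isClosed_le continuous_fst continuous_snd).inter ?_
      refine isClosed_biInter fun z hz => ?_
      refine isClosed_eq ?_ continuous_const
      exact hGc.comp_continuous (f := fun p : unitInterval × unitInterval => (z, p)) (by fun_prop)
        (fun p => ⟨hz, mem_univ _⟩)
    obtain ⟨q, hqA, hqc, -⟩ := exists_const_max hΓ τ2 (fun z p => F z p.1) hc1
      (fun x => hharm x.1) (fun γ z hz x => hinv γ z hz x.1) A2 hA2c
      ⟨y, hyA, by simpa using hyc⟩ (by
        rintro γ x ⟨hx1, hx2⟩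
        refine ⟨(hmono γ).monotone hx1, ?_⟩
        simp only [mem_iInter, mem_ofPred_eq] at hx2 ⊢
        intro z hz
        have hz' := hΓ.maps_disc γ⁻¹ z hz
        rw [← hx2 _ hz', ← hGinv γ _ hz', ← hΓ.mul_act _ _ z hz, mul_inv_cancel,
          hΓ.one_act z hz])
    obtain ⟨hq1, hq2⟩ := hqA
    simp only [mem_iInter, mem_ofPred_eq] at hq1 hq2
    have hG : G 0 q = G 0 y := hq2 0 zero_mem_unitDisc
    have h00 := hF0 0 zero_mem_unitDisc
    have h01 := hF1 0 zero_mem_unitDisc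
    have hc : ∀ z ∈ unitDisc, F z q.2 = F 0 q.2 := by
      intro z hz
      have e1 := hqc z hz
      have e2 := (hq2 z hz).trans hG.symm
      simp only [G] at e1 e2
      linarith
    simp only [G] at hG hneg
    rcases hconst _ hqc with h | h <;> rcases hconst _ hc with h' | h'
    · rw [h, h'] at hG; linarith
    · rw [h, h'] at hG; linarith
    · rw [h, h'] at hq1; exact absurd hq1 (by simp)
    · rw [h, h'] at hG; linarith
  intro z hz x x' hxx'
  have := hymin (x, x') hxx' z hz
  simp only [G] at this hm
  linarith

end

section
open scoped Topology ENNReal ComplexConjugate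

open MeasureTheory

/-- A measurable family of continuous cumulative distribution functions on `[0,1]`. -/
structure CDFFam where
  H : ℂ → unitInterval → ℝ
  cont : ∀ z, Continuous (H z)
  mono : ∀ z, Monotone (H z)
  zero : ∀ z, H z 0 = 0
  one : ∀ z, H z 1 = 1
  meas : ∀ x, Measurable fun z => H z x

namespace CDFFam
variable (c : CDFFam)

lemma nonneg (z : ℂ) (x : unitInterval) : 0 ≤ c.H z x := by
  rw [← c.zero z]; exact c.mono z unitInterval.nonneg'

lemma le_one (z : ℂ) (x : unitInterval) : c.H z x ≤ 1 := by
  rw [← c.one z]; exact c.mono z unitInterval.le_one'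

def stieltjes (z : ℂ) : StieltjesFunction unitInterval where
  toFun := c.H z
  mono' := c.mono z
  right_continuous' := fun _ => (c.cont z).continuousWithinAt

def nu (z : ℂ) : Measure unitInterval := (c.stieltjes z).measure

lemma tendsto_bot (z : ℂ) : Tendsto (c.stieltjes z) atBot (𝓝 0) := by
  rw [atBot_eq_pure_of_isBot isBot_bot]
  have : (c.stieltjes z) ⊥ = 0 := c.zero z
  have h := tendsto_pure_nhds (c.stieltjes z) ⊥
  simp only [this] at h
  exact h

lemma tendsto_top (z : ℂ) : Tendsto (c.stieltjes z) atTop (𝓝 1) := by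
  rw [atTop_eq_pure_of_isTop isTop_top]
  have : (c.stieltjes z) ⊤ = 1 := c.one z
  have h := tendsto_pure_nhds (c.stieltjes z) ⊤
  simp only [this] at h
  exact h

lemma nu_Iic (z : ℂ) (x : unitInterval) : c.nu z (Iic x) = ENNReal.ofReal (c.H z x) := by
  rw [nu, StieltjesFunction.measure_Iic _ (c.tendsto_bot z), sub_zero]
  rfl

instance (z : ℂ) : IsProbabilityMeasure (c.nu z) :=
  StieltjesFunction.isProbabilityMeasure _ (c.tendsto_bot z) (c.tendsto_top z)

lemma nu_Ioo (z : ℂ) : c.nu z (Ioo 0 1) = 1 := by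
  have h : Function.leftLim (c.stieltjes z) (1 : unitInterval) = 1 := by
    have := (c.cont z).continuousAt.continuousWithinAt.leftLim_eq (a := (1 : unitInterval))
    exact this.trans (c.one z)
  rw [nu, StieltjesFunction.measure_Ioo, h]
  have : (c.stieltjes z) 0 = 0 := c.zero z
  rw [this]
  simp

lemma nu_measurable : Measurable c.nu := by
  refine Measurable.measure_of_isPiSystem_of_isProbabilityMeasure
    ((borel_eq_generateFrom_Iic unitInterval).symm ▸ BorelSpace.measurable_eq) isPiSystem_Iic ?_
  rintro _ ⟨x, rfl⟩
  simp_rw [nu_Iic]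
  exact (c.meas x).ennreal_ofReal

/-- The cdf as an extended nonnegative real. -/
def a (z : ℂ) (t : unitInterval) : ℝ≥0∞ := ENNReal.ofReal (c.H z t)

lemma H_measurable : Measurable fun p : ℂ × unitInterval => c.H p.1 p.2 := by
  have := measurable_uncurry_of_continuous_of_measurable (u := fun x z => c.H z x)
    c.cont c.meas
  exact this.comp measurable_swap

lemma a_measurable : Measurable fun p : ℂ × unitInterval => c.a p.1 p.2 :=
  c.H_measurable.ennreal_ofReal

lemma lintegral_measurable {g : ℂ × ℂ → unitInterval → ℝ≥0∞}
    (hg : Measurable (Function.uncurry g)) :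
    Measurable fun p : ℂ × ℂ => ∫⁻ t, g p t ∂(c.nu p.1) := by
  let κ : ProbabilityTheory.Kernel (ℂ × ℂ) unitInterval :=
    ⟨fun p => c.nu p.1, c.nu_measurable.comp measurable_fst⟩
  have : ProbabilityTheory.IsMarkovKernel κ := ⟨fun p => by
    change IsProbabilityMeasure (c.nu p.1); infer_instance⟩
  exact hg.lintegral_kernel_prod_right (κ := κ)

def T (z w : ℂ) : ℝ≥0∞ := ∫⁻ t, c.a w t ^ 2 ∂(c.nu z)

lemma T_measurable : Measurable fun p : ℂ × ℂ => c.T p.1 p.2 :=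
  c.lintegral_measurable (g := fun p t => c.a p.2 t ^ 2)
    ((c.a_measurable.comp (measurable_snd.comp measurable_fst |>.prodMk measurable_snd)).pow_const 2)

lemma T_le_one (z w : ℂ) : c.T z w ≤ 1 := by
  have : c.T z w ≤ ∫⁻ _, 1 ∂(c.nu z) := by
    refine lintegral_mono fun t => ?_
    have : c.a w t ≤ 1 := by
      rw [a]; exact ENNReal.ofReal_le_one.2 (c.le_one w t)
    exact pow_le_one' this 2
  simpa using this

lemma pk_nu (hharm : ∀ x, HarmonicOnSet (fun z => c.H z x) unitDisc) {r : ℝ} (hr : r < 1)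
    {z : ℂ} (hz : z ∈ unitDisc) {g : unitInterval → ℝ≥0∞} (hg : Measurable g) :
    ∫⁻ w, pk r z w * ∫⁻ t, g t ∂(c.nu w) ∂hyp = ck r * ∫⁻ t, g t ∂(c.nu z) := by
  have hpm : Measurable (pk r z) := (pk_measurable r).comp measurable_prodMk_left
  have key : ck r • c.nu z = (hyp.withDensity (pk r z)).bind c.nu := by
    have : IsFiniteMeasure (ck r • c.nu z) :=
      Measure.smul_finite _ (ck_lt_top hr).ne
    refine Measure.ext_of_Iic _ _ fun x => ?_
    rw [Measure.bind_apply measurableSet_Iic c.nu_measurable.aemeasurable,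
      lintegral_withDensity_eq_lintegral_mul _ hpm (g := fun w => c.nu w (Iic x))
        ((Measure.measurable_coe measurableSet_Iic).comp c.nu_measurable)]
    simp only [Measure.smul_apply, smul_eq_mul, Pi.mul_apply, nu_Iic]
    rw [pk_mean (hharm x) (fun w _ => c.nonneg w x) (c.meas x) r hz]
  have h2 : Measurable fun w => ∫⁻ t, g t ∂(c.nu w) :=
    (Measure.measurable_lintegral hg).comp c.nu_measurable
  have : ∫⁻ t, g t ∂(ck r • c.nu z) = _ := congrArg (fun m => ∫⁻ t, g t ∂m) key
  rw [Measure.lintegral_bind c.nu_measurable.aemeasurable hg.aemeasurable,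
    lintegral_withDensity_eq_lintegral_mul _ hpm h2, lintegral_smul_measure] at this
  exact this.symm

lemma nu_map {Γ : Type*} [Group Γ] {ρ : Γ → ℂ → ℂ} {τ : Γ → unitInterval → unitInterval}
    (hτ : IsActionByHomeomorphisms Γ unitInterval τ) (hmono : ∀ γ, StrictMono (τ γ))
    (hinv : ∀ γ : Γ, ∀ z ∈ unitDisc, ∀ x, c.H (ρ γ z) (τ γ x) = c.H z x) (γ : Γ)
    {z : ℂ} (hz : z ∈ unitDisc) : c.nu (ρ γ z) = (c.nu z).map (τ γ) := by
  refine Measure.ext_of_Iic _ _ fun x => ?_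
  obtain ⟨y, rfl⟩ : ∃ y, τ γ y = x :=
    ⟨τ γ⁻¹ x, by rw [← hτ.mul_act, mul_inv_cancel, hτ.one_act]⟩
  rw [Measure.map_apply (hτ.continuous_act γ).measurable measurableSet_Iic]
  have : τ γ ⁻¹' Iic (τ γ y) = Iic y := by
    ext t; simp [(hmono γ).le_iff_le]
  rw [this, nu_Iic, nu_Iic, hinv γ z hz]

lemma T_inv {Γ : Type*} [Group Γ] {ρ : Γ → ℂ → ℂ} {τ : Γ → unitInterval → unitInterval}
    (hτ : IsActionByHomeomorphisms Γ unitInterval τ) (hmono : ∀ γ, StrictMono (τ γ))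
    (hinv : ∀ γ : Γ, ∀ z ∈ unitDisc, ∀ x, c.H (ρ γ z) (τ γ x) = c.H z x) (γ : Γ)
    {z w : ℂ} (hz : z ∈ unitDisc) (hw : w ∈ unitDisc) : c.T (ρ γ z) (ρ γ w) = c.T z w := by
  have hm : ∀ w, Measurable (c.a w) := fun w => c.a_measurable.comp measurable_prodMk_left
  rw [T, c.nu_map hτ hmono hinv γ hz,
    lintegral_map ((hm _).pow_const 2) (hτ.continuous_act γ).measurable]
  simp only [a, hinv γ w hw, T]

/-- the energy density -/
def en (r : ℝ) (z : ℂ) : ℝ≥0∞ :=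
  ∫⁻ w, pk r z w * ∫⁻ t, ENNReal.ofReal ((c.H w t - c.H z t) ^ 2) ∂(c.nu z) ∂hyp

lemma sq_measurable : Measurable fun p : (ℂ × ℂ) × unitInterval =>
    ENNReal.ofReal ((c.H p.1.2 p.2 - c.H p.1.1 p.2) ^ 2) := by
  have h1 : Measurable fun p : (ℂ × ℂ) × unitInterval => c.H p.1.2 p.2 :=
    c.H_measurable.comp ((measurable_snd.comp measurable_fst).prodMk measurable_snd)
  have h2 : Measurable fun p : (ℂ × ℂ) × unitInterval => c.H p.1.1 p.2 :=
    c.H_measurable.comp ((measurable_fst.comp measurable_fst).prodMk measurable_snd)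
  exact ((h1.sub h2).pow_const 2).ennreal_ofReal

lemma en_measurable (r : ℝ) : Measurable (c.en r) := by
  have : Measurable fun p : ℂ × ℂ =>
      pk r p.1 p.2 * ∫⁻ t, ENNReal.ofReal ((c.H p.2 t - c.H p.1 t) ^ 2) ∂(c.nu p.1) :=
    (pk_measurable r).mul (c.lintegral_measurable
      (g := fun p t => ENNReal.ofReal ((c.H p.2 t - c.H p.1 t) ^ 2)) c.sq_measurable)
  exact this.lintegral_prod_right'

lemma en_eq (hharm : ∀ x, HarmonicOnSet (fun z => c.H z x) unitDisc) {r : ℝ} (hr : r < 1)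
    {z : ℂ} (hz : z ∈ unitDisc) :
    c.en r z + ck r * c.T z z = ∫⁻ w, pk r z w * c.T z w ∂hyp := by
  have hm : ∀ w, Measurable (c.a w) := fun w => c.a_measurable.comp measurable_prodMk_left
  have hpm : Measurable (pk r z) := (pk_measurable r).comp measurable_prodMk_left
  have hTm : Measurable (c.T z) := c.T_measurable.comp measurable_prodMk_left
  have hsq : ∀ w, Measurable fun t => ENNReal.ofReal ((c.H w t - c.H z t) ^ 2) := fun w =>
    c.sq_measurable.comp (f := fun t => ((z, w), t)) measurable_prodMk_left
  have hzw : ∀ w, Measurable fun t => c.a z t * c.a w t := fun w => (hm z).mul (hm w)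
  have hpt : ∀ w t, ENNReal.ofReal ((c.H w t - c.H z t) ^ 2) + 2 * (c.a z t * c.a w t) =
      c.a w t ^ 2 + c.a z t ^ 2 := by
    intro w t
    have h1 := c.nonneg w t
    have h2 := c.nonneg z t
    rw [a, a, ← ENNReal.ofReal_mul h2, ← ENNReal.ofReal_pow h1, ← ENNReal.ofReal_pow h2,
      ← ENNReal.ofReal_add (by positivity) (by positivity),
      show (2 : ℝ≥0∞) = ENNReal.ofReal 2 by simp, ← ENNReal.ofReal_mul (by norm_num),
      ← ENNReal.ofReal_add (by positivity) (by positivity)]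
    congr 1
    ring
  have hinteg : ∀ w, ∫⁻ t, ENNReal.ofReal ((c.H w t - c.H z t) ^ 2) ∂(c.nu z) +
      2 * ∫⁻ t, c.a z t * c.a w t ∂(c.nu z) = c.T z w + c.T z z := by
    intro w
    rw [T, T, ← lintegral_add_left ((hm w).pow_const 2),
      ← lintegral_const_mul _ (hzw w), ← lintegral_add_left (hsq w)]
    exact lintegral_congr fun t => hpt w t
  have hcross : ∫⁻ w, pk r z w * ∫⁻ t, c.a z t * c.a w t ∂(c.nu z) ∂hyp = ck r * c.T z z := by
    have e1 : ∀ w, pk r z w * ∫⁻ t, c.a z t * c.a w t ∂(c.nu z) =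
        ∫⁻ t, c.a z t * (pk r z w * c.a w t) ∂(c.nu z) := by
      intro w
      rw [← lintegral_const_mul _ (hzw w)]
      refine lintegral_congr fun t => ?_
      ring
    simp only [e1]
    have hmm : Measurable fun p : ℂ × unitInterval => c.a z p.2 * (pk r z p.1 * c.a p.1 p.2) :=
      ((hm z).comp measurable_snd).mul ((hpm.comp measurable_fst).mul c.a_measurable)
    rw [lintegral_lintegral_swap hmm.aemeasurable, T, ← lintegral_const_mul _ ((hm z).pow_const 2)]
    refine lintegral_congr fun t => ?_
    rw [lintegral_const_mul]
    · simp only [a]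
      rw [pk_mean (hharm t) (fun w _ => c.nonneg w t) (c.meas t) r hz]
      ring
    · exact hpm.mul (c.a_measurable.comp measurable_prodMk_right)
  have hone : ∫⁻ w, pk r z w ∂hyp = ck r := by
    have := pk_mean (H := fun _ => 1) (by
      intro z hz
      obtain ⟨s, hs, hsub, -⟩ := hharm 0 z hz
      exact ⟨s, hs, hsub, fun _ => 1, differentiableOn_const _, by simp⟩) (fun _ _ => zero_le_one)
      measurable_const r hz
    simpa using this
  have hfin : ck r * c.T z z ≠ ∞ :=
    ENNReal.mul_ne_top (ck_lt_top hr).ne ((c.T_le_one z z).trans_lt ENNReal.one_lt_top).ne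
  have hsqm : Measurable fun w => ∫⁻ t, ENNReal.ofReal ((c.H w t - c.H z t) ^ 2) ∂(c.nu z) :=
    (c.lintegral_measurable (g := fun p t => ENNReal.ofReal ((c.H p.2 t - c.H p.1 t) ^ 2))
      c.sq_measurable).comp measurable_prodMk_left
  have hcm : Measurable fun w => ∫⁻ t, c.a z t * c.a w t ∂(c.nu z) := by
    have hmm : Measurable fun p : ℂ × unitInterval => c.a z p.2 * c.a p.1 p.2 :=
      ((hm z).comp measurable_snd).mul c.a_measurable
    exact hmm.lintegral_prod_right'
  have total : c.en r z + 2 * (ck r * c.T z z) =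
      ∫⁻ w, pk r z w * c.T z w ∂hyp + ck r * c.T z z := by
    have m1 : Measurable fun w => pk r z w * ∫⁻ t, c.a z t * c.a w t ∂(c.nu z) := hpm.mul hcm
    have m2 : Measurable fun w => pk r z w *
      ∫⁻ t, ENNReal.ofReal ((c.H w t - c.H z t) ^ 2) ∂(c.nu z) := hpm.mul hsqm
    have m3 : Measurable fun w => pk r z w * c.T z w := hpm.mul hTm
    nth_rewrite 1 [← hcross]
    rw [en, ← lintegral_const_mul _ m1, ← lintegral_add_left m2,
      ← hone, ← lintegral_mul_const _ hpm, ← lintegral_add_left m3]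
    refine lintegral_congr fun w => ?_
    rw [← mul_add, ← hinteg w]
    ring
  rw [two_mul, ← add_assoc] at total
  exact (ENNReal.add_left_inj hfin).1 total

lemma energy_zero {Γ : Type*} [Group Γ] {ρ : Γ → ℂ → ℂ} (hΓ : IsCocompactFuchsian Γ ρ)
    {τ : Γ → unitInterval → unitInterval}
    (hτ : IsActionByHomeomorphisms Γ unitInterval τ) (hmono : ∀ γ, StrictMono (τ γ))
    (hharm : ∀ x, HarmonicOnSet (fun z => c.H z x) unitDisc)
    (hinv : ∀ γ : Γ, ∀ z ∈ unitDisc, ∀ x, c.H (ρ γ z) (τ γ x) = c.H z x) :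
    ∃ z ∈ unitDisc, ∀ n : ℕ, c.en (1 - 1 / ((n : ℝ) + 2)) z = 0 := by
  obtain ⟨ψ, hψm, hψtop, hψ0, hunf⟩ := exists_unfold_weight hΓ
  have hae : ∀ r < 1, ∀ᵐ z ∂hyp, ψ z * c.en r z = 0 := by
    intro r hr
    have hTT : Measurable fun z => c.T z z := c.T_measurable.comp (measurable_id.prodMk measurable_id)
    have hu := hunf (fun z w => pk r z w * c.T z w) ((pk_measurable r).mul c.T_measurable) (by
      intro γ z hz w hw
      obtain ⟨α, β, h, h'⟩ := hΓ.moebius γ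
      rw [c.T_inv hτ hmono hinv γ hz hw]
      congr 1
      rw [h' z hz, h' w hw]
      exact pk_mob h hz hw r)
    have hψe : Measurable fun z => ψ z * c.en r z := hψm.mul (c.en_measurable r)
    have e1 : ∫⁻ z, ψ z * ∫⁻ w, pk r z w * c.T z w ∂hyp ∂hyp =
        ∫⁻ z, ψ z * c.en r z ∂hyp + ∫⁻ z, ψ z * (ck r * c.T z z) ∂hyp := by
      rw [← lintegral_add_left hψe]
      refine lintegral_congr_ae ?_
      filter_upwards [hyp_ae_mem] with z hz
      rw [← c.en_eq hharm hr hz, mul_add]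
    have e2 : ∫⁻ z, ψ z * ∫⁻ w, pk r w z * c.T w z ∂hyp ∂hyp =
        ∫⁻ z, ψ z * (ck r * c.T z z) ∂hyp := by
      refine lintegral_congr_ae ?_
      filter_upwards [hyp_ae_mem] with z hz
      rw [T, ← c.pk_nu hharm hr hz (g := fun t => c.a z t ^ 2) ((c.a_measurable.comp measurable_prodMk_left).pow_const 2)]
      simp only [pk_symm r _ z]
      rfl
    have hfin : ∫⁻ z, ψ z * (ck r * c.T z z) ∂hyp ≠ ∞ := by
      have : ∫⁻ z, ψ z * (ck r * c.T z z) ∂hyp ≤ ∫⁻ z, ψ z * ck r ∂hyp := by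
        refine lintegral_mono fun z => ?_
        gcongr
        exact mul_le_of_le_one_right zero_le (c.T_le_one z z)
      rw [lintegral_mul_const _ hψm] at this
      exact (this.trans_lt (ENNReal.mul_lt_top hψtop.lt_top (ck_lt_top hr))).ne
    rw [e1, e2] at hu
    have h0 : ∫⁻ z, ψ z * c.en r z ∂hyp = 0 := by
      rw [← ENNReal.add_left_inj hfin, hu, zero_add]
    exact (lintegral_eq_zero_iff hψe).1 h0
  have hall : ∀ᵐ z ∂hyp, ∀ n : ℕ, ψ z * c.en (1 - 1 / ((n : ℝ) + 2)) z = 0 := by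
    rw [ae_all_iff]
    intro n
    apply hae
    have : 0 < 1 / ((n : ℝ) + 2) := by positivity
    linarith
  by_contra hcon
  push Not at hcon
  apply hψ0
  filter_upwards [hall, hyp_ae_mem] with z hz hzD
  obtain ⟨n, hn⟩ := hcon z hzD
  rcases mul_eq_zero.1 (hz n) with h | h
  · exact h
  · exact absurd h hn

end CDFFam

end

section
open scoped Topology ENNReal ComplexConjugate

open MeasureTheory

lemma disc_lt {z w : ℂ} (hz : z ∈ unitDisc) (hw : w ∈ unitDisc) :
    ‖z - w‖ < ‖1 - conj w * z‖ := by
  rw [mem_unitDisc] at hz hw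
  have h1 : ‖1 - conj w * z‖ ^ 2 - ‖z - w‖ ^ 2 = (1 - ‖z‖ ^ 2) * (1 - ‖w‖ ^ 2) := by
    simp only [Complex.sq_norm, Complex.normSq_apply, Complex.sub_re, Complex.sub_im,
      Complex.mul_re, Complex.mul_im, Complex.conj_re, Complex.conj_im, Complex.one_re,
      Complex.one_im]
    ring
  have h2 : 0 < (1 - ‖z‖ ^ 2) * (1 - ‖w‖ ^ 2) := by
    apply mul_pos <;> nlinarith [norm_nonneg z, norm_nonneg w]
  exact lt_of_pow_lt_pow_left₀ 2 (norm_nonneg _) (by linarith)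

lemma exists_pk_one {z w : ℂ} (hz : z ∈ unitDisc) (hw : w ∈ unitDisc) :
    ∃ n : ℕ, pk (1 - 1 / ((n : ℝ) + 2)) z w = 1 := by
  have h := disc_lt hz hw
  have hpos : 0 < ‖1 - conj w * z‖ := (norm_nonneg _).trans_lt h
  obtain ⟨n, hn⟩ := exists_nat_one_div_lt (show 0 < (‖1 - conj w * z‖ - ‖z - w‖) / ‖1 - conj w * z‖
    from div_pos (sub_pos.2 h) hpos)
  refine ⟨n, ?_⟩
  rw [pk, if_pos]
  rw [lt_div_iff₀ hpos] at hn
  have : 1 / ((n : ℝ) + 2) ≤ 1 / ((n : ℝ) + 1) := by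
    apply one_div_le_one_div_of_le <;> first | positivity | linarith
  nlinarith

lemma interval_liouville {Γ : Type*} [Group Γ] {ρ : Γ → ℂ → ℂ} (hΓ : IsCocompactFuchsian Γ ρ)
    {τ : Γ → unitInterval → unitInterval}
    (hτ : IsActionByHomeomorphisms Γ unitInterval τ) (h0 : ∀ γ, τ γ 0 = 0)
    (h1 : ∀ γ, τ γ 1 = 1) {F : ℂ → unitInterval → ℝ}
    (hcont : ContinuousOn (fun p : ℂ × unitInterval => F p.1 p.2)
      (unitDisc ×ˢ (univ : Set unitInterval)))
    (hharm : ∀ x, HarmonicOnSet (fun z => F z x) unitDisc)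
    (hinv : ∀ γ : Γ, ∀ z ∈ unitDisc, ∀ x, F (ρ γ z) (τ γ x) = F z x)
    (hF0 : ∀ z ∈ unitDisc, F z 0 = 0) (hF1 : ∀ z ∈ unitDisc, F z 1 = 1)
    (hconst : ∀ x, (∀ z ∈ unitDisc, F z x = F 0 x) → x = 0 ∨ x = 1) : False := by
  classical
  have hmono := interval_strictMono hτ h0 h1
  have hFmono := interval_monotone hΓ hτ h0 h1 hcont hharm hinv hF0 hF1 hconst
  have hFc : ∀ x, ContinuousOn (fun z => F z x) unitDisc := fun x =>
    hcont.comp (f := fun z => (z, x)) (by fun_prop) (fun z hz => ⟨hz, mem_univ _⟩)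
  let π : ℂ → ℂ := fun z => if z ∈ unitDisc then z else 0
  have hπ : ∀ z, π z ∈ unitDisc := by
    intro z
    by_cases h : z ∈ unitDisc
    · simp only [π, if_pos h, h]
    · simp only [π, if_neg h, zero_mem_unitDisc]
  have hπD : ∀ z ∈ unitDisc, π z = z := fun z hz => if_pos hz
  have hπm : Measurable π := Measurable.ite measurableSet_unitDisc measurable_id measurable_const
  let c : CDFFam :=
    { H := fun z x => F (π z) x
      cont := fun z => hcont.comp_continuous (f := fun x => (π z, x)) (by fun_prop)
        (fun x => ⟨hπ z, mem_univ _⟩)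
      mono := fun z => hFmono _ (hπ z)
      zero := fun z => hF0 _ (hπ z)
      one := fun z => hF1 _ (hπ z)
      meas := fun x => by
        have e1 : Measurable (unitDisc.domRestrict (fun z => F z x)) :=
          (hFc x).domRestrict.measurable
        exact e1.comp (hπm.subtype_mk (h := hπ)) }
  have hcH : ∀ z ∈ unitDisc, ∀ x, c.H z x = F z x := fun z hz x => by
    change F (π z) x = F z x
    rw [hπD z hz]
  have hcharm : ∀ x, HarmonicOnSet (fun z => c.H z x) unitDisc := by
    intro x z hz
    obtain ⟨s, hs, hsub, g, hg, hgF⟩ := hharm x z hz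
    exact ⟨s, hs, hsub, g, hg, fun w hw => (hcH w (hsub hw) x).trans (hgF w hw)⟩
  obtain ⟨z, hz, hen⟩ := c.energy_zero hΓ hτ hmono hcharm (by
    intro γ z hz x
    rw [hcH _ (hΓ.maps_disc γ z hz), hcH _ hz, hinv γ z hz])
  -- swap the integrals
  have hsw : ∀ n : ℕ, ∀ᵐ t ∂(c.nu z), ∫⁻ w, pk (1 - 1 / ((n : ℝ) + 2)) z w *
      ENNReal.ofReal ((c.H w t - c.H z t) ^ 2) ∂hyp = 0 := by
    intro n
    have hpm : Measurable (pk (1 - 1 / ((n : ℝ) + 2)) z) :=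
      (pk_measurable _).comp measurable_prodMk_left
    have hm : Measurable fun p : ℂ × unitInterval => pk (1 - 1 / ((n : ℝ) + 2)) z p.1 *
        ENNReal.ofReal ((c.H p.1 p.2 - c.H z p.2) ^ 2) :=
      (hpm.comp measurable_fst).mul (c.sq_measurable.comp
        (f := fun p : ℂ × unitInterval => ((z, p.1), p.2))
        ((measurable_const.prodMk measurable_fst).prodMk measurable_snd))
    have h := hen n
    rw [CDFFam.en] at h
    have e1 : ∀ w, pk (1 - 1 / ((n : ℝ) + 2)) z w *
        ∫⁻ t, ENNReal.ofReal ((c.H w t - c.H z t) ^ 2) ∂(c.nu z) =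
        ∫⁻ t, pk (1 - 1 / ((n : ℝ) + 2)) z w *
          ENNReal.ofReal ((c.H w t - c.H z t) ^ 2) ∂(c.nu z) := by
      intro w
      rw [lintegral_const_mul]
      exact c.sq_measurable.comp (f := fun t => ((z, w), t)) measurable_prodMk_left
    simp only [e1] at h
    rw [lintegral_lintegral_swap hm.aemeasurable] at h
    exact (lintegral_eq_zero_iff hm.lintegral_prod_left').1 h
  rw [← ae_all_iff] at hsw
  obtain ⟨t, ht, htI⟩ : ∃ t, (∀ n : ℕ, ∫⁻ w, pk (1 - 1 / ((n : ℝ) + 2)) z w *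
      ENNReal.ofReal ((c.H w t - c.H z t) ^ 2) ∂hyp = 0) ∧ t ∈ Ioo (0 : unitInterval) 1 := by
    have hI : ∃ᵐ t ∂(c.nu z), t ∈ Ioo (0 : unitInterval) 1 := by
      rw [frequently_ae_mem_iff, c.nu_Ioo]
      exact one_ne_zero
    obtain ⟨t, h1, h2⟩ := (hI.and_eventually hsw).exists
    exact ⟨t, h2, h1⟩
  have hae : ∀ᵐ w ∂hyp, F w t = F z t := by
    have : ∀ᵐ w ∂hyp, ∀ n : ℕ, pk (1 - 1 / ((n : ℝ) + 2)) z w *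
      ENNReal.ofReal ((c.H w t - c.H z t) ^ 2) = 0 := by
      rw [ae_all_iff]
      intro n
      refine (lintegral_eq_zero_iff ?_).1 (ht n)
      refine Measurable.mul ((pk_measurable _).comp measurable_prodMk_left) ?_
      exact (((c.meas t).sub measurable_const).pow_const 2).ennreal_ofReal
    filter_upwards [this, hyp_ae_mem] with w hw hwD
    obtain ⟨n, hn⟩ := exists_pk_one hz hwD
    have := hw n
    rw [hn, one_mul, ENNReal.ofReal_eq_zero, hcH w hwD, hcH z hz] at this
    have h2 : F w t - F z t = 0 := by
      apply pow_eq_zero_iff (two_ne_zero) |>.1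
      exact le_antisymm this (sq_nonneg _)
    linarith
  have hO : IsOpen (unitDisc ∩ (fun w => F w t) ⁻¹' {F z t}ᶜ) :=
    (hFc t).isOpen_inter_preimage Metric.isOpen_ball isOpen_compl_singleton
  have hO0 : hyp (unitDisc ∩ (fun w => F w t) ⁻¹' {F z t}ᶜ) = 0 := by
    rw [measure_eq_zero_iff_ae_notMem]
    filter_upwards [hae] with w hw hmem
    exact hmem.2 hw
  have hO1 := hyp_pos_of_volume_pos hO.measurableSet inter_subset_left hO0
  have hO2 := hO.measure_eq_zero_iff volume |>.1 hO1
  have hall : ∀ w ∈ unitDisc, F w t = F z t := by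
    intro w hw
    by_contra hne
    have : w ∈ unitDisc ∩ (fun w => F w t) ⁻¹' {F z t}ᶜ := ⟨hw, hne⟩
    rw [hO2] at this
    exact this
  rcases hconst t (fun w hw => (hall w hw).trans (hall 0 zero_mem_unitDisc).symm) with h | h
  · exact htI.1.ne' h
  · exact htI.2.ne h

end

section
open scoped Topology ENNReal ComplexConjugate

open MeasureTheory

lemma IsCocompactFuchsian.continuousOn {Γ : Type*} [Group Γ] {ρ : Γ → ℂ → ℂ}
    (hΓ : IsCocompactFuchsian Γ ρ) (γ : Γ) : ContinuousOn (ρ γ) unitDisc := by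
  obtain ⟨α, β, h, h'⟩ := hΓ.moebius γ
  have : ContinuousOn (mob α β) unitDisc := fun z hz =>
    (mob_hasDerivAt h hz).continuousAt.continuousWithinAt
  exact this.congr h'

lemma IsCocompactFuchsian.subgroup {Γ : Type*} [Group Γ] {ρ : Γ → ℂ → ℂ}
    (hΓ : IsCocompactFuchsian Γ ρ) (Γ' : Subgroup Γ) (t : Finset Γ)
    (ht : ∀ δ : Γ, ∃ γ ∈ t, γ⁻¹ * δ ∈ Γ') :
    IsCocompactFuchsian Γ' (fun γ => ρ (γ : Γ)) where
  one_act := hΓ.one_act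
  mul_act := fun γ₁ γ₂ => hΓ.mul_act γ₁ γ₂
  maps_disc := fun γ => hΓ.maps_disc γ
  moebius := fun γ => hΓ.moebius γ
  faithful := fun γ h => Subtype.ext (hΓ.faithful γ h)
  properly_discontinuous := fun K hKD hK =>
    (hΓ.properly_discontinuous K hKD hK).preimage (f := fun γ : Γ' => (γ : Γ))
      Subtype.coe_injective.injOn
  cocompact := by
    obtain ⟨K, hKD, hK, hcov⟩ := hΓ.cocompact
    refine ⟨⋃ γ ∈ t, ρ γ⁻¹ '' K, ?_, ?_, ?_⟩
    · refine iUnion₂_subset fun γ _ => ?_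
      rintro _ ⟨z, hz, rfl⟩
      exact hΓ.maps_disc _ z (hKD hz)
    · exact t.isCompact_biUnion fun γ _ => hK.image_of_continuousOn ((hΓ.continuousOn _).mono hKD)
    · intro z hz
      obtain ⟨δ, hδ⟩ := hcov z hz
      obtain ⟨γ, hγ, hmem⟩ := ht δ
      refine ⟨⟨_, hmem⟩, ?_⟩
      simp only [mem_iUnion]
      exact ⟨γ, hγ, ρ δ z, hδ, (hΓ.mul_act _ _ z hz).symm⟩

lemma no_gap {Γ : Type*} [Group Γ] {ρ : Γ → ℂ → ℂ} (hΓ : IsCocompactFuchsian Γ ρ)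
    {X : Type*} [TopologicalSpace X] [CompactSpace X] [T2Space X] [LocallyConnectedSpace X]
    {σ : Γ → X → X} (hσ : IsActionByHomeomorphisms Γ X σ)
    {f : ℂ → X → ℝ}
    (hcont : ContinuousOn (fun p : ℂ × X => f p.1 p.2) (unitDisc ×ˢ (univ : Set X)))
    (hharm : ∀ x : X, HarmonicOnSet (fun z => f z x) unitDisc)
    (hinv : ∀ γ : Γ, ∀ z ∈ unitDisc, ∀ x : X, f (ρ γ z) (σ γ x) = f z x)
    {φ : unitInterval → X} (hφ : Continuous φ) (hopen : IsOpen (φ '' Ioo 0 1))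
    (hinj : InjOn φ (Ioo 0 1))
    (hφ0 : ∀ z ∈ unitDisc, f z (φ 0) = f 0 (φ 0)) (hφ1 : ∀ z ∈ unitDisc, f z (φ 1) = f 0 (φ 1))
    (hφI : ∀ t ∈ Ioo (0 : unitInterval) 1, ¬ ∀ z ∈ unitDisc, f z (φ t) = f 0 (φ t)) : False := by
  have h0D := zero_mem_unitDisc
  have hfc : ∀ z ∈ unitDisc, Continuous (f z) := fun z hz =>
    hcont.comp_continuous (f := fun x => (z, x)) (by fun_prop) (fun x => ⟨hz, mem_univ _⟩)
  have hinv' : ∀ γ : Γ, ∀ z ∈ unitDisc, ∀ x : X, f z (σ γ x) = f (ρ γ⁻¹ z) x := by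
    intro γ z hz x
    rw [← hinv γ _ (hΓ.maps_disc γ⁻¹ z hz), ← hΓ.mul_act _ _ z hz, mul_inv_cancel,
      hΓ.one_act z hz]
  have hσinv : ∀ γ x, σ γ⁻¹ (σ γ x) = x := fun γ x => by
    rw [← hσ.mul_act, inv_mul_cancel, hσ.one_act]
  have hσinv' : ∀ γ x, σ γ (σ γ⁻¹ x) = x := fun γ x => by
    rw [← hσ.mul_act, mul_inv_cancel, hσ.one_act]
  let C : Set X := {x | ∀ z ∈ unitDisc, f z x = f 0 x}
  have hCσ : ∀ γ, ∀ x ∈ C, ∀ z ∈ unitDisc, f z (σ γ x) = f 0 x := by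
    intro γ x hx z hz
    rw [hinv' γ z hz]
    exact hx _ (hΓ.maps_disc _ z hz)
  have hCinv : ∀ γ, ∀ x ∈ C, σ γ x ∈ C := by
    intro γ x hx z hz
    rw [hCσ γ x hx z hz, hCσ γ x hx 0 h0D]
  let I : Set X := φ '' Ioo 0 1
  have hIC : ∀ x ∈ I, x ∉ C := by
    rintro _ ⟨t, ht, rfl⟩ h
    exact hφI t ht h
  let J : Γ → Set X := fun γ => σ γ '' I
  have hJC : ∀ γ, ∀ x ∈ J γ, x ∉ C := by
    rintro γ _ ⟨x, hx, rfl⟩ h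
    apply hIC x hx
    have := hCinv γ⁻¹ _ h
    rwa [hσinv] at this
  have hJopen : ∀ γ, IsOpen (J γ) := by
    intro γ
    have : J γ = σ γ⁻¹ ⁻¹' I := by
      ext x
      constructor
      · rintro ⟨y, hy, rfl⟩
        rw [mem_preimage, hσinv]
        exact hy
      · intro hx
        exact ⟨_, hx, hσinv' γ x⟩
    rw [this]
    exact hopen.preimage (hσ.continuous_act _)
  have hIconn : IsPreconnected I := isPreconnected_Ioo.image _ hφ.continuousOn
  have hJconn : ∀ γ, IsPreconnected (J γ) := fun γ =>
    hIconn.image _ (hσ.continuous_act γ).continuousOn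
  have hJfr : ∀ γ, ∀ x ∈ closure (J γ), x ∉ J γ → x = σ γ (φ 0) ∨ x = σ γ (φ 1) := by
    intro γ x hx hxJ
    have hc : IsClosed (range (σ γ ∘ φ)) :=
      (isCompact_range ((hσ.continuous_act γ).comp hφ)).isClosed
    have hsub : closure (J γ) ⊆ range (σ γ ∘ φ) := by
      refine closure_minimal ?_ hc
      rintro _ ⟨_, ⟨t, _, rfl⟩, rfl⟩
      exact ⟨t, rfl⟩
    obtain ⟨t, rfl⟩ := hsub hx
    by_cases h0 : t = 0
    · left; rw [h0]; rfl
    by_cases h1 : t = 1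
    · right; rw [h1]; rfl
    exact absurd ⟨φ t, ⟨t, ⟨unitInterval.pos_iff_ne_zero.2 h0,
      unitInterval.lt_one_iff_ne_one.2 h1⟩, rfl⟩, rfl⟩ hxJ
  have hJsub : ∀ γ δ, (J δ ∩ J γ).Nonempty → J δ ⊆ J γ := by
    intro γ δ hne
    refine (hJconn δ).subset_of_closure_inter_subset (hJopen γ) hne ?_
    rintro x ⟨hx1, hx2⟩
    by_contra hx3
    apply hJC δ x hx2
    rcases hJfr γ x hx1 hx3 with rfl | rfl
    · exact hCinv _ _ hφ0
    · exact hCinv _ _ hφ1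
  have hJeq : ∀ γ δ, (J δ ∩ J γ).Nonempty → J δ = J γ := fun γ δ hne =>
    (hJsub γ δ hne).antisymm (hJsub δ γ (by rwa [inter_comm]))
  let V : Set X := closure (⋃ γ, J γ)
  have hJV : ∀ γ, J γ ⊆ V := fun γ => (subset_iUnion J γ).trans subset_closure
  have hVinv : ∀ γ, ∀ x ∈ V, σ γ x ∈ V := by
    intro γ x hx
    refine map_mem_closure (hσ.continuous_act γ) hx ?_
    intro y hy
    simp only [mem_iUnion] at hy ⊢
    obtain ⟨δ, w, hw, rfl⟩ := hy
    exact ⟨γ * δ, w, hw, hσ.mul_act _ _ _⟩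
  have hhalf : ∃ t : unitInterval, t ∈ Ioo (0 : unitInterval) 1 := by
    exact exists_between zero_lt_one
  obtain ⟨th, hth⟩ := hhalf
  have hJ1 : J 1 = I := by
    ext x
    simp [J, hσ.one_act]
  have hVI : I ⊆ V := hJ1 ▸ hJV 1
  have hVne : V.Nonempty := ⟨φ th, hVI ⟨th, hth, rfl⟩⟩
  let c0 := f 0 (φ 0)
  let c1 := f 0 (φ 1)
  have hval : ∀ y ∈ V, (∀ γ, y ∉ J γ) → f 0 y = c0 ∨ f 0 y = c1 := by
    intro y hy hyJ
    have hW : y ∈ closure {x | ∃ γ, x = σ γ (φ 0) ∨ x = σ γ (φ 1)} := by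
      rw [mem_closure_iff_nhds]
      intro U hU
      obtain ⟨U', ⟨hU'o, hyU', hU'c⟩, hU'U⟩ :=
        (LocallyConnectedSpace.open_connected_basis y).mem_iff.1 hU
      obtain ⟨x, hxU, hx⟩ := mem_closure_iff.1 hy U' hU'o hyU'
      obtain ⟨γ, hxγ⟩ := mem_iUnion.1 hx
      by_contra hcon
      apply hyJ γ
      refine hU'c.isPreconnected.subset_of_closure_inter_subset (hJopen γ) ⟨x, hxU, hxγ⟩ ?_ hyU'
      rintro w ⟨hw1, hw2⟩
      by_contra hw3
      exact hcon ⟨w, hU'U hw2, γ, hJfr γ w hw1 hw3⟩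
    have hcl : IsClosed {x | f 0 x = c0 ∨ f 0 x = c1} :=
      (isClosed_eq (hfc 0 h0D) continuous_const).union
        (isClosed_eq (hfc 0 h0D) continuous_const)
    refine closure_minimal ?_ hcl hW
    rintro x ⟨γ, rfl | rfl⟩
    · left; exact hCσ γ _ hφ0 0 h0D
    · right; exact hCσ γ _ hφ1 0 h0D
  obtain ⟨y1, hy1V, hy1C, hy1⟩ := exists_const_max hΓ σ f hcont hharm hinv V isClosed_closure
    hVne hVinv
  obtain ⟨y2, hy2V, hy2C, hy2⟩ := exists_const_min hΓ σ f hcont hharm hinv V isClosed_closure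
    hVne hVinv
  have hne : c0 ≠ c1 := by
    intro heq
    apply hφI th hth
    have e1 : f 0 y1 = c0 := by
      rcases hval y1 hy1V (fun γ h => hJC γ y1 h hy1C) with h | h
      · exact h
      · rw [h, heq]
    have e2 : f 0 y2 = c0 := by
      rcases hval y2 hy2V (fun γ h => hJC γ y2 h hy2C) with h | h
      · exact h
      · rw [h, heq]
    have e3 : ∀ z ∈ unitDisc, f z (φ th) = c0 := fun z hz =>
      le_antisymm (e1 ▸ hy1 _ (hVI ⟨th, hth, rfl⟩) z hz) (e2 ▸ hy2 _ (hVI ⟨th, hth, rfl⟩) z hz)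
    intro z hz
    rw [e3 z hz, e3 0 h0D]
  -- finitely many translates
  let m := (c0 + c1) / 2
  have hm0 : m ≠ c0 := by
    intro h; apply hne; simp only [m] at h; linarith
  have hm1 : m ≠ c1 := by
    intro h; apply hne; simp only [m] at h; linarith
  have hQ : IsCompact (V ∩ {x | f 0 x = m}) :=
    (isClosed_closure.inter (isClosed_eq (hfc 0 h0D) continuous_const)).isCompact
  obtain ⟨t, ht⟩ := hQ.elim_finite_subcover J hJopen (by
    rintro y ⟨hyV, hym⟩
    by_contra hcon
    simp only [mem_iUnion, not_exists] at hcon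
    simp only [mem_ofPred_eq] at hym
    rcases hval y hyV hcon with h | h
    · exact hm0 (hym.symm.trans h)
    · exact hm1 (hym.symm.trans h))
  have hfin : ∀ δ, ∃ γ ∈ t, J δ = J γ := by
    intro δ
    have hg : Continuous fun s : unitInterval => f 0 (σ δ (φ s)) :=
      (hfc 0 h0D).comp ((hσ.continuous_act δ).comp hφ)
    have hg0 : f 0 (σ δ (φ 0)) = c0 := hCσ δ _ hφ0 0 h0D
    have hg1 : f 0 (σ δ (φ 1)) = c1 := hCσ δ _ hφ1 0 h0D
    have hmem : m ∈ uIcc (f 0 (σ δ (φ 0))) (f 0 (σ δ (φ 1))) := by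
      rw [hg0, hg1, mem_uIcc]
      rcases le_total c0 c1 with h | h
      · left; constructor <;> simp only [m] <;> linarith
      · right; constructor <;> simp only [m] <;> linarith
    obtain ⟨s, hs⟩ := mem_range_of_exists_le_of_exists_ge hg
      (c := m) (by
        rcases mem_uIcc.1 hmem with h | h
        · exact ⟨0, h.1⟩
        · exact ⟨1, h.1⟩) (by
        rcases mem_uIcc.1 hmem with h | h
        · exact ⟨1, h.2⟩
        · exact ⟨0, h.2⟩)
    have hs' : f 0 (σ δ (φ s)) = m := hs
    have hs0 : s ≠ 0 := by
      rintro rfl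
      exact hm0 (hs'.symm.trans hg0)
    have hs1 : s ≠ 1 := by
      rintro rfl
      exact hm1 (hs'.symm.trans hg1)
    have hsJ : σ δ (φ s) ∈ J δ := ⟨φ s, ⟨s, ⟨unitInterval.pos_iff_ne_zero.2 hs0,
      unitInterval.lt_one_iff_ne_one.2 hs1⟩, rfl⟩, rfl⟩
    have := ht ⟨hJV δ hsJ, hs'⟩
    simp only [mem_iUnion] at this
    obtain ⟨γ, hγ, hγJ⟩ := this
    exact ⟨γ, hγ, hJeq γ δ ⟨_, hsJ, hγJ⟩⟩
  -- the stabilizer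
  have hJmul : ∀ γ δ, J (γ * δ) = σ γ '' J δ := by
    intro γ δ
    simp only [J, image_image, hσ.mul_act]
  let Γ' : Subgroup Γ :=
    { carrier := {γ | J γ = I}
      one_mem' := hJ1
      mul_mem' := by
        intro γ δ hγ hδ
        simp only [mem_ofPred_eq] at hγ hδ ⊢
        rw [hJmul, hδ]
        exact hγ
      inv_mem' := by
        intro γ hγ
        simp only [mem_ofPred_eq] at hγ ⊢
        rw [← hJ1, ← inv_mul_cancel γ, hJmul, hγ] }
  have hΓ' : IsCocompactFuchsian Γ' (fun γ => ρ (γ : Γ)) := by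
    refine hΓ.subgroup Γ' t fun δ => ?_
    obtain ⟨γ, hγ, he⟩ := hfin δ
    refine ⟨γ, hγ, ?_⟩
    change J (γ⁻¹ * δ) = I
    rw [hJmul, he, ← hJmul, inv_mul_cancel, hJ1]
  -- φ is injective
  have hφinj : Function.Injective φ := by
    have key : ∀ s, (s = 0 ∨ s = 1 ∨ s ∈ Ioo (0 : unitInterval) 1) := by
      intro s
      by_cases h0 : s = 0
      · exact Or.inl h0
      by_cases h1 : s = 1
      · exact Or.inr (Or.inl h1)
      exact Or.inr (Or.inr ⟨unitInterval.pos_iff_ne_zero.2 h0, unitInterval.lt_one_iff_ne_one.2 h1⟩)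
    have hn01 : φ 0 ≠ φ 1 := fun h => hne (congrArg (f 0) h)
    intro s s' h
    rcases key s with rfl | rfl | hs <;> rcases key s' with rfl | rfl | hs'
    · rfl
    · exact absurd h hn01
    · exact absurd (show φ s' ∈ C from h ▸ hφ0) (hIC _ ⟨s', hs', rfl⟩)
    · exact absurd h.symm hn01
    · rfl
    · exact absurd (show φ s' ∈ C from h ▸ hφ1) (hIC _ ⟨s', hs', rfl⟩)
    · exact absurd (show φ s ∈ C from h ▸ hφ0) (hIC _ ⟨s, hs, rfl⟩)
    · exact absurd (show φ s ∈ C from h ▸ hφ1) (hIC _ ⟨s, hs, rfl⟩)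
    · exact hinj hs hs' h
  have hemb := hφ.isClosedEmbedding hφinj
  have hclI : ∀ s, φ s ∈ closure I := by
    intro s
    refine map_mem_closure hφ (s := Ioo 0 1) ?_ (fun x hx => ⟨x, hx, rfl⟩)
    rw [closure_Ioo zero_ne_one]
    exact ⟨unitInterval.nonneg', unitInterval.le_one'⟩
  have hfrI : ∀ x ∈ closure I, x ∉ I → x = φ 0 ∨ x = φ 1 := by
    have := hJfr 1
    rw [hJ1] at this
    simpa only [hσ.one_act] using this
  have hfr0 : ∀ γ : Γ', σ γ (φ 0) ∈ closure I ∧ σ γ (φ 1) ∈ closure I ∧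
      ∀ s, σ γ (φ s) ∈ closure I := by
    intro γ
    have : ∀ s, σ γ (φ s) ∈ closure I := by
      intro s
      have h := map_mem_closure (hσ.continuous_act γ) (hclI s) (mapsTo_image (σ γ) I)
      have hγ : σ γ '' I = I := γ.2
      rwa [hγ] at h
    exact ⟨this 0, this 1, this⟩
  have hfix0 : ∀ γ : Γ', σ γ (φ 0) = φ 0 := by
    intro γ
    rcases hfrI _ (hfr0 γ).1 (fun h => hIC _ h (hCinv _ _ hφ0)) with h | h
    · exact h
    · exact absurd ((hCσ γ _ hφ0 0 h0D).symm.trans (congrArg (f 0) h)) hne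
  have hfix1 : ∀ γ : Γ', σ γ (φ 1) = φ 1 := by
    intro γ
    rcases hfrI _ (hfr0 γ).2.1 (fun h => hIC _ h (hCinv _ _ hφ1)) with h | h
    · exact absurd ((hCσ γ _ hφ1 0 h0D).symm.trans (congrArg (f 0) h)) hne.symm
    · exact h
  have hclrange : closure I ⊆ range φ := by
    refine closure_minimal ?_ hemb.isClosed_range
    rintro _ ⟨s, _, rfl⟩
    exact ⟨s, rfl⟩
  have hex : ∀ (γ : Γ') (s : unitInterval), ∃ s', φ s' = σ γ (φ s) := fun γ s =>
    hclrange ((hfr0 γ).2.2 s)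
  choose τ hτ using hex
  have hτact : IsActionByHomeomorphisms Γ' unitInterval τ :=
    { one_act := fun s => hφinj (by rw [hτ]; exact hσ.one_act _)
      mul_act := fun γ₁ γ₂ s => hφinj (by rw [hτ, hτ, hτ]; exact hσ.mul_act _ _ _)
      continuous_act := fun γ => by
        rw [hemb.isEmbedding.continuous_iff]
        have : φ ∘ τ γ = σ γ ∘ φ := funext fun s => hτ γ s
        rw [this]
        exact (hσ.continuous_act γ).comp hφ }
  have hd : c1 - c0 ≠ 0 := sub_ne_zero.2 hne.symm
  refine interval_liouville hΓ' hτact (fun γ => hφinj (by rw [hτ, hfix0]))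
    (fun γ => hφinj (by rw [hτ, hfix1]))
    (F := fun z s => (c1 - c0)⁻¹ * f z (φ s) + (-c0 * (c1 - c0)⁻¹)) ?_ ?_ ?_ ?_ ?_ ?_
  · refine ContinuousOn.add (ContinuousOn.mul continuousOn_const ?_) continuousOn_const
    exact hcont.comp (f := fun p : ℂ × unitInterval => (p.1, φ p.2)) (by fun_prop)
      (fun p hp => ⟨hp.1, mem_univ _⟩)
  · exact fun s => (hharm (φ s)).affine _ _
  · intro γ z hz s
    simp only [hτ, hinv _ z hz]
  · intro z hz
    have : f z (φ 0) = c0 := hφ0 z hz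
    simp only [this]
    ring
  · intro z hz
    have : f z (φ 1) = c1 := hφ1 z hz
    simp only [this]
    field_simp
    ring
  · intro s hs
    by_contra hcon
    push Not at hcon
    refine hφI s ⟨unitInterval.pos_iff_ne_zero.2 hcon.1, unitInterval.lt_one_iff_ne_one.2 hcon.2⟩ ?_
    intro z hz
    have := hs z hz
    simp only [add_left_inj] at this
    exact mul_left_cancel₀ (inv_ne_zero hd) this

end

section
open scoped Topology ENNReal ComplexConjugate

open MeasureTheory

/-- The angular parametrization of the circle. -/
def ang (t : ℝ) : UnitCircle := ⟨Complex.exp (t * Complex.I), by simp⟩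

lemma ang_continuous : Continuous ang := by
  unfold ang
  fun_prop

lemma ang_eq_iff {s t : ℝ} : ang s = ang t ↔ ∃ n : ℤ, s = t + n * (2 * Real.pi) := by
  rw [ang, ang, Subtype.mk.injEq, Complex.exp_eq_exp_iff_exists_int]
  refine exists_congr fun n => ?_
  rw [show (t : ℂ) * Complex.I + n * (2 * Real.pi * Complex.I) =
    ((t + n * (2 * Real.pi) : ℝ) : ℂ) * Complex.I by push_cast; ring,
    mul_left_inj' Complex.I_ne_zero]
  exact_mod_cast Iff.rfl

lemma ang_surjective : Function.Surjective ang := by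
  intro x
  have hx : ‖(x : ℂ)‖ = 1 := by simpa using x.2
  refine ⟨Complex.arg x, Subtype.ext ?_⟩
  have := Complex.norm_mul_exp_arg_mul_I (x : ℂ)
  rw [hx] at this
  simpa [ang] using this

lemma ang_ne {s t : ℝ} (h1 : s < t) (h2 : t < s + 2 * Real.pi) : ang s ≠ ang t := by
  intro h
  obtain ⟨n, hn⟩ := ang_eq_iff.1 h
  have hp := Real.pi_pos
  have a1 : (n : ℝ) < 0 := by
    by_contra hc; push Not at hc; nlinarith
  have a2 : (-1 : ℝ) < n := by
    by_contra hc; push Not at hc; nlinarith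
  have b1 : n < 0 := by exact_mod_cast a1
  have b2 : -1 < n := by exact_mod_cast a2
  omega

lemma ang_isOpen {a b : ℝ} (hb : b ≤ a + 2 * Real.pi) (hab : a < b) :
    IsOpen (ang '' Ioo a b) := by
  have hp := Real.pi_pos
  have : ang '' Ioo a b = (ang '' Icc b (a + 2 * Real.pi))ᶜ := by
    ext x
    constructor
    · rintro ⟨t, ht, rfl⟩ ⟨s, hs, he⟩
      exact ang_ne (ht.2.trans_le hs.1) (by linarith [hs.2, ht.1]) he.symm
    · intro hx
      obtain ⟨s, rfl⟩ := ang_surjective x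
      obtain ⟨n, hn, -⟩ := existsUnique_add_zsmul_mem_Ioc (show 0 < 2 * Real.pi by positivity) s a
      have he : ang (s + n • (2 * Real.pi)) = ang s := ang_eq_iff.2 ⟨n, by simp⟩
      rw [← he] at hx ⊢
      refine ⟨_, ⟨hn.1, ?_⟩, rfl⟩
      by_contra hc
      push Not at hc
      exact hx ⟨_, ⟨hc, hn.2⟩, rfl⟩
  rw [this]
  exact (isCompact_Icc.image ang_continuous).isClosed.isOpen_compl

lemma circle_locallyConnected : LocallyConnectedSpace UnitCircle := by
  have : Fact (Module.finrank ℝ ℂ = 1 + 1) := ⟨by simp⟩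
  exact ChartedSpace.locallyConnectedSpace (EuclideanSpace ℝ (Fin 1)) _

lemma exists_gap {C : Set UnitCircle} (hC : IsClosed C) (hne : C.Nonempty) {p : UnitCircle}
    (hp : p ∉ C) : ∃ a b : ℝ, a < b ∧ b ≤ a + 2 * Real.pi ∧ ang a ∈ C ∧ ang b ∈ C ∧
      ∀ t ∈ Ioo a b, ang t ∉ C := by
  have hpi := Real.pi_pos
  obtain ⟨t0, rfl⟩ := ang_surjective p
  have hCc : IsClosed (ang ⁻¹' C) := hC.preimage ang_continuous
  have hper : ∀ t, ang (t + 2 * Real.pi) = ang t := fun t => ang_eq_iff.2 ⟨1, by simp⟩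
  obtain ⟨q, hq⟩ := hne
  obtain ⟨s, rfl⟩ := ang_surjective q
  have hshift : ∀ u : ℝ, ∃ n : ℤ, s + n • (2 * Real.pi) ∈ Ioc u (u + 2 * Real.pi) := fun u =>
    (existsUnique_add_zsmul_mem_Ioc (show 0 < 2 * Real.pi by positivity) s u).exists
  have hsC : ∀ n : ℤ, ang (s + n • (2 * Real.pi)) ∈ C := fun n => by
    rw [show ang (s + n • (2 * Real.pi)) = ang s from ang_eq_iff.2 ⟨n, by simp⟩]
    exact hq
  have hA : (ang ⁻¹' C ∩ Iic t0).Nonempty := by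
    obtain ⟨n, hn⟩ := hshift (t0 - 2 * Real.pi)
    exact ⟨_, hsC n, by simpa using hn.2⟩
  have hB : (ang ⁻¹' C ∩ Ici t0).Nonempty := by
    obtain ⟨n, hn⟩ := hshift t0
    exact ⟨_, hsC n, hn.1.le⟩
  have hAb : BddAbove (ang ⁻¹' C ∩ Iic t0) := ⟨t0, fun x hx => hx.2⟩
  have hBb : BddBelow (ang ⁻¹' C ∩ Ici t0) := ⟨t0, fun x hx => hx.2⟩
  have ha := (hCc.inter isClosed_Iic).csSup_mem hA hAb
  have hb := (hCc.inter isClosed_Ici).csInf_mem hB hBb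
  set a := sSup (ang ⁻¹' C ∩ Iic t0)
  set b := sInf (ang ⁻¹' C ∩ Ici t0)
  have hat : a < t0 := lt_of_le_of_ne ha.2 (fun h => hp (h ▸ ha.1))
  have hbt : t0 < b := lt_of_le_of_ne hb.2 (fun h => hp (h ▸ hb.1))
  have hno : ∀ t ∈ Ioo a b, ang t ∉ C := by
    intro t ht htC
    rcases le_total t t0 with h | h
    · exact absurd (le_csSup hAb ⟨htC, h⟩) (not_le.2 ht.1)
    · exact absurd (csInf_le hBb ⟨htC, h⟩) (not_le.2 ht.2)
  refine ⟨a, b, hat.trans hbt, ?_, ha.1, hb.1, hno⟩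
  by_contra hc
  push Not at hc
  refine hno (a + 2 * Real.pi) ⟨by linarith, hc⟩ ?_
  rw [hper]
  exact ha.1

theorem liouville_final_aux
    {Γ : Type*} [Group Γ] (ρ : Γ → ℂ → ℂ) (hΓ : IsCocompactFuchsian Γ ρ)
    (σ : Γ → UnitCircle → UnitCircle) (hσ : IsActionByHomeomorphisms Γ UnitCircle σ)
    (f : ℂ → UnitCircle → ℝ)
    (hcont : ContinuousOn (fun p : ℂ × UnitCircle => f p.1 p.2)
      (unitDisc ×ˢ (univ : Set UnitCircle)))
    (hharm : ∀ x : UnitCircle, HarmonicOnSet (fun z => f z x) unitDisc)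
    (hinv : ∀ γ : Γ, ∀ z ∈ unitDisc, ∀ x : UnitCircle, f (ρ γ z) (σ γ x) = f z x) :
    ∀ z ∈ unitDisc, ∀ x : UnitCircle, f z x = f 0 x := by
  have hloc := circle_locallyConnected
  have hcomp : CompactSpace UnitCircle := isCompact_iff_compactSpace.1 (isCompact_sphere _ _)
  have hfc : ∀ z ∈ unitDisc, Continuous (f z) := fun z hz =>
    hcont.comp_continuous (f := fun x => (z, x)) (by fun_prop) (fun x => ⟨hz, mem_univ _⟩)
  let C : Set UnitCircle := ⋂ z ∈ unitDisc, {x | f z x = f 0 x}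
  have hCmem : ∀ x, x ∈ C ↔ ∀ z ∈ unitDisc, f z x = f 0 x := fun x => by simp [C]
  have hC : IsClosed C :=
    isClosed_biInter fun z hz => isClosed_eq (hfc z hz) (hfc 0 zero_mem_unitDisc)
  obtain ⟨y, -, hy, -⟩ := exists_const_max hΓ σ f hcont hharm hinv univ isClosed_univ
    ⟨ang 0, mem_univ _⟩ (fun _ _ _ => mem_univ _)
  have hall : ∀ x, x ∈ C := by
    intro p
    by_contra hp
    obtain ⟨a, b, hab, hb, haC, hbC, hno⟩ := exists_gap hC ⟨y, (hCmem y).2 hy⟩ hp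
    have hd : 0 < b - a := sub_pos.2 hab
    let φ : unitInterval → UnitCircle := fun t => ang (a + (t : ℝ) * (b - a))
    have hφ : Continuous φ := ang_continuous.comp (by fun_prop)
    have hIoo : ∀ t ∈ Ioo (0 : unitInterval) 1, a + (t : ℝ) * (b - a) ∈ Ioo a b := by
      rintro t ⟨h0, h1⟩
      have h0' : (0 : ℝ) < t := h0
      have h1' : (t : ℝ) < 1 := h1
      constructor <;> nlinarith
    have himg : φ '' Ioo 0 1 = ang '' Ioo a b := by
      ext x
      constructor
      · rintro ⟨t, ht, rfl⟩
        exact ⟨_, hIoo t ht, rfl⟩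
      · rintro ⟨s, hs, rfl⟩
        have h0 : 0 < (s - a) / (b - a) := div_pos (by linarith [hs.1]) hd
        have h1 : (s - a) / (b - a) < 1 := by
          rw [div_lt_one hd]; linarith [hs.2]
        refine ⟨⟨(s - a) / (b - a), h0.le, h1.le⟩, ⟨h0, h1⟩, ?_⟩
        simp only [φ]
        congr 1
        field_simp
        ring
    refine no_gap hΓ hσ hcont hharm hinv hφ (himg ▸ ang_isOpen hb hab) ?_ ?_ ?_ ?_
    · have key : ∀ s ∈ Ioo (0 : unitInterval) 1, ∀ t ∈ Ioo (0 : unitInterval) 1, s < t →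
          φ s ≠ φ t := by
        intro s hs t ht hst
        have hs' := hIoo s hs
        have ht' := hIoo t ht
        have hst' : (s : ℝ) < t := hst
        refine ang_ne ?_ ?_
        · nlinarith
        · linarith [hs'.1, ht'.2]
      intro s hs t ht h
      rcases lt_trichotomy s t with h' | h' | h'
      · exact absurd h (key s hs t ht h')
      · exact h'
      · exact absurd h.symm (key t ht s hs h')
    · have : φ 0 = ang a := by simp [φ]
      rw [this]
      exact (hCmem _).1 haC
    · have : φ 1 = ang b := by simp [φ]
      rw [this]
      exact (hCmem _).1 hbC
    · intro t ht h
      exact hno _ (hIoo t ht) ((hCmem _).2 h)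
  exact fun z hz x => (hCmem x).1 (hall x) z hz

end

/-- **Theorem 1.2 (circle-fiber case).** Every `Γ`-invariant leafwise harmonic function on
`𝔻 × S¹`, for a cocompact Fuchsian group `Γ` acting on `S¹` by homeomorphisms, is
independent of the disc variable. -/
theorem liouville_foliated_circle_bundle
    {Γ : Type*} [Group Γ] (ρ : Γ → ℂ → ℂ) (hΓ : IsCocompactFuchsian Γ ρ)
    (σ : Γ → UnitCircle → UnitCircle) (hσ : IsActionByHomeomorphisms Γ UnitCircle σ)
    (f : ℂ → UnitCircle → ℝ)
    (hcont : ContinuousOn (fun p : ℂ × UnitCircle => f p.1 p.2)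
      (unitDisc ×ˢ (univ : Set UnitCircle)))
    (hharm : ∀ x : UnitCircle, HarmonicOnSet (fun z => f z x) unitDisc)
    (hinv : ∀ γ : Γ, ∀ z ∈ unitDisc, ∀ x : UnitCircle, f (ρ γ z) (σ γ x) = f z x) :
    ∀ z ∈ unitDisc, ∀ x : UnitCircle, f z x = f 0 x := by
  exact liouville_final_aux ρ hΓ σ hσ f hcont hharm hinv
end
end

section
/- (Theorem 1.2, interval-fiber case, for bundles over compact hyperbolic surfaces.) Let Γ be a cocompact Fuchsian group and let Γ also act on the closed interval [0,1] by homeomorphisms (via an arbitrary homomorphism Γ → Homeo([0,1])). Then every Γ-invariant leafwise harmonic function f̃ : 𝔻 × [0,1] → ℝ is independent of the disc variable: f̃(z,x) = f̃(0,x) for all z ∈ 𝔻 and all x ∈ [0,1]. (Equivalently, the foliated interval bundle (𝔻 × [0,1])/Γ over the compact hyperbolic surface 𝔻/Γ has the Liouville property.) -/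
open Metric Set Filter

noncomputable section

open MeasureTheory
open scoped ENNReal Topology

/-! ### Möbius maps of the disc -/

namespace LF

def mob (α β z : ℂ) : ℂ := (α * z + β) / ((starRingEnd ℂ) β * z + (starRingEnd ℂ) α)

def den (α β z : ℂ) : ℂ := (starRingEnd ℂ) β * z + (starRingEnd ℂ) α

lemma mem_disc {z : ℂ} : z ∈ unitDisc ↔ ‖z‖ < 1 := by simp [unitDisc]

lemma isOpen_disc : IsOpen unitDisc := Metric.isOpen_ball

lemma den_ne {α β z : ℂ} (h : ‖α‖ ^ 2 - ‖β‖ ^ 2 = 1) (hz : z ∈ unitDisc) : den α β z ≠ 0 := by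
  intro h0
  rw [mem_disc] at hz
  have h1 : (starRingEnd ℂ) α = - ((starRingEnd ℂ) β * z) := by
    unfold den at h0
    linear_combination h0
  have h2 : ‖α‖ = ‖β‖ * ‖z‖ := by
    have := congrArg norm h1
    simpa using this
  have h3 : ‖β‖ * ‖z‖ ≤ ‖β‖ := mul_le_of_le_one_right (norm_nonneg _) hz.le
  nlinarith [norm_nonneg α, norm_nonneg β]

lemma norm_sq_cond {α β : ℂ} (h : ‖α‖ ^ 2 - ‖β‖ ^ 2 = 1) :
    α * (starRingEnd ℂ) α - β * (starRingEnd ℂ) β = 1 := by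
  rw [Complex.mul_conj, Complex.mul_conj, Complex.normSq_eq_norm_sq, Complex.normSq_eq_norm_sq]
  exact_mod_cast congrArg (fun x : ℝ => (x : ℂ)) h

lemma one_sub_conj_mul {α β z w : ℂ} (h : ‖α‖ ^ 2 - ‖β‖ ^ 2 = 1) (hz : z ∈ unitDisc)
    (hw : w ∈ unitDisc) :
    1 - (starRingEnd ℂ) (mob α β z) * mob α β w =
      (1 - (starRingEnd ℂ) z * w) / ((starRingEnd ℂ) (den α β z) * den α β w) := by
  have hz' := den_ne h hz
  have hw' := den_ne h hw
  have hz2 : (starRingEnd ℂ) (den α β z) ≠ 0 := by simpa using hz'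
  have e1 : mob α β z = (α * z + β) / den α β z := rfl
  have e2 : mob α β w = (α * w + β) / den α β w := rfl
  rw [e1, e2, map_div₀]
  have h1 := norm_sq_cond h
  field_simp
  simp only [den, map_add, map_mul, Complex.conj_conj]
  linear_combination (1 - (starRingEnd ℂ) z * w) * h1

lemma one_sub_norm_sq {α β z : ℂ} (h : ‖α‖ ^ 2 - ‖β‖ ^ 2 = 1) (hz : z ∈ unitDisc) :
    1 - ‖mob α β z‖ ^ 2 = (1 - ‖z‖ ^ 2) / ‖den α β z‖ ^ 2 := by
  have h1 := one_sub_conj_mul h hz hz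
  simp only [Complex.conj_mul'] at h1
  exact_mod_cast h1

lemma one_sub_pos {z : ℂ} (hz : z ∈ unitDisc) : 0 < 1 - ‖z‖ ^ 2 := by
  rw [mem_disc] at hz
  nlinarith [norm_nonneg z]

lemma mob_mem {α β z : ℂ} (h : ‖α‖ ^ 2 - ‖β‖ ^ 2 = 1) (hz : z ∈ unitDisc) :
    mob α β z ∈ unitDisc := by
  have h1 := one_sub_norm_sq h hz
  have h2 := one_sub_pos hz
  have h3 : 0 < ‖den α β z‖ ^ 2 := by have := den_ne h hz; positivity
  have h4 : 0 < 1 - ‖mob α β z‖ ^ 2 := by rw [h1]; positivity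
  rw [mem_disc]
  nlinarith [norm_nonneg (mob α β z)]

lemma mob_inv {α β z : ℂ} (h : ‖α‖ ^ 2 - ‖β‖ ^ 2 = 1) (hz : z ∈ unitDisc) :
    mob ((starRingEnd ℂ) α) (-β) (mob α β z) = z := by
  have hz' := den_ne h hz
  have e1 : mob α β z = (α * z + β) / den α β z := rfl
  have h1 := norm_sq_cond h
  have h2 : den ((starRingEnd ℂ) α) (-β) (mob α β z) ≠ 0 :=
    den_ne (by simpa using h) (mob_mem h hz)
  have h3 : den ((starRingEnd ℂ) α) (-β) (mob α β z) = 1 / den α β z := by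
    rw [e1]
    field_simp
    simp only [den, map_neg, Complex.conj_conj] at *
    field_simp
    linear_combination h1
  have e2 : mob ((starRingEnd ℂ) α) (-β) (mob α β z) =
    ((starRingEnd ℂ) α * mob α β z + -β) / den ((starRingEnd ℂ) α) (-β) (mob α β z) := rfl
  rw [e2, h3, e1]
  field_simp
  simp only [den]
  linear_combination z * h1

lemma mob_inv' {α β z : ℂ} (h : ‖α‖ ^ 2 - ‖β‖ ^ 2 = 1) (hz : z ∈ unitDisc) :
    mob α β (mob ((starRingEnd ℂ) α) (-β) z) = z := by
  have h' : ‖(starRingEnd ℂ) α‖ ^ 2 - ‖-β‖ ^ 2 = 1 := by simpa using h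
  have := mob_inv h' hz
  simpa using this

lemma mob_image {α β : ℂ} (h : ‖α‖ ^ 2 - ‖β‖ ^ 2 = 1) : mob α β '' unitDisc = unitDisc := by
  ext w
  constructor
  · rintro ⟨z, hz, rfl⟩
    exact mob_mem h hz
  · intro hw
    exact ⟨mob ((starRingEnd ℂ) α) (-β) w, mob_mem (by simpa using h) hw, mob_inv' h hw⟩

lemma mob_injOn {α β : ℂ} (h : ‖α‖ ^ 2 - ‖β‖ ^ 2 = 1) : InjOn (mob α β) unitDisc := by
  intro z hz w hw hzw
  rw [← mob_inv h hz, ← mob_inv h hw, hzw]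

lemma mob_hasDerivAt {α β z : ℂ} (h : ‖α‖ ^ 2 - ‖β‖ ^ 2 = 1) (hz : z ∈ unitDisc) :
    HasDerivAt (mob α β) (1 / den α β z ^ 2) z := by
  have hz' := den_ne h hz
  have h1 : HasDerivAt (fun z => α * z + β) α z := by
    simpa using ((hasDerivAt_id z).const_mul α).add_const β
  have h2 : HasDerivAt (den α β) ((starRingEnd ℂ) β) z := by
    have := ((hasDerivAt_id z).const_mul ((starRingEnd ℂ) β)).add_const ((starRingEnd ℂ) α)
    rw [mul_one] at this
    exact this
  have h3 := h1.div h2 hz'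
  have h4 : (α * den α β z - (α * z + β) * (starRingEnd ℂ) β) / den α β z ^ 2 = 1 / den α β z ^ 2 := by
    congr 1
    simp only [den]
    linear_combination norm_sq_cond h
  rw [h4] at h3
  exact h3

lemma det_smul (a : ℂ) : (a • (1 : ℂ →L[ℝ] ℂ)).det = ‖a‖ ^ 2 := by
  have : (((a • (1 : ℂ →L[ℝ] ℂ)) : ℂ →L[ℝ] ℂ) : ℂ →ₗ[ℝ] ℂ) = LinearMap.mulLeft ℝ a := by
    ext
    all_goals simp
  rw [ContinuousLinearMap.det, this, ← Complex.normSq_eq_norm_sq, ← Algebra.norm_complex_apply]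
  rfl

/-- hyperbolic density -/
def lam (z : ℂ) : ℝ≥0∞ := ENNReal.ofReal (1 / (1 - ‖z‖ ^ 2) ^ 2)

lemma measurable_lam : Measurable lam := by
  unfold lam
  fun_prop

lemma lintegral_mob {α β : ℂ} (h : ‖α‖ ^ 2 - ‖β‖ ^ 2 = 1) (F : ℂ → ℝ≥0∞) :
    ∫⁻ z in unitDisc, lam z * F (mob α β z) = ∫⁻ z in unitDisc, lam z * F z := by
  have key := lintegral_image_eq_lintegral_abs_det_fderiv_mul volume
    isOpen_disc.measurableSet
    (fun z hz => ((mob_hasDerivAt h hz).complexToReal_fderiv).hasFDerivWithinAt (s := unitDisc))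
    (mob_injOn h) (fun z => lam z * F z)
  rw [mob_image h] at key
  rw [key]
  apply setLIntegral_congr_fun isOpen_disc.measurableSet
  intro z hz
  simp only
  rw [← mul_assoc]
  congr 1
  have hz' := den_ne h hz
  have hn : 0 < ‖den α β z‖ := by positivity
  have := one_sub_pos hz
  rw [det_smul, lam, lam, one_sub_norm_sq h hz, ← ENNReal.ofReal_mul (abs_nonneg _)]
  congr 1
  rw [abs_of_nonneg (by positivity)]
  simp only [norm_div, norm_pow, norm_one]
  field_simp

/-- Berezin kernel -/
def ker (z w : ℂ) : ℝ := ((1 - ‖z‖ ^ 2) * (1 - ‖w‖ ^ 2) / ‖1 - (starRingEnd ℂ) z * w‖ ^ 2) ^ 2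

lemma ker_symm (z w : ℂ) : ker z w = ker w z := by
  unfold ker
  have : ‖1 - (starRingEnd ℂ) z * w‖ = ‖1 - (starRingEnd ℂ) w * z‖ := by
    rw [← Complex.norm_conj]
    simp [mul_comm]
  rw [this, mul_comm (1 - ‖z‖ ^ 2)]

lemma one_sub_ne {z w : ℂ} (hz : z ∈ unitDisc) (hw : w ∈ unitDisc) :
    1 - (starRingEnd ℂ) z * w ≠ 0 := by
  intro h0
  rw [mem_disc] at hz hw
  have h1 : (starRingEnd ℂ) z * w = 1 := by linear_combination -h0
  have h2 : ‖z‖ * ‖w‖ = 1 := by simpa using congrArg norm h1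
  nlinarith [norm_nonneg z, norm_nonneg w]

lemma ker_pos {z w : ℂ} (hz : z ∈ unitDisc) (hw : w ∈ unitDisc) : 0 < ker z w := by
  have := one_sub_ne hz hw
  have := one_sub_pos hz
  have := one_sub_pos hw
  unfold ker
  positivity

lemma ker_mob {α β z w : ℂ} (h : ‖α‖ ^ 2 - ‖β‖ ^ 2 = 1) (hz : z ∈ unitDisc)
    (hw : w ∈ unitDisc) : ker (mob α β z) (mob α β w) = ker z w := by
  have hz' : 0 < ‖den α β z‖ := by have := den_ne h hz; positivity
  have hw' : 0 < ‖den α β w‖ := by have := den_ne h hw; positivity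
  have h0 : 0 < ‖1 - (starRingEnd ℂ) z * w‖ := by have := one_sub_ne hz hw; positivity
  unfold ker
  rw [one_sub_norm_sq h hz, one_sub_norm_sq h hw, one_sub_conj_mul h hz hw]
  simp only [norm_div, norm_mul, Complex.norm_conj]
  field_simp

lemma lam_mul_ker_zero {u : ℂ} (hu : u ∈ unitDisc) :
    lam u * ENNReal.ofReal (ker 0 u) = 1 := by
  have := one_sub_pos hu
  unfold lam ker
  rw [← ENNReal.ofReal_mul (by positivity)]
  simp
  field_simp

lemma exists_mob {z : ℂ} (hz : z ∈ unitDisc) :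
    ∃ α β : ℂ, ‖α‖ ^ 2 - ‖β‖ ^ 2 = 1 ∧ mob α β 0 = z := by
  have h := one_sub_pos hz
  set r : ℝ := 1 / Real.sqrt (1 - ‖z‖ ^ 2) with hr
  have hs := Real.sqrt_pos.mpr h
  have hs2 := Real.sq_sqrt h.le
  have hr0 : 0 < r := by positivity
  refine ⟨r, r * z, ?_, ?_⟩
  · simp only [norm_mul, Complex.norm_real, Real.norm_eq_abs, mul_pow, sq_abs]
    have : r ^ 2 = 1 / (1 - ‖z‖ ^ 2) := by rw [hr, div_pow, hs2]; simp
    rw [this]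
    field_simp
  · have : (r : ℂ) ≠ 0 := by exact_mod_cast hr0.ne'
    simp [mob]
    field_simp

/-- Berezin transform as an average over the disc. -/
lemma lintegral_ker {α β : ℂ} (h : ‖α‖ ^ 2 - ‖β‖ ^ 2 = 1) (F : ℂ → ℝ≥0∞) :
    ∫⁻ w in unitDisc, lam w * (ENNReal.ofReal (ker (mob α β 0) w) * F w) =
      ∫⁻ u in unitDisc, F (mob α β u) := by
  rw [← lintegral_mob h]
  apply setLIntegral_congr_fun isOpen_disc.measurableSet
  intro u hu
  have h0 : (0 : ℂ) ∈ unitDisc := by simp [unitDisc]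
  simp only
  rw [ker_mob h h0 hu, ← mul_assoc, lam_mul_ker_zero hu, one_mul]

/-! ### Harmonic functions on the disc -/

lemma harm_global {h : ℂ → ℝ} (hh : HarmonicOnSet h unitDisc) :
    InnerProductSpace.HarmonicOnNhd h unitDisc ∧
    ∃ g : ℂ → ℂ, DifferentiableOn ℂ g unitDisc ∧ ∀ w ∈ unitDisc, h w = (g w).re := by
  have h1 : InnerProductSpace.HarmonicOnNhd h unitDisc := by
    intro z hz
    obtain ⟨r, hr, hsub, g, hg, hgr⟩ := hh z hz
    have hz' : z ∈ Metric.ball z r := Metric.mem_ball_self hr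
    have ha : AnalyticAt ℂ g z := hg.analyticAt (Metric.isOpen_ball.mem_nhds hz')
    have h2 : InnerProductSpace.HarmonicAt (Complex.reCLM ∘ g) z := ha.harmonicAt.comp_CLM _
    refine (InnerProductSpace.harmonicAt_congr_nhds ?_).mpr h2
    filter_upwards [Metric.isOpen_ball.mem_nhds hz'] with w hw
    simpa using hgr w hw
  refine ⟨h1, ?_⟩
  obtain ⟨F, hF, hFe⟩ := h1.exists_analyticOnNhd_ball_re_eq
  exact ⟨F, hF.differentiableOn, fun w hw => (hFe hw).symm⟩

lemma harm_comp {h : ℂ → ℝ} (hh : HarmonicOnSet h unitDisc) {α β : ℂ}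
    (hab : ‖α‖ ^ 2 - ‖β‖ ^ 2 = 1) : HarmonicOnSet (fun z => h (mob α β z)) unitDisc := by
  obtain ⟨-, g, hg, hge⟩ := harm_global hh
  intro z hz
  obtain ⟨r, hr, hsub⟩ := Metric.isOpen_iff.mp isOpen_disc z hz
  refine ⟨r, hr, hsub, fun z => g (mob α β z), ?_, ?_⟩
  · intro w hw
    have hw' := hsub hw
    exact ((hg.differentiableAt (isOpen_disc.mem_nhds (mob_mem hab hw'))).comp w
      (mob_hasDerivAt hab hw').differentiableAt).differentiableWithinAt
  · intro w hw
    exact hge _ (mob_mem hab (hsub hw))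

lemma harm_max {h : ℂ → ℝ} (hh : HarmonicOnSet h unitDisc) {c : ℂ} (hc : c ∈ unitDisc)
    (hmax : ∀ w ∈ unitDisc, h w ≤ h c) : ∀ w ∈ unitDisc, h w = h c := by
  obtain ⟨-, g, hg, hge⟩ := harm_global hh
  have h1 := Complex.norm_eqOn_of_isPreconnected_of_isMaxOn (f := fun z => Complex.exp (g z))
    (convex_ball (0 : ℂ) 1).isPreconnected isOpen_disc hg.cexp hc (by
      intro w hw
      simp only [Function.comp, Complex.norm_exp, Set.mem_ofPred_eq, Real.exp_le_exp]
      rw [← hge w hw, ← hge c hc]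
      exact hmax w hw)
  intro w hw
  have h2 := h1 hw
  simp only [Function.comp, Complex.norm_exp, Function.const, Real.exp_eq_exp] at h2
  rw [hge w hw, hge c hc, h2]

lemma ofReal_integral_le {X : Type*} [MeasurableSpace X] {μ : Measure X} (g : X → ℝ) :
    ENNReal.ofReal (∫ x, g x ∂μ) ≤ ∫⁻ x, ENNReal.ofReal (g x) ∂μ := by
  by_cases hg : Integrable g μ
  · rw [integral_eq_lintegral_pos_part_sub_lintegral_neg_part hg]
    refine (ENNReal.ofReal_le_ofReal (sub_le_self _ ENNReal.toReal_nonneg)).trans ?_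
    exact ENNReal.ofReal_toReal_le
  · rw [integral_undef hg]; simp

lemma mean_le {h : ℂ → ℝ} (hh : HarmonicOnSet h unitDisc) :
    ENNReal.ofReal Real.pi * ENNReal.ofReal (h 0) ≤ ∫⁻ u in unitDisc, ENNReal.ofReal (h u) := by
  obtain ⟨hn, -⟩ := harm_global hh
  have hcont : ContinuousOn h unitDisc := hn.continuousOn
  have hm : Measurable (unitDisc.indicator fun u => ENNReal.ofReal (h u)) := by
    classical
    have := (ENNReal.continuous_ofReal.comp_continuousOn hcont).measurable_piecewise
      (continuousOn_const (c := (0 : ℝ≥0∞))) isOpen_disc.measurableSet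
    convert this using 1
    ext u
    by_cases hu : u ∈ unitDisc <;> simp [hu]
  rw [← lintegral_indicator isOpen_disc.measurableSet, ← Complex.lintegral_comp_polarCoord_symm]
  have hpm : Measurable (fun p : ℝ × ℝ => ENNReal.ofReal p.1 •
      unitDisc.indicator (fun u => ENNReal.ofReal (h u)) (Complex.polarCoord.symm p)) := by
    have : Measurable (fun p : ℝ × ℝ => Complex.polarCoord.symm p) := by
      simp only [Complex.polarCoord_symm_apply]
      fun_prop
    exact (measurable_fst.ennreal_ofReal).smul (hm.comp this)
  have hT : polarCoord.target = Ioi (0 : ℝ) ×ˢ Ioo (-Real.pi) Real.pi := rfl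
  rw [hT, Measure.volume_eq_prod, setLIntegral_prod _ hpm.aemeasurable]
  have step : ∀ r ∈ Ioo (0 : ℝ) 1, ENNReal.ofReal r * ENNReal.ofReal (2 * Real.pi * h 0) ≤
      ∫⁻ θ in Ioo (-Real.pi) Real.pi, ENNReal.ofReal r •
      unitDisc.indicator (fun u => ENNReal.ofReal (h u)) (Complex.polarCoord.symm (r, θ)) := by
    intro r hr
    have hmem : ∀ θ : ℝ, Complex.polarCoord.symm (r, θ) ∈ unitDisc := by
      intro θ
      rw [mem_disc, Complex.norm_polarCoord_symm]
      simpa [abs_of_pos hr.1] using hr.2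
    have hcm : ∀ θ : ℝ, Complex.polarCoord.symm (r, θ) = circleMap 0 r θ := by
      intro θ
      simp [circleMap, Complex.exp_mul_I]
    have havg : Real.circleAverage h 0 r = h 0 := by
      apply InnerProductSpace.HarmonicOnNhd.circleAverage_eq
      intro z hz
      apply hn
      rw [mem_disc]
      rw [Metric.mem_closedBall, dist_zero_right, abs_of_pos hr.1] at hz
      exact hz.trans_lt hr.2
    have h2 : 2 * Real.pi * h 0 = ∫ θ in Ioo (-Real.pi) Real.pi, h (circleMap 0 r θ) := by
      rw [Real.circleAverage_eq_integral_add (-Real.pi)] at havg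
      rw [← integral_Ioc_eq_integral_Ioo, ← intervalIntegral.integral_of_le (by linarith [Real.pi_pos]),
        ← havg, intervalIntegral.integral_comp_add_right (fun θ => h (circleMap 0 r θ))]
      have := Real.pi_pos
      rw [smul_eq_mul, ← mul_assoc, mul_inv_cancel₀ (by positivity), one_mul]
      congr 1 <;> ring
    simp only [smul_eq_mul]
    rw [lintegral_const_mul' _ _ ENNReal.ofReal_ne_top]
    gcongr
    rw [h2]
    refine (ofReal_integral_le _).trans (le_of_eq ?_)
    congr 1
    ext θ
    rw [indicator_of_mem (hmem θ), hcm]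
  calc ENNReal.ofReal Real.pi * ENNReal.ofReal (h 0)
      = ∫⁻ r in Ioo (0 : ℝ) 1, ENNReal.ofReal r * ENNReal.ofReal (2 * Real.pi * h 0) := by
        rw [lintegral_mul_const' _ _ ENNReal.ofReal_ne_top]
        have : ∫⁻ r in Ioo (0 : ℝ) 1, ENNReal.ofReal r = ENNReal.ofReal (1 / 2) := by
          rw [← ofReal_integral_eq_lintegral_ofReal]
          · rw [← integral_Ioc_eq_integral_Ioo, ← intervalIntegral.integral_of_le zero_le_one,
              integral_id]
            norm_num
          · exact (continuous_id.integrableOn_Icc (a := (0:ℝ)) (b := 1)).mono_set Ioo_subset_Icc_self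
          · filter_upwards [ae_restrict_mem measurableSet_Ioo] with r hr using hr.1.le
        rw [this, ← ENNReal.ofReal_mul (p := 1 / 2) (by norm_num),
          ← ENNReal.ofReal_mul (p := Real.pi) Real.pi_pos.le]
        congr 1
        ring
    _ ≤ ∫⁻ r in Ioo (0 : ℝ) 1, ∫⁻ θ in Ioo (-Real.pi) Real.pi, ENNReal.ofReal r •
      unitDisc.indicator (fun u => ENNReal.ofReal (h u)) (Complex.polarCoord.symm (r, θ)) :=
        setLIntegral_mono' measurableSet_Ioo step
    _ ≤ _ := lintegral_mono_set Ioo_subset_Ioi_self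

lemma berezin_le {h : ℂ → ℝ} (hh : HarmonicOnSet h unitDisc) {z : ℂ} (hz : z ∈ unitDisc) :
    ENNReal.ofReal Real.pi * ENNReal.ofReal (h z) ≤
      ∫⁻ w in unitDisc, lam w * (ENNReal.ofReal (ker z w) * ENNReal.ofReal (h w)) := by
  obtain ⟨α, β, hab, rfl⟩ := exists_mob hz
  rw [lintegral_ker hab (fun w => ENNReal.ofReal (h w))]
  exact mean_le (harm_comp hh hab)

lemma ker_mass {z : ℂ} (hz : z ∈ unitDisc) :
    ∫⁻ w in unitDisc, lam w * ENNReal.ofReal (ker z w) = ENNReal.ofReal Real.pi := by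
  obtain ⟨α, β, hab, rfl⟩ := exists_mob hz
  have := lintegral_ker hab (fun w => 1)
  simp only [mul_one] at this
  rw [this]
  simp only [unitDisc, ENNReal.ofReal, lintegral_const, MeasurableSet.univ, Measure.restrict_apply,
    univ_inter, Complex.volume_ball]
  have : NNReal.pi = Real.pi.toNNReal := by
    ext
    simp [Real.pi_pos.le]
  simp [this]

end LF

/-! ### Mass transport -/

namespace LF

lemma mass_transport {D : Type*} [MeasurableSpace D] {μ : Measure D} [SFinite μ]
    {H : Type*} [Group H] [Countable H] {act : H → D → D}
    (hinv : ∀ γ z, act γ (act γ⁻¹ z) = z)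
    (hmp : ∀ γ, MeasurePreserving (act γ) μ μ) {ψ : D → ℝ≥0∞} (hψm : Measurable ψ)
    (hψ : ∀ z, ∑' γ, ψ (act γ z) = 1) {k : D → D → ℝ≥0∞}
    (hk : Measurable (fun q : D × D => k q.1 q.2))
    (hkinv : ∀ γ z w, k (act γ z) (act γ w) = k z w) :
    ∫⁻ z, ψ z * ∫⁻ w, k z w ∂μ ∂μ = ∫⁻ z, ψ z * ∫⁻ w, k w z ∂μ ∂μ := by
  have hkz : ∀ z, Measurable (fun w => k z w) := fun z => hk.comp measurable_prodMk_left
  have hkz' : ∀ z, Measurable (fun w => k w z) := fun z => hk.comp measurable_prodMk_right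
  have hactm : ∀ γ, Measurable (act γ) := fun γ => (hmp γ).measurable
  have hψγ : ∀ γ, Measurable (fun z => ψ (act γ z)) := fun γ => hψm.comp (hactm γ)
  have e1 : ∫⁻ z, ψ z * ∫⁻ w, k z w ∂μ ∂μ =
      ∑' γ, ∫⁻ z, ∫⁻ w, ψ z * (ψ (act γ w) * k z w) ∂μ ∂μ := by
    rw [← lintegral_tsum]
    · refine lintegral_congr fun z => ?_
      rw [← lintegral_tsum]
      · rw [← lintegral_const_mul _ (hkz z)]
        refine lintegral_congr fun w => ?_
        rw [ENNReal.tsum_mul_left, ENNReal.tsum_mul_right, hψ, one_mul]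
      · intro γ
        exact (((hψγ γ).mul (hkz z)).const_mul _).aemeasurable
    · intro γ
      refine Measurable.aemeasurable ?_
      refine Measurable.lintegral_prod_right'
        (f := fun q : D × D => ψ q.1 * (ψ (act γ q.2) * k q.1 q.2)) ?_
      exact (hψm.comp measurable_fst).mul (((hψγ γ).comp measurable_snd).mul hk)
  have e2 : ∀ γ, ∫⁻ z, ∫⁻ w, ψ z * (ψ (act γ w) * k z w) ∂μ ∂μ =
      ∫⁻ w, ∫⁻ z, ψ w * (ψ (act γ⁻¹ z) * k z w) ∂μ ∂μ := by
    intro γ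
    have hm2 : ∀ γ : H, Measurable (fun q : D × D => ψ (act γ q.1) * (ψ q.2 * k q.1 q.2)) :=
      fun γ => ((hψγ γ).comp measurable_fst).mul ((hψm.comp measurable_snd).mul hk)
    have hinv' : ∀ z, act γ⁻¹ (act γ z) = z := fun z => by simpa using hinv γ⁻¹ z
    have hkinv2 : ∀ z w, k z (act γ⁻¹ w) = k (act γ z) w := by
      intro z w
      rw [← hkinv γ z (act γ⁻¹ w), hinv]
    calc ∫⁻ z, ∫⁻ w, ψ z * (ψ (act γ w) * k z w) ∂μ ∂μ
        = ∫⁻ z, ∫⁻ w, ψ z * (ψ w * k (act γ z) w) ∂μ ∂μ := by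
          refine lintegral_congr fun z => ?_
          have := (hmp γ).lintegral_comp (f := fun w => ψ z * (ψ w * k (act γ z) w))
            ((hψm.mul (hkz _)).const_mul _)
          rw [← this]
          refine lintegral_congr fun w => ?_
          rw [hkinv]
      _ = ∫⁻ z, ∫⁻ w, ψ (act γ⁻¹ z) * (ψ w * k z w) ∂μ ∂μ := by
          have := (hmp γ).lintegral_comp
            (f := fun z => ∫⁻ w, ψ (act γ⁻¹ z) * (ψ w * k z w) ∂μ)
            ((hm2 γ⁻¹).lintegral_prod_right')
          rw [← this]
          refine lintegral_congr fun z => ?_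
          rw [hinv']
      _ = ∫⁻ w, ∫⁻ z, ψ (act γ⁻¹ z) * (ψ w * k z w) ∂μ ∂μ :=
          lintegral_lintegral_swap (hm2 γ⁻¹).aemeasurable
      _ = _ := by
          refine lintegral_congr fun w => lintegral_congr fun z => ?_
          ring
  rw [e1]
  simp_rw [e2]
  rw [← lintegral_tsum]
  · refine lintegral_congr fun w => ?_
    rw [← lintegral_tsum]
    · rw [← lintegral_const_mul _ (hkz' w)]
      refine lintegral_congr fun z => ?_
      rw [ENNReal.tsum_mul_left, ENNReal.tsum_mul_right]
      have : ∑' γ : H, ψ (act γ⁻¹ z) = 1 := by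
        rw [← hψ z]
        exact (Equiv.inv H).tsum_eq (fun γ => ψ (act γ z))
      rw [this, one_mul]
    · intro γ
      exact (((hψγ γ⁻¹).mul (hkz' w)).const_mul _).aemeasurable
  · intro γ
    refine Measurable.aemeasurable ?_
    refine Measurable.lintegral_prod_right'
      (f := fun q : D × D => ψ q.1 * (ψ (act γ⁻¹ q.2) * k q.2 q.1)) ?_
    exact (hψm.comp measurable_fst).mul (((hψγ γ⁻¹).comp measurable_snd).mul (hk.comp measurable_swap))

lemma max_integral_le (B : ℝ) :
    ∫⁻ c in Ioo 0 B, ∫⁻ s in Ioo 0 B, max (ENNReal.ofReal c) (ENNReal.ofReal s) ≤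
      2 * ∫⁻ c in Ioo 0 B, ENNReal.ofReal c * ENNReal.ofReal c := by
  set ν : Measure ℝ := volume.restrict (Ioo 0 B)
  have hm1 : Measurable (fun q : ℝ × ℝ => if q.2 < q.1 then ENNReal.ofReal q.1 else 0) :=
    Measurable.ite (measurableSet_lt measurable_snd measurable_fst)
      (measurable_fst.ennreal_ofReal) measurable_const
  have hm2 : Measurable (fun q : ℝ × ℝ => if q.1 < q.2 then ENNReal.ofReal q.2 else 0) :=
    Measurable.ite (measurableSet_lt measurable_fst measurable_snd)
      (measurable_snd.ennreal_ofReal) measurable_const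
  have h1 : ∫⁻ c, ∫⁻ s, (if s < c then ENNReal.ofReal c else 0) ∂ν ∂ν ≤
      ∫⁻ c, ENNReal.ofReal c * ENNReal.ofReal c ∂ν := by
    refine lintegral_mono fun c => ?_
    have : (fun s : ℝ => if s < c then ENNReal.ofReal c else 0) =
        (Iio c).indicator (fun _ => ENNReal.ofReal c) := by
      ext s; simp [indicator]
    simp only [this]
    rw [lintegral_indicator_const measurableSet_Iio]
    gcongr
    rw [Measure.restrict_apply measurableSet_Iio]
    refine (measure_mono (t := Ioo 0 c) ?_).trans ?_
    · rintro s ⟨h1, h2⟩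
      exact ⟨h2.1, h1⟩
    · simp
  have h2 : ∫⁻ c, ∫⁻ s, (if c < s then ENNReal.ofReal s else 0) ∂ν ∂ν =
      ∫⁻ c, ∫⁻ s, (if s < c then ENNReal.ofReal c else 0) ∂ν ∂ν :=
    lintegral_lintegral_swap hm2.aemeasurable
  calc ∫⁻ c, ∫⁻ s, max (ENNReal.ofReal c) (ENNReal.ofReal s) ∂ν ∂ν
      ≤ ∫⁻ c, ∫⁻ s, ((if s < c then ENNReal.ofReal c else 0) +
          (if c < s then ENNReal.ofReal s else 0)) ∂ν ∂ν := by
        refine lintegral_mono fun c => ?_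
        refine lintegral_mono_ae ?_
        have : ∀ᵐ s ∂ν, s ≠ c := by
          refine ae_restrict_of_ae ?_
          simp [ae_iff]
        filter_upwards [this] with s hs
        rcases lt_or_gt_of_ne hs with h | h
        · simp [h, h.not_gt, ENNReal.ofReal_le_ofReal h.le]
        · simp [h, h.not_gt, ENNReal.ofReal_le_ofReal h.le]
    _ = ∫⁻ c, ∫⁻ s, (if s < c then ENNReal.ofReal c else 0) ∂ν ∂ν +
        ∫⁻ c, ∫⁻ s, (if c < s then ENNReal.ofReal s else 0) ∂ν ∂ν := by
        rw [← lintegral_add_left hm1.lintegral_prod_right']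
        refine lintegral_congr fun c => ?_
        exact lintegral_add_left (hm1.comp measurable_prodMk_left) _
    _ ≤ _ := by
        rw [h2, two_mul]
        gcongr

lemma lintegral_add3 {X : Type*} [MeasurableSpace X] {μ : Measure X} {f g h : X → ℝ≥0∞}
    (hf : Measurable f) (hg : Measurable g) :
    ∫⁻ x, f x ∂μ + ∫⁻ x, g x ∂μ + ∫⁻ x, h x ∂μ = ∫⁻ x, (f x + g x + h x) ∂μ := by
  have hfg : Measurable (fun x => f x + g x) := hf.add hg
  rw [← lintegral_add_left hf, ← lintegral_add_left hfg]

lemma abstract_key {D : Type*} [MeasurableSpace D] {μ : Measure D} [SFinite μ] (hμ : μ ≠ 0)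
    {H : Type*} [Group H] [Countable H] {act : H → D → D}
    (hinv : ∀ γ z, act γ (act γ⁻¹ z) = z)
    (hmp : ∀ γ, MeasurePreserving (act γ) μ μ) {ψ : D → ℝ≥0∞} (hψm : Measurable ψ)
    (hψ : ∀ z, ∑' γ, ψ (act γ z) = 1) (hV : ∫⁻ z, ψ z ∂μ ≠ ∞)
    {p : D → D → ℝ≥0∞} (hpm : Measurable (fun q : D × D => p q.1 q.2))
    (hps : ∀ z w, p z w = p w z) (hpinv : ∀ γ z w, p (act γ z) (act γ w) = p z w)
    (hp0 : ∀ z w, p z w ≠ 0) {m : ℝ≥0∞} (hm : ∀ z, ∫⁻ w, p z w ∂μ = m) (hmtop : m ≠ ∞)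
    {B : ℝ} {T : D → ℝ → ℝ} (hT : Measurable (fun q : D × ℝ => T q.1 q.2))
    (hTinv : ∀ γ z w s c, T (act γ w) s < T (act γ z) c ↔ T w s < T z c)
    (hsub : ∀ z, ∀ c ∈ Ioo 0 B, m * ENNReal.ofReal c ≤
      ∫⁻ w, p z w * (volume.restrict (Ioo 0 B)) {s | T w s < T z c} ∂μ) :
    ∃ z₀, ∀ᵐ w ∂μ, ∀ᵐ c ∂(volume.restrict (Ioo 0 B)), ∀ᵐ s ∂(volume.restrict (Ioo 0 B)),
      (s < c → T w s < T z₀ c) ∧ (c < s → T z₀ c < T w s) := by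
  set ν : Measure ℝ := volume.restrict (Ioo 0 B) with hν
  set V := ∫⁻ z, ψ z ∂μ with hVdef
  -- the basic four-variable functions
  let g1 : ((D × D) × ℝ) × ℝ → ℝ≥0∞ := fun q =>
    if T q.1.1.2 q.2 < T q.1.1.1 q.1.2 then ENNReal.ofReal q.1.2 else 0
  let g2 : ((D × D) × ℝ) × ℝ → ℝ≥0∞ := fun q =>
    if T q.1.1.1 q.1.2 < T q.1.1.2 q.2 then ENNReal.ofReal q.2 else 0
  let mx : ((D × D) × ℝ) × ℝ → ℝ≥0∞ := fun q => max (ENNReal.ofReal q.1.2) (ENNReal.ofReal q.2)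
  have mT1 : Measurable (fun q : ((D × D) × ℝ) × ℝ => T q.1.1.2 q.2) :=
    hT.comp ((measurable_snd.comp (measurable_fst.comp measurable_fst)).prodMk measurable_snd)
  have mT2 : Measurable (fun q : ((D × D) × ℝ) × ℝ => T q.1.1.1 q.1.2) :=
    hT.comp ((measurable_fst.comp (measurable_fst.comp measurable_fst)).prodMk
      (measurable_snd.comp measurable_fst))
  have mc : Measurable (fun q : ((D × D) × ℝ) × ℝ => ENNReal.ofReal q.1.2) :=
    (measurable_snd.comp measurable_fst).ennreal_ofReal
  have ms : Measurable (fun q : ((D × D) × ℝ) × ℝ => ENNReal.ofReal q.2) :=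
    measurable_snd.ennreal_ofReal
  have mg1 : Measurable g1 := Measurable.ite (measurableSet_lt mT1 mT2) mc measurable_const
  have mg2 : Measurable g2 := Measurable.ite (measurableSet_lt mT2 mT1) ms measurable_const
  have mmx : Measurable mx := mc.max ms
  let e : ((D × D) × ℝ) × ℝ → ℝ≥0∞ := fun q => mx q - (g1 q + g2 q)
  have me : Measurable e := mmx.sub (mg1.add mg2)
  have hle : ∀ q, g1 q + g2 q ≤ mx q := by
    intro q
    simp only [g1, g2, mx]
    rcases lt_trichotomy (T q.1.1.2 q.2) (T q.1.1.1 q.1.2) with h | h | h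
    · simp [h, h.not_gt]
    · simp [h]
    · simp [h, h.not_gt]
  have hadd : ∀ q, g1 q + g2 q + e q = mx q := fun q => add_tsub_cancel_of_le (hle q)
  -- double integrals
  let A1 : D × D → ℝ≥0∞ := fun q => ∫⁻ c, ∫⁻ s, g1 ((q, c), s) ∂ν ∂ν
  let A2 : D × D → ℝ≥0∞ := fun q => ∫⁻ c, ∫⁻ s, g2 ((q, c), s) ∂ν ∂ν
  let E : D × D → ℝ≥0∞ := fun q => ∫⁻ c, ∫⁻ s, e ((q, c), s) ∂ν ∂ν
  let M : ℝ≥0∞ := ∫⁻ c, ∫⁻ s, max (ENNReal.ofReal c) (ENNReal.ofReal s) ∂ν ∂ν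
  have mA1 : Measurable A1 := (mg1.lintegral_prod_right').lintegral_prod_right'
  have mA2 : Measurable A2 := (mg2.lintegral_prod_right').lintegral_prod_right'
  have mE : Measurable E := (me.lintegral_prod_right').lintegral_prod_right'
  have hsum : ∀ q, A1 q + A2 q + E q = M := by
    intro q
    have i1 : Measurable (fun c => ∫⁻ s, g1 ((q, c), s) ∂ν) :=
      (mg1.lintegral_prod_right').comp measurable_prodMk_left
    have i2 : Measurable (fun c => ∫⁻ s, g2 ((q, c), s) ∂ν) :=
      (mg2.lintegral_prod_right').comp measurable_prodMk_left
    have j1 : ∀ c, Measurable (fun s => g1 ((q, c), s)) := fun c => mg1.comp measurable_prodMk_left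
    have j2 : ∀ c, Measurable (fun s => g2 ((q, c), s)) := fun c => mg2.comp measurable_prodMk_left
    simp only [A1, A2, E, M]
    rw [lintegral_add3 i1 i2]
    refine lintegral_congr fun c => ?_
    rw [lintegral_add3 (j1 c) (j2 c)]
    refine lintegral_congr fun s => ?_
    exact hadd ((q, c), s)
  have hA2 : ∀ z w, A2 (z, w) = A1 (w, z) := by
    intro z w
    simp only [A1, A2]
    exact lintegral_lintegral_swap (f := fun c s => g2 (((z, w), c), s))
      (mg2.comp ((measurable_const.prodMk measurable_fst).prodMk measurable_snd)).aemeasurable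
  let Q : ℝ≥0∞ := ∫⁻ c, ENNReal.ofReal c * ENNReal.ofReal c ∂ν
  have hM : M ≤ 2 * Q := max_integral_le B
  have hQtop : Q ≠ ∞ := by
    have : Q ≤ ∫⁻ c, ENNReal.ofReal B * ENNReal.ofReal B ∂ν := by
      refine lintegral_mono_ae ?_
      filter_upwards [ae_restrict_mem measurableSet_Ioo] with c hc
      have := ENNReal.ofReal_le_ofReal hc.2.le
      gcongr
    refine ne_top_of_le_ne_top ?_ this
    rw [lintegral_const, hν, Measure.restrict_apply_univ, Real.volume_Ioo]
    finiteness
  have hpz : ∀ z, Measurable (fun w => p z w) := fun z => hpm.comp measurable_prodMk_left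
  -- lower bound
  have hlow : ∀ z, m * Q ≤ ∫⁻ w, p z w * A1 (z, w) ∂μ := by
    intro z
    have hA1 : ∀ w, A1 (z, w) = ∫⁻ c, ENNReal.ofReal c * ν {s | T w s < T z c} ∂ν := by
      intro w
      refine lintegral_congr fun c => ?_
      have hms : MeasurableSet {s | T w s < T z c} :=
        measurableSet_lt (hT.comp measurable_prodMk_left) measurable_const
      rw [← lintegral_indicator_const hms]
      refine lintegral_congr fun s => ?_
      simp [g1, indicator]
    have mν : Measurable (fun q : D × ℝ => ν {s | T q.1 s < T z q.2}) := by
      have : MeasurableSet {r : (D × ℝ) × ℝ | T r.1.1 r.2 < T z r.1.2} :=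
        measurableSet_lt
          (hT.comp ((measurable_fst.comp measurable_fst).prodMk measurable_snd))
          (hT.comp (measurable_const.prodMk (measurable_snd.comp measurable_fst)))
      exact measurable_measure_prodMk_left this
    calc m * Q = ∫⁻ c, ENNReal.ofReal c * (m * ENNReal.ofReal c) ∂ν := by
          simp only [Q]
          rw [← lintegral_const_mul' _ _ hmtop]
          refine lintegral_congr fun c => ?_
          ring
      _ ≤ ∫⁻ c, ENNReal.ofReal c * ∫⁻ w, p z w * ν {s | T w s < T z c} ∂μ ∂ν := by
          refine lintegral_mono_ae ?_
          filter_upwards [ae_restrict_mem measurableSet_Ioo] with c hc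
          have := hsub z c hc
          gcongr
      _ = ∫⁻ c, ∫⁻ w, ENNReal.ofReal c * (p z w * ν {s | T w s < T z c}) ∂μ ∂ν := by
          refine lintegral_congr fun c => ?_
          rw [lintegral_const_mul' _ _ ENNReal.ofReal_ne_top]
      _ = ∫⁻ w, ∫⁻ c, ENNReal.ofReal c * (p z w * ν {s | T w s < T z c}) ∂ν ∂μ := by
          refine lintegral_lintegral_swap (Measurable.aemeasurable ?_)
          exact (measurable_fst.ennreal_ofReal).mul
            (((hpz z).comp measurable_snd).mul (mν.comp measurable_swap))
      _ = _ := by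
          refine lintegral_congr fun w => ?_
          rw [hA1, ← lintegral_const_mul]
          · refine lintegral_congr fun c => ?_
            ring
          · exact (measurable_id.ennreal_ofReal).mul (mν.comp measurable_prodMk_left)
  have hlow1 : V * (m * Q) ≤ ∫⁻ z, ψ z * ∫⁻ w, p z w * A1 (z, w) ∂μ ∂μ := by
    rw [hVdef, ← lintegral_mul_const _ hψm]
    refine lintegral_mono fun z => ?_
    have := hlow z
    simp only
    gcongr
  have hlow2 : V * (m * Q) ≤ ∫⁻ z, ψ z * ∫⁻ w, p z w * A2 (z, w) ∂μ ∂μ := by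
    have := mass_transport hinv hmp hψm hψ (k := fun z w => p z w * A1 (z, w))
      (hpm.mul mA1) (by
        intro γ z w
        simp only [A1, g1, hTinv, hpinv])
    rw [this] at hlow1
    refine hlow1.trans (le_of_eq ?_)
    refine lintegral_congr fun z => ?_
    congr 1
    refine lintegral_congr fun w => ?_
    rw [hA2, hps]
  have mpA1 : ∀ z, Measurable (fun w => p z w * A1 (z, w)) :=
    fun z => (hpm.mul mA1).comp measurable_prodMk_left
  have mpA2 : ∀ z, Measurable (fun w => p z w * A2 (z, w)) :=
    fun z => (hpm.mul mA2).comp measurable_prodMk_left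
  have htot : ∫⁻ z, ψ z * ∫⁻ w, p z w * A1 (z, w) ∂μ ∂μ +
      ∫⁻ z, ψ z * ∫⁻ w, p z w * A2 (z, w) ∂μ ∂μ +
      ∫⁻ z, ψ z * ∫⁻ w, p z w * E (z, w) ∂μ ∂μ ≤ V * (m * Q) + V * (m * Q) := by
    have i1 : Measurable (fun z => ψ z * ∫⁻ w, p z w * A1 (z, w) ∂μ) :=
      hψm.mul (hpm.mul mA1).lintegral_prod_right'
    have i2 : Measurable (fun z => ψ z * ∫⁻ w, p z w * A2 (z, w) ∂μ) :=
      hψm.mul (hpm.mul mA2).lintegral_prod_right'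
    rw [lintegral_add3 i1 i2]
    calc _ = ∫⁻ z, ψ z * (m * M) ∂μ := by
          refine lintegral_congr fun z => ?_
          rw [← mul_add, ← mul_add, lintegral_add3 (mpA1 z) (mpA2 z), ← hm z, ← lintegral_mul_const _ (hpz z)]
          congr 1
          refine lintegral_congr fun w => ?_
          rw [← hsum (z, w)]
          ring
      _ = V * (m * M) := lintegral_mul_const _ hψm
      _ ≤ V * (m * (2 * Q)) := by gcongr
      _ = _ := by ring
  have hzero : ∫⁻ z, ψ z * ∫⁻ w, p z w * E (z, w) ∂μ ∂μ = 0 := by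
    have hfin : V * (m * Q) + V * (m * Q) ≠ ∞ := by finiteness
    have h1 : V * (m * Q) + V * (m * Q) + ∫⁻ z, ψ z * ∫⁻ w, p z w * E (z, w) ∂μ ∂μ
        ≤ V * (m * Q) + V * (m * Q) + 0 := by
      rw [add_zero]
      refine le_trans ?_ htot
      gcongr
    exact nonpos_iff_eq_zero.mp ((ENNReal.add_le_add_iff_left hfin).mp h1)
  have hVne : V ≠ 0 := by
    intro h0
    apply hμ
    have : ∫⁻ z, (1 : ℝ≥0∞) ∂μ = 0 := by
      have h2 : ∫⁻ z, (1 : ℝ≥0∞) ∂μ = ∫⁻ z, ∑' γ, ψ (act γ z) ∂μ :=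
        lintegral_congr fun z => (hψ z).symm
      have mm : ∀ γ, AEMeasurable (fun z => ψ (act γ z)) μ :=
        fun γ => (hψm.comp (hmp γ).measurable).aemeasurable
      rw [h2, lintegral_tsum mm]
      simp only [fun γ => (hmp γ).lintegral_comp hψm]
      simp [← hVdef, h0]
    simpa using this
  have mpE : Measurable (fun z => ψ z * ∫⁻ w, p z w * E (z, w) ∂μ) :=
    hψm.mul (hpm.mul mE).lintegral_prod_right'
  rw [lintegral_eq_zero_iff mpE] at hzero
  have : ∃ z₀, ψ z₀ ≠ 0 ∧ ψ z₀ * ∫⁻ w, p z₀ w * E (z₀, w) ∂μ = 0 := by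
    by_contra! hcon
    apply hVne
    rw [hVdef, lintegral_eq_zero_iff hψm]
    filter_upwards [hzero] with z hz
    by_contra hne
    exact hcon z hne hz
  obtain ⟨z₀, hz0, hz1⟩ := this
  refine ⟨z₀, ?_⟩
  have hz2 := (mul_eq_zero.mp hz1).resolve_left hz0
  have mpE0 : Measurable (fun w => p z₀ w * E (z₀, w)) :=
    (hpm.mul mE).comp measurable_prodMk_left
  rw [lintegral_eq_zero_iff mpE0] at hz2
  filter_upwards [hz2] with w hw
  have hw2 : E (z₀, w) = 0 := (mul_eq_zero.mp hw).resolve_left (hp0 _ _)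
  have mE0 : Measurable (fun c => ∫⁻ s, e (((z₀, w), c), s) ∂ν) :=
    me.lintegral_prod_right'.comp measurable_prodMk_left
  rw [show E (z₀, w) = ∫⁻ c, ∫⁻ s, e (((z₀, w), c), s) ∂ν ∂ν from rfl,
    lintegral_eq_zero_iff mE0] at hw2
  filter_upwards [hw2, ae_restrict_mem measurableSet_Ioo] with c hc hc0
  have hc' : ∫⁻ s, e (((z₀, w), c), s) ∂ν = 0 := hc
  have me0 : Measurable (fun s => e (((z₀, w), c), s)) := me.comp measurable_prodMk_left
  rw [lintegral_eq_zero_iff me0] at hc'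
  filter_upwards [hc', ae_restrict_mem measurableSet_Ioo] with s hs hs0
  have hs' : e (((z₀, w), c), s) = 0 := hs
  have h1 := hadd (((z₀, w), c), s)
  rw [hs', add_zero] at h1
  simp only [g1, g2, mx] at h1
  have hcp := ENNReal.ofReal_pos.mpr hc0.1
  have hsp := ENNReal.ofReal_pos.mpr hs0.1
  constructor
  · intro hlt
    have hlt' : ENNReal.ofReal s < ENNReal.ofReal c := (ENNReal.ofReal_lt_ofReal_iff hc0.1).mpr hlt
    rw [max_eq_left hlt'.le] at h1
    by_contra hn
    rw [if_neg hn, zero_add] at h1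
    split_ifs at h1
    · exact hlt'.ne h1
    · exact hcp.ne h1
  · intro hlt
    have hlt' : ENNReal.ofReal c < ENNReal.ofReal s := (ENNReal.ofReal_lt_ofReal_iff hs0.1).mpr hlt
    rw [max_eq_right hlt'.le] at h1
    by_contra hn
    rw [if_neg hn, add_zero] at h1
    split_ifs at h1
    · exact hlt'.ne h1
    · exact hsp.ne h1

end LF
namespace LF

abbrev Dsc : Type := ↥unitDisc

def hyp : Measure Dsc :=
  (Measure.comap (Subtype.val : Dsc → ℂ) volume).withDensity (fun z => lam z.1)

lemma lint_hyp (G : ℂ → ℝ≥0∞) :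
    ∫⁻ z : Dsc, G z.1 ∂hyp = ∫⁻ z in unitDisc, lam z * G z := by
  unfold hyp
  rw [lintegral_withDensity_eq_lintegral_mul_non_measurable]
  · exact lintegral_subtype_comap isOpen_disc.measurableSet (fun z => lam z * G z)
  · exact measurable_lam.comp measurable_subtype_coe
  · exact Eventually.of_forall fun z => ENNReal.ofReal_lt_top

lemma hyp_sfinite : SFinite hyp := by
  unfold hyp
  have : SFinite (Measure.comap (Subtype.val : Dsc → ℂ) volume) := by
    have : IsFiniteMeasure (Measure.comap (Subtype.val : Dsc → ℂ) volume) := by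
      constructor
      rw [comap_subtype_coe_apply isOpen_disc.measurableSet, Set.image_univ, Subtype.range_coe]
      exact Metric.isBounded_ball.measure_lt_top
    infer_instance
  infer_instance

lemma hyp_open {U : Set Dsc} (hU : IsOpen U) (h0 : hyp U = 0) : U = ∅ := by
  unfold hyp at h0
  rw [withDensity_apply_eq_zero (f := fun z : Dsc => lam z.1)
    (measurable_lam.comp measurable_subtype_coe)] at h0
  have h1 : ({z : Dsc | lam z.1 ≠ 0} ∩ U) = U := by
    apply Set.inter_eq_right.mpr
    intro z _
    have := one_sub_pos z.2
    simp only [lam, Set.mem_ofPred_eq, ne_eq, ENNReal.ofReal_eq_zero, not_le]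
    positivity
  rw [h1, comap_subtype_coe_apply isOpen_disc.measurableSet] at h0
  · have h2 : IsOpen (Subtype.val '' U) := isOpen_disc.isOpenMap_subtype_val _ hU
    have h3 := (h2.measure_eq_zero_iff volume).mp h0
    simpa using h3

lemma exists_of_ae {B : ℝ} {P : ℝ → Prop}
    (h : ∀ᵐ c ∂((volume : Measure ℝ).restrict (Ioo 0 B)), P c)
    {u v : ℝ} (hu : 0 ≤ u) (huv : u < v) (hv : v ≤ B) : ∃ c ∈ Ioo u v, P c := by
  by_contra! hcon
  rw [ae_restrict_iff' measurableSet_Ioo, ae_iff] at h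
  have h1 : Ioo u v ⊆ {a | ¬ (a ∈ Ioo 0 B → P a)} := by
    intro c hc
    simp only [Set.mem_ofPred_eq, Classical.not_imp]
    exact ⟨⟨hu.trans_lt hc.1, hc.2.trans_le hv⟩, hcon c hc⟩
  have h2 := measure_mono_null h1 h
  rw [Real.volume_Ioo, ENNReal.ofReal_eq_zero] at h2
  linarith

lemma ivt {g : unitInterval → ℝ} (hg : Continuous g) {u v : unitInterval} (huv : u ≤ v) {c : ℝ}
    (h1 : g u ≤ c) (h2 : c ≤ g v) : ∃ y ∈ Icc u v, g y = c := by
  have hI := intermediate_value_Icc (f := fun t : ℝ => g (projIcc 0 1 zero_le_one t))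
    (a := u.1) (b := v.1) huv (hg.comp continuous_projIcc).continuousOn
  obtain ⟨y, hy, hyc⟩ := hI (show c ∈ _ by simpa using ⟨h1, h2⟩)
  have hy01 : y ∈ Icc (0 : ℝ) 1 := ⟨u.2.1.trans hy.1, hy.2.trans v.2.2⟩
  refine ⟨⟨y, hy01⟩, ⟨hy.1, hy.2⟩, ?_⟩
  simpa [projIcc_of_mem zero_le_one hy01] using hyc

lemma measurable_ker : Measurable (fun q : ℂ × ℂ => ker q.1 q.2) := by
  unfold ker
  have h1 : Measurable (fun q : ℂ × ℂ => (starRingEnd ℂ) q.1) :=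
    (Complex.continuous_conj.comp continuous_fst).measurable
  have h2 : Measurable (fun q : ℂ × ℂ => ‖1 - (starRingEnd ℂ) q.1 * q.2‖) := by fun_prop
  fun_prop

lemma measurable_kerD :
    Measurable (fun q : Dsc × Dsc => ENNReal.ofReal (ker q.1.1 q.2.1)) := by
  have h : Measurable (fun q : Dsc × Dsc => ((q.1.1, q.2.1) : ℂ × ℂ)) :=
    (measurable_subtype_coe.comp measurable_fst).prodMk
      (measurable_subtype_coe.comp measurable_snd)
  have h2 : Measurable (fun q : ℂ × ℂ => ENNReal.ofReal (ker q.1 q.2)) :=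
    measurable_ker.ennreal_ofReal
  have h3 := h2.comp h
  simpa only [Function.comp_def] using h3

set_option maxHeartbeats 1600000 in
theorem analytic_key {H : Type*} [Group H] (ρ : H → ℂ → ℂ) (hΓ : IsCocompactFuchsian H ρ)
    (σ : H → unitInterval → unitInterval) (hσ : IsActionByHomeomorphisms H unitInterval σ)
    (f : ℂ → unitInterval → ℝ)
    (hcont : ContinuousOn (fun p : ℂ × unitInterval => f p.1 p.2)
      (unitDisc ×ˢ (univ : Set unitInterval)))
    (hharm : ∀ x : unitInterval, HarmonicOnSet (fun z => f z x) unitDisc)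
    (hinv : ∀ γ : H, ∀ z ∈ unitDisc, ∀ x : unitInterval, f (ρ γ z) (σ γ x) = f z x)
    (hmono : ∀ γ, StrictMono (σ γ)) {a b : unitInterval} (hab : a < b)
    (ha : ∀ γ, σ γ a = a) (hb : ∀ γ, σ γ b = b) {B : ℝ} (hB : 0 < B)
    (hfa : ∀ z ∈ unitDisc, f z a = 0) (hfb : ∀ z ∈ unitDisc, f z b = B)
    (hle : ∀ z ∈ unitDisc, ∀ x ∈ Icc a b, f z x ≤ B) :
    ∃ t ∈ Icc a b, ∀ z ∈ unitDisc, f z t = B / 2 := by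
  have : SFinite hyp := hyp_sfinite
  have z0mem : (0 : ℂ) ∈ unitDisc := by simp [mem_disc]
  -- continuity facts
  have hF : Continuous (fun q : Dsc × unitInterval => f q.1.1 q.2) := by
    have : Continuous (fun q : Dsc × unitInterval => ((q.1.1, q.2) : ℂ × unitInterval)) := by
      fun_prop
    exact hcont.comp_continuous this (fun q => ⟨q.1.2, mem_univ _⟩)
  have hFz : ∀ z : Dsc, Continuous (f z.1) := fun z =>
    hF.comp (continuous_const.prodMk continuous_id)
  have hFx : ∀ x : unitInterval, Continuous (fun z : Dsc => f z.1 x) := fun x =>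
    hF.comp (continuous_id.prodMk continuous_const)
  -- countability
  have hcount : Countable H := by
    have hcov : (univ : Set H) ⊆ ⋃ n : ℕ,
        {γ : H | ((ρ γ '' closedBall 0 (1 - 1 / ((n : ℝ) + 2))) ∩
          closedBall 0 (1 - 1 / ((n : ℝ) + 2))).Nonempty} := by
      intro γ _
      have h1 := hΓ.maps_disc γ 0 z0mem
      rw [mem_disc] at h1
      obtain ⟨n, hn⟩ := exists_nat_gt (1 / (1 - ‖ρ γ 0‖))
      have hpos : 0 < 1 - ‖ρ γ 0‖ := by linarith
      rw [div_lt_iff₀ hpos] at hn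
      have hn2 : (0 : ℝ) < (n : ℝ) + 2 := by positivity
      have h3 : 1 / ((n : ℝ) + 2) ≤ 1 - ‖ρ γ 0‖ := by
        rw [div_le_iff₀ hn2]; nlinarith
      refine mem_iUnion.mpr ⟨n, ρ γ 0, ⟨0, ?_, rfl⟩, ?_⟩
      · have : 1 / ((n : ℝ) + 2) ≤ 1 := by
          rw [div_le_one hn2]; linarith [(Nat.cast_nonneg n : (0 : ℝ) ≤ n)]
        simp only [mem_closedBall, dist_self]; linarith
      · simp only [mem_closedBall, dist_zero_right]; linarith
    have hc : (univ : Set H).Countable := by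
      refine Set.Countable.mono hcov (countable_iUnion fun n => Set.Finite.countable ?_)
      apply hΓ.properly_discontinuous
      · intro z hz
        rw [mem_disc]
        simp only [mem_closedBall, dist_zero_right] at hz
        have : 0 < 1 / ((n : ℝ) + 2) := by positivity
        linarith
      · exact isCompact_closedBall _ _
    exact countable_univ_iff.mp hc
  -- the action on the disc
  let act : H → Dsc → Dsc := fun γ z => ⟨ρ γ z.1, hΓ.maps_disc γ z.1 z.2⟩
  choose α β habn hmob using hΓ.moebius
  have hmob' : ∀ γ, ∀ z ∈ unitDisc, ρ γ z = mob (α γ) (β γ) z := hmob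
  have act_mul : ∀ γ₁ γ₂ z, act (γ₁ * γ₂) z = act γ₁ (act γ₂ z) := fun γ₁ γ₂ z =>
    Subtype.ext (hΓ.mul_act γ₁ γ₂ z.1 z.2)
  have act_one : ∀ z, act 1 z = z := fun z => Subtype.ext (hΓ.one_act z.1 z.2)
  have hactinv : ∀ γ z, act γ (act γ⁻¹ z) = z := by
    intro γ z
    rw [← act_mul, mul_inv_cancel, act_one]
  have hactc : ∀ γ, Continuous (act γ) := by
    intro γ
    apply Continuous.subtype_mk
    have : ContinuousOn (ρ γ) unitDisc := by
      have h1 : ContinuousOn (mob (α γ) (β γ)) unitDisc := fun z hz =>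
        (mob_hasDerivAt (habn γ) hz).continuousAt.continuousWithinAt
      exact h1.congr (hmob' γ)
    exact this.comp_continuous continuous_subtype_val (fun z => z.2)
  have hmp : ∀ γ, MeasurePreserving (act γ) hyp hyp := by
    intro γ
    refine ⟨(hactc γ).measurable, ?_⟩
    ext s hs
    rw [Measure.map_apply (hactc γ).measurable hs]
    have e1 : ∀ s : Set Dsc, MeasurableSet s →
        hyp s = ∫⁻ z : Dsc, (Subtype.val '' s).indicator 1 z.1 ∂hyp := by
      intro s hs
      rw [← lintegral_indicator_one hs]
      apply lintegral_congr
      intro z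
      simp only [Set.indicator]
      congr 1
      simp
    rw [e1 s hs, lint_hyp, ← lintegral_mob (habn γ), e1 _ ((hactc γ).measurable hs), lint_hyp]
    apply setLIntegral_congr_fun isOpen_disc.measurableSet
    intro z hz
    simp only
    congr 1
    simp only [Set.indicator]
    congr 1
    rw [← hmob' γ z hz]
    simp [act, hz, hΓ.maps_disc γ z hz]
  -- the fundamental weight
  obtain ⟨K, hKd, hKc, hK⟩ := hΓ.cocompact
  let KD : Set Dsc := Subtype.val ⁻¹' K
  have hKDm : MeasurableSet KD := measurable_subtype_coe hKc.isClosed.measurableSet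
  let ind : Dsc → ℝ≥0∞ := KD.indicator 1
  have indm : Measurable ind := measurable_one.indicator hKDm
  let N : Dsc → ℝ≥0∞ := fun z => ∑' γ, ind (act γ z)
  have Nm : Measurable N := Measurable.tsum fun γ => indm.comp (hactc γ).measurable
  have N1 : ∀ z, 1 ≤ N z := by
    intro z
    obtain ⟨γ, hγ⟩ := hK z.1 z.2
    refine le_trans ?_ (ENNReal.le_tsum γ)
    have : act γ z ∈ KD := hγ
    simp [ind, this]
  have Ninv : ∀ γ z, N (act γ z) = N z := by
    intro γ z
    simp only [N, ← act_mul]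
    exact (Equiv.mulRight γ).tsum_eq (fun δ => ind (act δ z))
  have Nfin : ∀ z, N z ≠ ∞ := by
    intro z
    have hfin : {γ : H | act γ z ∈ KD}.Finite := by
      refine (hΓ.properly_discontinuous (K ∪ {z.1}) ?_ (hKc.union isCompact_singleton)).subset ?_
      · rintro w (hw | hw)
        · exact hKd hw
        · rw [hw]; exact z.2
      · intro γ hγ
        exact ⟨ρ γ z.1, ⟨z.1, Or.inr rfl, rfl⟩, Or.inl hγ⟩
    have : N z = ∑ γ ∈ hfin.toFinset, ind (act γ z) := by
      apply tsum_eq_sum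
      intro γ hγ
      have : act γ z ∉ KD := by simpa using hγ
      simp [ind, this]
    rw [this]
    refine (ENNReal.sum_lt_top.mpr fun γ _ => ?_).ne
    by_cases h : act γ z ∈ KD <;> simp [ind, h]
  let ψ : Dsc → ℝ≥0∞ := fun z => ind z / N z
  have hψm : Measurable ψ := indm.div Nm
  have hψ : ∀ z, ∑' γ, ψ (act γ z) = 1 := by
    intro z
    simp only [ψ, Ninv, div_eq_mul_inv]
    rw [ENNReal.tsum_mul_right]
    exact ENNReal.mul_inv_cancel (zero_lt_one.trans_le (N1 z)).ne' (Nfin z)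
  have hV : ∫⁻ z, ψ z ∂hyp ≠ ∞ := by
    have h1 : ∫⁻ z, ψ z ∂hyp ≤ ∫⁻ z : Dsc, K.indicator 1 z.1 ∂hyp := by
      apply lintegral_mono
      intro z
      have : ψ z ≤ ind z := ENNReal.div_le_of_le_mul' (by
        calc ind z = 1 * ind z := (one_mul _).symm
          _ ≤ N z * ind z := by gcongr; exact N1 z)
      exact this
    refine (h1.trans_lt ?_).ne
    rw [lint_hyp]
    have h2 : ∫⁻ z in unitDisc, lam z * K.indicator 1 z ≤ ∫⁻ z in K, lam z := by
      rw [← lintegral_indicator hKc.isClosed.measurableSet]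
      refine (setLIntegral_le_lintegral _ _).trans (lintegral_mono fun z => ?_)
      by_cases h : z ∈ K <;> simp [h]
    refine h2.trans_lt ?_
    have hcl : ContinuousOn (fun z : ℂ => 1 / (1 - ‖z‖ ^ 2) ^ 2) K := by
      apply ContinuousOn.div continuousOn_const (by fun_prop)
      intro z hz
      have := one_sub_pos (hKd hz)
      positivity
    obtain ⟨C, hC⟩ := hKc.bddAbove_image hcl
    calc ∫⁻ z in K, lam z ≤ ∫⁻ z in K, ENNReal.ofReal C := by
          apply setLIntegral_mono' hKc.isClosed.measurableSet
          intro z hz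
          exact ENNReal.ofReal_le_ofReal (hC ⟨z, hz, rfl⟩)
      _ = ENNReal.ofReal C * volume K := by simp
      _ < ∞ := ENNReal.mul_lt_top ENNReal.ofReal_lt_top hKc.measure_lt_top
  -- the kernel
  let p : Dsc → Dsc → ℝ≥0∞ := fun z w => ENNReal.ofReal (ker z.1 w.1)
  have hpm : Measurable (fun q : Dsc × Dsc => p q.1 q.2) := measurable_kerD
  have hps : ∀ z w, p z w = p w z := fun z w => by simp only [p, ker_symm]
  have hpinv : ∀ γ z w, p (act γ z) (act γ w) = p z w := by
    intro γ z w
    simp only [p, act, hmob' γ _ z.2, hmob' γ _ w.2, ker_mob (habn γ) z.2 w.2]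
  have hp0 : ∀ z w, p z w ≠ 0 := by
    intro z w
    simpa [p] using ker_pos z.2 w.2
  have hm : ∀ z, ∫⁻ w, p z w ∂hyp = ENNReal.ofReal Real.pi := by
    intro z
    rw [← ker_mass z.2]
    exact lint_hyp (fun w => ENNReal.ofReal (ker z.1 w))
  -- the level function
  let S : Dsc → ℝ → Set unitInterval := fun z c => {x | x ∈ Icc a b ∧ (c ≤ f z.1 x ∨ x = b)}
  have hSleast : ∀ z c, ∃ x, IsLeast (S z c) x := by
    intro z c
    apply IsCompact.exists_isLeast
    · apply IsClosed.isCompact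
      apply IsClosed.inter isClosed_Icc
      apply IsClosed.union
      · exact isClosed_le continuous_const (hFz z)
      · exact isClosed_singleton
    · exact ⟨b, ⟨hab.le, le_rfl⟩, Or.inr rfl⟩
  choose τ hτ using hSleast
  have hτI : ∀ z c, τ z c ∈ Icc a b := fun z c => (hτ z c).1.1
  have hτle : ∀ z c x, x ∈ Icc a b → c ≤ f z.1 x → τ z c ≤ x := fun z c x hx h =>
    (hτ z c).2 ⟨hx, Or.inl h⟩
  have hτmono : ∀ z c c', c ≤ c' → τ z c ≤ τ z c' := by
    intro z c c' h
    refine (hτ z c).2 ⟨hτI z c', ?_⟩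
    rcases (hτ z c').1.2 with h1 | h1
    · exact Or.inl (h.trans h1)
    · exact Or.inr h1
  have hτv : ∀ z, ∀ c ∈ Ioo 0 B, f z.1 (τ z c) = c := by
    intro z c hc
    have h1 : c ≤ f z.1 (τ z c) := by
      rcases (hτ z c).1.2 with h1 | h1
      · exact h1
      · rw [h1, hfb _ z.2]; exact hc.2.le
    obtain ⟨y, hy, hyc⟩ := ivt (hFz z) (hτI z c).1 (by rw [hfa _ z.2]; exact hc.1.le) h1
    have h2 := hτle z c y ⟨hy.1, hy.2.trans (hτI z c).2⟩ hyc.ge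
    rw [← le_antisymm hy.2 h2, hyc]
  have hτact : ∀ γ z c, τ (act γ z) c = σ γ (τ z c) := by
    intro γ z c
    apply (hτ (act γ z) c).unique
    have hf1 : ∀ x, f (act γ z).1 (σ γ x) = f z.1 x := fun x => hinv γ z.1 z.2 x
    constructor
    · refine ⟨⟨?_, ?_⟩, ?_⟩
      · rw [← ha γ]; exact (hmono γ).monotone (hτI z c).1
      · rw [← hb γ]; exact (hmono γ).monotone (hτI z c).2
      · rw [hf1]
        rcases (hτ z c).1.2 with h1 | h1
        · exact Or.inl h1
        · right; rw [h1, hb]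
    · intro x hx
      have hx' : x = σ γ (σ γ⁻¹ x) := by rw [← hσ.mul_act, mul_inv_cancel, hσ.one_act]
      rw [hx']
      apply (hmono γ).monotone
      apply (hτ z c).2
      refine ⟨⟨?_, ?_⟩, ?_⟩
      · rw [← ha γ⁻¹]; exact (hmono _).monotone hx.1.1
      · rw [← hb γ⁻¹]; exact (hmono _).monotone hx.1.2
      · rcases hx.2 with h1 | h1
        · left; rw [← hf1, ← hx']; exact h1
        · right; rw [h1, hb]
  let T : Dsc → ℝ → ℝ := fun z c => (τ z c : ℝ)
  have hTm : Measurable (fun q : Dsc × ℝ => T q.1 q.2) := by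
    apply measurable_of_Iic
    intro x
    let E : Set ((Dsc × ℝ) × unitInterval) :=
      {q | (q.2 ∈ Icc a b ∧ (q.2 : ℝ) ≤ x) ∧ (q.1.2 ≤ f q.1.1.1 q.2 ∨ q.2 = b)}
    have hE : IsClosed E := by
      apply IsClosed.inter
      · apply IsClosed.inter
        · exact isClosed_Icc.preimage continuous_snd
        · exact isClosed_le (continuous_subtype_val.comp continuous_snd) continuous_const
      · apply IsClosed.union
        · refine isClosed_le (continuous_snd.comp continuous_fst) ?_
          exact hF.comp ((continuous_fst.comp continuous_fst).prodMk continuous_snd)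
        · exact isClosed_eq continuous_snd continuous_const
    have h2 : (fun q : Dsc × ℝ => T q.1 q.2) ⁻¹' Iic x = Prod.fst '' E := by
      ext q
      constructor
      · intro hq
        exact ⟨(q, τ q.1 q.2), ⟨⟨hτI _ _, hq⟩, (hτ q.1 q.2).1.2⟩, rfl⟩
      · rintro ⟨⟨q', y⟩, ⟨⟨hy1, hy2⟩, hy3⟩, rfl⟩
        have : τ q'.1 q'.2 ≤ y := (hτ q'.1 q'.2).2 ⟨hy1, hy3⟩
        exact le_trans (Subtype.coe_le_coe.mpr this) hy2
    rw [h2]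
    exact (isClosedMap_fst_of_compactSpace _ hE).measurableSet
  have hTinv : ∀ γ z w s c, T (act γ w) s < T (act γ z) c ↔ T w s < T z c := by
    intro γ z w s c
    simp only [T, hτact, Subtype.coe_lt_coe]
    exact (hmono γ).lt_iff_lt
  have hsub : ∀ z, ∀ c ∈ Ioo 0 B, ENNReal.ofReal Real.pi * ENNReal.ofReal c ≤
      ∫⁻ w, p z w * ((volume : Measure ℝ).restrict (Ioo 0 B)) {s | T w s < T z c} ∂hyp := by
    intro z c hc
    have h1 := berezin_le (hharm (τ z c)) z.2
    simp only [hτv z c hc] at h1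
    refine h1.trans ?_
    rw [← lint_hyp (fun w => ENNReal.ofReal (ker z.1 w) * ENNReal.ofReal (f w (τ z c)))]
    apply lintegral_mono
    intro w
    simp only [p]
    gcongr
    have h2 : Ioo 0 (f w.1 (τ z c)) ⊆ {s | T w s < T z c} ∩ Ioo 0 B := by
      intro s hs
      have hfB := hle w.1 w.2 _ (hτI z c)
      have hs' : s ∈ Ioo 0 B := ⟨hs.1, hs.2.trans_le hfB⟩
      refine ⟨?_, hs'⟩
      have h3 := hτle w s (τ z c) (hτI z c) hs.2.le
      rcases h3.lt_or_eq with h4 | h4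
      · exact h4
      · have := hτv w s hs'
        rw [h4] at this
        exact absurd this hs.2.ne'
    calc ENNReal.ofReal (f w.1 (τ z c)) = volume (Ioo 0 (f w.1 (τ z c))) := by simp
      _ ≤ volume ({s | T w s < T z c} ∩ Ioo 0 B) := measure_mono h2
      _ ≤ _ := Measure.le_restrict_apply _ _
  have hne : hyp ≠ 0 := by
    intro h
    have := hyp_open isOpen_univ (by rw [h]; simp)
    have h3 : (⟨0, z0mem⟩ : Dsc) ∈ (univ : Set Dsc) := mem_univ _
    rw [this] at h3
    exact h3
  obtain ⟨z₀, hz₀⟩ := abstract_key hne hactinv hmp hψm hψ hV hpm hps hpinv hp0 hm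
    ENNReal.ofReal_ne_top hTm hTinv hsub
  -- left continuity
  have hleft : ∀ z, ∀ c ∈ Ioo 0 B, ∀ x ∈ Icc a b, (∀ s ∈ Ioo 0 c, τ z s ≤ x) → τ z c ≤ x := by
    intro z c hc x hx h
    obtain ⟨y, hy, hymax⟩ := (isCompact_Icc : IsCompact (Icc a x)).exists_isMaxOn
      ⟨a, le_rfl, hx.1⟩ (hFz z).continuousOn
    refine (hτle z c y ⟨hy.1, hy.2.trans hx.2⟩ ?_).trans hy.2
    apply le_of_forall_lt
    intro s hs
    obtain ⟨s', hs1, hs2⟩ := exists_between (max_lt hs hc.1)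
    have h0 : 0 < s' := (le_max_right _ _).trans_lt hs1
    have h1 : f z.1 (τ z s') ≤ f z.1 y := hymax ⟨(hτI z s').1, h s' ⟨h0, hs2⟩⟩
    rw [hτv z s' ⟨h0, hs2.trans hc.2⟩] at h1
    exact ((le_max_left _ _).trans_lt hs1).trans_le h1
  have hc : B / 2 ∈ Ioo 0 B := ⟨by linarith, by linarith⟩
  have hae : ∀ᵐ w ∂hyp, f w.1 (τ z₀ (B / 2)) = B / 2 := by
    filter_upwards [hz₀] with w hw
    have k1 : ∀ s c, 0 < s → s < c → c < B → τ w s ≤ τ z₀ c := by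
      intro s c h0 hsc hcB
      obtain ⟨c', hc', hP⟩ := exists_of_ae hw (u := (s + c) / 2) (v := c) (by linarith)
        (by linarith) hcB.le
      obtain ⟨s', hs', hQ⟩ := exists_of_ae hP (u := s) (v := (s + c) / 2) h0.le
        (by linarith) (by linarith)
      have h1 : τ w s' < τ z₀ c' := hQ.1 (hs'.2.trans hc'.1)
      exact ((hτmono w _ _ hs'.1.le).trans h1.le).trans (hτmono z₀ _ _ hc'.2.le)
    have k2 : ∀ s c, 0 < s → s < c → c < B → τ z₀ s ≤ τ w c := by
      intro s c h0 hsc hcB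
      obtain ⟨c', hc', hP⟩ := exists_of_ae hw (u := s) (v := (s + c) / 2) h0.le
        (by linarith) (by linarith)
      obtain ⟨s', hs', hQ⟩ := exists_of_ae hP (u := (s + c) / 2) (v := c) (by linarith)
        (by linarith) hcB.le
      have h1 : τ z₀ c' < τ w s' := hQ.2 (hc'.2.trans hs'.1)
      exact ((hτmono z₀ _ _ hc'.1.le).trans h1.le).trans (hτmono w _ _ hs'.2.le)
    have heq : τ w (B / 2) = τ z₀ (B / 2) := by
      apply le_antisymm
      · exact hleft w _ hc _ (hτI _ _) fun s hs => k1 s _ hs.1 hs.2 hc.2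
      · exact hleft z₀ _ hc _ (hτI _ _) fun s hs => k2 s _ hs.1 hs.2 hc.2
    rw [← heq]
    exact hτv w _ hc
  refine ⟨τ z₀ (B / 2), hτI _ _, fun z hz => ?_⟩
  have hU := hyp_open (U := {w : Dsc | ¬ f w.1 (τ z₀ (B / 2)) = B / 2})
    (isOpen_ne_fun (hFx _) continuous_const) (ae_iff.mp hae)
  by_contra hcon
  have : (⟨z, hz⟩ : Dsc) ∈ {w : Dsc | ¬ f w.1 (τ z₀ (B / 2)) = B / 2} := hcon
  rw [hU] at this
  exact this

end LF
namespace LF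

/-- The standing data: a cocompact Fuchsian group with an action on the interval, and an
invariant leafwise harmonic function. -/
structure Sys (Γ : Type*) [Group Γ] (ρ : Γ → ℂ → ℂ) (σ : Γ → unitInterval → unitInterval)
    (f : ℂ → unitInterval → ℝ) : Prop where
  hΓ : IsCocompactFuchsian Γ ρ
  hσ : IsActionByHomeomorphisms Γ unitInterval σ
  hcont : ContinuousOn (fun p : ℂ × unitInterval => f p.1 p.2)
      (unitDisc ×ˢ (univ : Set unitInterval))
  hharm : ∀ x : unitInterval, HarmonicOnSet (fun z => f z x) unitDisc
  hinv : ∀ γ : Γ, ∀ z ∈ unitDisc, ∀ x : unitInterval, f (ρ γ z) (σ γ x) = f z x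

lemma zero_mem_disc : (0 : ℂ) ∈ unitDisc := by simp [mem_disc]

variable {Γ : Type*} [Group Γ] {ρ : Γ → ℂ → ℂ} {σ : Γ → unitInterval → unitInterval}
    {f : ℂ → unitInterval → ℝ}

lemma Sys.affine (S : Sys Γ ρ σ f) (s t : ℝ) : Sys Γ ρ σ (fun z x => s * f z x + t) where
  hΓ := S.hΓ
  hσ := S.hσ
  hcont := (continuousOn_const.mul S.hcont).add continuousOn_const
  hharm := by
    intro x z hz
    obtain ⟨r, hr, hsub, g, hg, hge⟩ := S.hharm x z hz
    refine ⟨r, hr, hsub, fun w => s * g w + t, (hg.const_mul _).add_const _, fun w hw => ?_⟩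
    have := hge w hw
    simp only at this ⊢
    rw [this]
    simp
  hinv := by
    intro γ z hz x
    simp only [S.hinv γ z hz x]

lemma Sys.cont_x (S : Sys Γ ρ σ f) {z : ℂ} (hz : z ∈ unitDisc) : Continuous (f z) := by
  have : Continuous (fun x : unitInterval => ((z, x) : ℂ × unitInterval)) := by fun_prop
  exact S.hcont.comp_continuous this (fun x => ⟨hz, mem_univ _⟩)

lemma Sys.inv_right (S : Sys Γ ρ σ f) (γ : Γ) (x : unitInterval) : σ γ (σ γ⁻¹ x) = x := by
  rw [← S.hσ.mul_act, mul_inv_cancel, S.hσ.one_act]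

lemma Sys.inv_left (S : Sys Γ ρ σ f) (γ : Γ) (x : unitInterval) : σ γ⁻¹ (σ γ x) = x := by
  rw [← S.hσ.mul_act, inv_mul_cancel, S.hσ.one_act]

lemma Sys.inv_right' (S : Sys Γ ρ σ f) (γ : Γ) {z : ℂ} (hz : z ∈ unitDisc) :
    ρ γ (ρ γ⁻¹ z) = z := by
  rw [← S.hΓ.mul_act _ _ _ hz, mul_inv_cancel, S.hΓ.one_act _ hz]

lemma Sys.mono_or_anti (S : Sys Γ ρ σ f) (γ : Γ) : StrictMono (σ γ) ∨ StrictAnti (σ γ) :=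
  (S.hσ.continuous_act γ).strictMono_of_inj (Function.LeftInverse.injective (S.inv_left γ))

/-- The set of constant leaves. -/
def cst (f : ℂ → unitInterval → ℝ) : Set unitInterval := {x | ∀ z ∈ unitDisc, f z x = f 0 x}

lemma Sys.f_sigma (S : Sys Γ ρ σ f) (γ : Γ) {x : unitInterval} (hx : x ∈ cst f) {z : ℂ}
    (hz : z ∈ unitDisc) : f z (σ γ x) = f 0 x := by
  have h := S.hinv γ (ρ γ⁻¹ z) (S.hΓ.maps_disc _ _ hz) x
  rw [S.inv_right' γ hz] at h
  rw [h]
  exact hx _ (S.hΓ.maps_disc _ _ hz)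

lemma Sys.cst_inv (S : Sys Γ ρ σ f) (γ : Γ) {x : unitInterval} (hx : x ∈ cst f) :
    σ γ x ∈ cst f := by
  intro z hz
  rw [S.f_sigma γ hx hz, S.f_sigma γ hx zero_mem_disc]

lemma Sys.cst_closed (S : Sys Γ ρ σ f) : IsClosed (cst f) := by
  have : cst f = ⋂ z ∈ unitDisc, {x | f z x = f 0 x} := by
    ext x; simp [cst]
  rw [this]
  exact isClosed_biInter fun z hz => isClosed_eq (S.cont_x hz) (S.cont_x zero_mem_disc)

lemma Sys.exists_max (S : Sys Γ ρ σ f) {Y : Set unitInterval} (hY : IsClosed Y)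
    (hne : Y.Nonempty) (hinvY : ∀ γ, ∀ y ∈ Y, σ γ y ∈ Y) :
    ∃ y ∈ Y, ∃ k ∈ unitDisc, y ∈ cst f ∧ ∀ z ∈ unitDisc, ∀ x ∈ Y, f z x ≤ f k y := by
  obtain ⟨K, hKd, hKc, hK⟩ := S.hΓ.cocompact
  obtain ⟨γ₀, hγ₀⟩ := hK 0 zero_mem_disc
  obtain ⟨y0, hy0⟩ := hne
  obtain ⟨⟨k, y⟩, ⟨hk, hy⟩, hmax⟩ := (hKc.prod hY.isCompact).exists_isMaxOn
    ⟨(ρ γ₀ 0, y0), hγ₀, hy0⟩ (S.hcont.mono (Set.prod_mono hKd (subset_univ Y)))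
  have hall : ∀ z ∈ unitDisc, ∀ x ∈ Y, f z x ≤ f k y := by
    intro z hz x hx
    obtain ⟨γ, hγ⟩ := hK z hz
    rw [← S.hinv γ z hz x]
    exact hmax (show (ρ γ z, σ γ x) ∈ K ×ˢ Y from ⟨hγ, hinvY γ x hx⟩)
  refine ⟨y, hy, k, hKd hk, ?_, hall⟩
  have hm := harm_max (S.hharm y) (hKd hk) (fun w hw => hall w hw y hy)
  intro z hz
  have h1 := hm z hz
  have h2 := hm 0 zero_mem_disc
  simp only at h1 h2
  rw [h1, h2]

lemma Sys.endpoint (S : Sys Γ ρ σ f) {e : unitInterval} (he : e = 0 ∨ e = 1) : e ∈ cst f := by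
  have hE : ∀ γ, σ γ e = 0 ∨ σ γ e = 1 := by
    intro γ
    have n0 : ∀ x : unitInterval, 0 ≤ x := fun x => unitInterval.nonneg'
    have n1 : ∀ x : unitInterval, x ≤ 1 := fun x => unitInterval.le_one'
    rcases S.mono_or_anti γ with h | h <;> rcases he with rfl | rfl
    · left
      apply le_antisymm _ (n0 _)
      have := h.monotone (n0 (σ γ⁻¹ 0))
      rwa [S.inv_right] at this
    · right
      apply le_antisymm (n1 _)
      have := h.monotone (n1 (σ γ⁻¹ 1))
      rwa [S.inv_right] at this
    · right
      apply le_antisymm (n1 _)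
      have := h.antitone (n0 (σ γ⁻¹ 1))
      rwa [S.inv_right] at this
    · left
      apply le_antisymm _ (n0 _)
      have := h.antitone (n1 (σ γ⁻¹ 0))
      rwa [S.inv_right] at this
  have hfin : (range fun γ => σ γ e).Finite := by
    refine (Set.toFinite {(0 : unitInterval), 1}).subset ?_
    rintro _ ⟨γ, rfl⟩
    simpa using hE γ
  obtain ⟨y, ⟨γ, rfl⟩, -, -, hy, -⟩ := S.exists_max (Y := range fun γ => σ γ e) hfin.isClosed
    ⟨_, 1, rfl⟩ (by
      rintro γ _ ⟨δ, rfl⟩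
      exact ⟨γ * δ, S.hσ.mul_act _ _ _⟩)
  have := S.cst_inv γ⁻¹ hy
  simpa only [S.inv_left] using this

lemma Sys.upper (S : Sys Γ ρ σ f) {a b : unitInterval} (hab : a < b) (ha : a ∈ cst f)
    (hb : b ∈ cst f) (hgap : ∀ x ∈ Ioo a b, x ∉ cst f) :
    ∀ z ∈ unitDisc, ∀ x ∈ Icc a b, f z x ≤ max (f 0 a) (f 0 b) := by
  set W : Set unitInterval := ⋃ γ : Γ, σ γ '' Icc a b with hW
  have hsubW : Icc a b ⊆ W := by
    intro x hx
    exact mem_iUnion.mpr ⟨1, x, hx, S.hσ.one_act x⟩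
  have hWinv : ∀ γ, MapsTo (σ γ) W W := by
    intro γ x hx
    obtain ⟨δ, u, hu, rfl⟩ := mem_iUnion.mp hx
    exact mem_iUnion.mpr ⟨γ * δ, u, hu, S.hσ.mul_act _ _ _⟩
  obtain ⟨y, hyW, k, hk, hyC, hmax⟩ := S.exists_max (Y := closure W) isClosed_closure
    ⟨a, subset_closure (hsubW ⟨le_rfl, hab.le⟩)⟩
    (fun γ y hy => (hWinv γ).closure (S.hσ.continuous_act γ) hy)
  intro z hz x hx
  refine (hmax z hz x (subset_closure (hsubW hx))).trans ?_
  by_contra! hlt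
  have hU : IsOpen {u | max (f 0 a) (f 0 b) < f k u} :=
    isOpen_lt continuous_const (S.cont_x hk)
  obtain ⟨r, hr, hball⟩ := Metric.isOpen_iff.mp hU y hlt
  obtain ⟨v, hv, hvW⟩ := Metric.mem_closure_iff.mp hyW r hr
  obtain ⟨γ, u, hu, rfl⟩ := mem_iUnion.mp hv
  have hpa : r ≤ |(σ γ a : ℝ) - y| := by
    by_contra! h
    have h1 : σ γ a ∈ ball y r := h
    have h2 := hball h1
    simp only [Set.mem_ofPred_eq, S.f_sigma γ ha hk] at h2
    exact absurd (le_max_left (f 0 a) (f 0 b)) (not_le.mpr h2)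
  have hpb : r ≤ |(σ γ b : ℝ) - y| := by
    by_contra! h
    have h1 : σ γ b ∈ ball y r := h
    have h2 := hball h1
    simp only [Set.mem_ofPred_eq, S.f_sigma γ hb hk] at h2
    exact absurd (le_max_right (f 0 a) (f 0 b)) (not_le.mpr h2)
  have hv' : |(y : ℝ) - σ γ u| < r := hvW
  have arith : ∀ p q y v : ℝ, p ≤ v → v ≤ q → |y - v| < r → r ≤ |p - y| → r ≤ |q - y| →
      p < y ∧ y < q := by
    intro p q y v h1 h2 h3 h4 h5
    rw [abs_lt] at h3
    rw [le_abs] at h4 h5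
    constructor
    · rcases h4 with h | h <;> linarith
    · rcases h5 with h | h <;> linarith
  have hmem : σ γ⁻¹ y ∈ Ioo a b := by
    rcases S.mono_or_anti γ with h | h
    · obtain ⟨h1, h2⟩ := arith _ _ _ _ (Subtype.coe_le_coe.mpr (h.monotone hu.1))
        (Subtype.coe_le_coe.mpr (h.monotone hu.2)) hv' hpa hpb
      have h1' : σ γ a < σ γ (σ γ⁻¹ y) := by rw [S.inv_right]; exact h1
      have h2' : σ γ (σ γ⁻¹ y) < σ γ b := by rw [S.inv_right]; exact h2
      exact ⟨h.lt_iff_lt.mp h1', h.lt_iff_lt.mp h2'⟩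
    · obtain ⟨h1, h2⟩ := arith _ _ _ _ (Subtype.coe_le_coe.mpr (h.antitone hu.2))
        (Subtype.coe_le_coe.mpr (h.antitone hu.1)) hv' hpb hpa
      have h1' : σ γ b < σ γ (σ γ⁻¹ y) := by rw [S.inv_right]; exact h1
      have h2' : σ γ (σ γ⁻¹ y) < σ γ a := by rw [S.inv_right]; exact h2
      exact ⟨h.lt_iff_gt.mp h2', h.lt_iff_gt.mp h1'⟩
  exact hgap _ hmem (S.cst_inv _ hyC)

lemma Sys.stab (S : Sys Γ ρ σ f) {a b : unitInterval} (ha : a ∈ cst f)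
    (hb : b ∈ cst f) (hgap : ∀ x ∈ Ioo a b, x ∉ cst f) (hne : f 0 a ≠ f 0 b) {γ : Γ}
    {x : unitInterval} (hx : x ∈ Ioo a b) (hy : σ γ x ∈ Ioo a b) : σ γ a = a ∧ σ γ b = b := by
  have ga := S.cst_inv γ ha
  have gb := S.cst_inv γ hb
  have ia := S.cst_inv γ⁻¹ ha
  have ib := S.cst_inv γ⁻¹ hb
  have ra := S.inv_right γ a
  have rb := S.inv_right γ b
  rcases S.mono_or_anti γ with h | h
  · constructor
    · have h1 := h hx.1
      have h2 : σ γ a ≤ a := by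
        by_contra! h3
        exact hgap _ ⟨h3, h1.trans hy.2⟩ ga
      refine h2.eq_or_lt.resolve_right fun h3 => ?_
      have h4 : σ γ a < σ γ (σ γ⁻¹ a) := by rw [ra]; exact h3
      have h5 : σ γ (σ γ⁻¹ a) < σ γ x := by rw [ra]; exact hy.1
      exact hgap _ ⟨h.lt_iff_lt.mp h4, (h.lt_iff_lt.mp h5).trans hx.2⟩ ia
    · have h1 := h hx.2
      have h2 : b ≤ σ γ b := by
        by_contra! h3
        exact hgap _ ⟨hy.1.trans h1, h3⟩ gb
      refine (h2.eq_or_lt.resolve_right fun h3 => ?_).symm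
      have h4 : σ γ (σ γ⁻¹ b) < σ γ b := by rw [rb]; exact h3
      have h5 : σ γ x < σ γ (σ γ⁻¹ b) := by rw [rb]; exact hy.2
      exact hgap _ ⟨hx.1.trans (h.lt_iff_lt.mp h5), h.lt_iff_lt.mp h4⟩ ib
  · exfalso
    have h1 := h hx.2
    have h2 : σ γ b ≤ a := by
      by_contra! h3
      exact hgap _ ⟨h3, h1.trans hy.2⟩ gb
    have h6 : σ γ b = a := by
      refine h2.eq_or_lt.resolve_right fun h3 => ?_
      have h4 : σ γ b < σ γ (σ γ⁻¹ a) := by rw [ra]; exact h3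
      have h5 : σ γ (σ γ⁻¹ a) < σ γ x := by rw [ra]; exact hy.1
      exact hgap _ ⟨hx.1.trans (h.lt_iff_gt.mp h5), h.lt_iff_gt.mp h4⟩ ia
    apply hne
    rw [← S.f_sigma γ hb zero_mem_disc, h6]

/-- The stabilizer of the gap. -/
def Sys.stabGroup (S : Sys Γ ρ σ f) (a b : unitInterval) : Subgroup Γ where
  carrier := {γ | σ γ a = a ∧ σ γ b = b}
  mul_mem' := by
    rintro γ δ ⟨h1, h2⟩ ⟨h3, h4⟩
    exact ⟨by rw [S.hσ.mul_act, h3, h1], by rw [S.hσ.mul_act, h4, h2]⟩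
  one_mem' := ⟨S.hσ.one_act a, S.hσ.one_act b⟩
  inv_mem' := by
    rintro γ ⟨h1, h2⟩
    refine ⟨?_, ?_⟩
    · have := S.inv_left γ a
      rwa [h1] at this
    · have := S.inv_left γ b
      rwa [h2] at this

lemma Sys.cont_rho (S : Sys Γ ρ σ f) (γ : Γ) : ContinuousOn (ρ γ) unitDisc := by
  obtain ⟨α, β, hab, hm⟩ := S.hΓ.moebius γ
  have h1 : ContinuousOn (mob α β) unitDisc := fun z hz =>
    (mob_hasDerivAt hab hz).continuousAt.continuousWithinAt
  exact h1.congr hm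

lemma Sys.stab_fuchsian (S : Sys Γ ρ σ f) {a b : unitInterval} (hab : a < b) (ha : a ∈ cst f)
    (hb : b ∈ cst f) (hgap : ∀ x ∈ Ioo a b, x ∉ cst f) (hne : f 0 a ≠ f 0 b) :
    IsCocompactFuchsian (S.stabGroup a b) (fun γ => ρ γ.1) where
  one_act := S.hΓ.one_act
  mul_act := fun γ δ => S.hΓ.mul_act γ.1 δ.1
  maps_disc := fun γ => S.hΓ.maps_disc γ.1
  moebius := fun γ => S.hΓ.moebius γ.1
  faithful := fun γ h => Subtype.ext (S.hΓ.faithful γ.1 h)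
  properly_discontinuous := fun K hK hKc =>
    Set.Finite.preimage (f := fun γ : S.stabGroup a b => γ.1)
      (s := {γ : Γ | ((ρ γ '' K) ∩ K).Nonempty})
      Subtype.val_injective.injOn (S.hΓ.properly_discontinuous K hK hKc)
  cocompact := by
    obtain ⟨K, hKd, hKc, hK⟩ := S.hΓ.cocompact
    have huc : UniformContinuous (f 0) :=
      CompactSpace.uniformContinuous_of_continuous (S.cont_x zero_mem_disc)
    obtain ⟨δ, hδ, hunif⟩ := Metric.uniformContinuous_iff.mp huc |f 0 a - f 0 b|
      (abs_pos.mpr (sub_ne_zero.mpr hne))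
    obtain ⟨N, hN⟩ := exists_nat_gt (1 / δ)
    have hNpos : (0 : ℝ) < N := (by positivity : 0 < 1 / δ).trans hN
    have hNδ : 1 / (N : ℝ) < δ := by
      rw [div_lt_iff₀ hδ] at hN
      rw [div_lt_iff₀ hNpos]
      linarith
    -- every translate of the gap contains a grid point
    have hgrid : ∀ γ, ∃ j ∈ Finset.range (N + 1), ∃ u ∈ Ioo a b, (σ γ u : ℝ) = j / N := by
      intro γ
      have hd : δ ≤ |(σ γ a : ℝ) - σ γ b| := by
        by_contra! h
        have h1 : dist (σ γ a) (σ γ b) < δ := h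
        have h2 := hunif h1
        rw [S.f_sigma γ ha zero_mem_disc, S.f_sigma γ hb zero_mem_disc, Real.dist_eq] at h2
        exact lt_irrefl _ h2
      have hpq : ∀ p q : ℝ, 0 ≤ p → q ≤ 1 → δ ≤ q - p →
          ∃ j ∈ Finset.range (N + 1), p < (j : ℝ) / N ∧ (j : ℝ) / N < q := by
        intro p q hp hq hpq
        have hfl := Nat.lt_floor_add_one (p * N)
        have hfl2 := Nat.floor_le (show 0 ≤ p * N by positivity)
        have e1 : p < ((⌊p * N⌋₊ + 1 : ℕ) : ℝ) / N := by
          rw [lt_div_iff₀ hNpos]; push_cast; exact hfl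
        have e2 : ((⌊p * N⌋₊ + 1 : ℕ) : ℝ) / N < q := by
          have : ((⌊p * N⌋₊ + 1 : ℕ) : ℝ) / N ≤ p + 1 / N := by
            rw [div_le_iff₀ hNpos, add_mul, one_div, inv_mul_cancel₀ hNpos.ne']
            push_cast
            linarith
          linarith
        refine ⟨⌊p * N⌋₊ + 1, ?_, e1, e2⟩
        rw [Finset.mem_range]
        have h3 := e2.trans_le hq
        rw [div_lt_one hNpos] at h3
        have : ⌊p * N⌋₊ + 1 < N := by exact_mod_cast h3
        omega
      rcases S.mono_or_anti γ with h | h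
      · have h1 : (σ γ a : ℝ) < σ γ b := h hab
        rw [abs_of_neg (by linarith)] at hd
        obtain ⟨j, hj, hj1, hj2⟩ := hpq (σ γ a) (σ γ b) (σ γ a).2.1 (σ γ b).2.2 (by linarith)
        let y : unitInterval := ⟨(j : ℝ) / N, ((σ γ a).2.1.trans hj1.le),
          (hj2.le.trans (σ γ b).2.2)⟩
        have e1 : σ γ a < σ γ (σ γ⁻¹ y) := by rw [S.inv_right]; exact hj1
        have e2 : σ γ (σ γ⁻¹ y) < σ γ b := by rw [S.inv_right]; exact hj2
        exact ⟨j, hj, σ γ⁻¹ y, ⟨h.lt_iff_lt.mp e1, h.lt_iff_lt.mp e2⟩, by rw [S.inv_right]⟩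
      · have h1 : (σ γ b : ℝ) < σ γ a := h hab
        rw [abs_of_pos (by linarith)] at hd
        obtain ⟨j, hj, hj1, hj2⟩ := hpq (σ γ b) (σ γ a) (σ γ b).2.1 (σ γ a).2.2 (by linarith)
        let y : unitInterval := ⟨(j : ℝ) / N, ((σ γ b).2.1.trans hj1.le),
          (hj2.le.trans (σ γ a).2.2)⟩
        have e1 : σ γ b < σ γ (σ γ⁻¹ y) := by rw [S.inv_right]; exact hj1
        have e2 : σ γ (σ γ⁻¹ y) < σ γ a := by rw [S.inv_right]; exact hj2
        exact ⟨j, hj, σ γ⁻¹ y, ⟨h.lt_iff_gt.mp e2, h.lt_iff_gt.mp e1⟩, by rw [S.inv_right]⟩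
    classical
    let g : ℕ → Γ := fun j => if h : ∃ γ, ∃ u ∈ Ioo a b, (σ γ u : ℝ) = j / N then h.choose else 1
    refine ⟨⋃ j ∈ Finset.range (N + 1), ρ (g j)⁻¹ '' K, ?_, ?_, ?_⟩
    · intro z hz
      simp only [mem_iUnion] at hz
      obtain ⟨j, -, w, hw, rfl⟩ := hz
      exact S.hΓ.maps_disc _ _ (hKd hw)
    · exact (Finset.range (N + 1)).isCompact_biUnion fun j _ =>
        hKc.image_of_continuousOn ((S.cont_rho _).mono hKd)
    · intro z hz
      obtain ⟨γ, hγ⟩ := hK z hz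
      obtain ⟨j, hj, u, hu, huj⟩ := hgrid γ
      have hex : ∃ γ, ∃ u ∈ Ioo a b, (σ γ u : ℝ) = j / N := ⟨γ, u, hu, huj⟩
      obtain ⟨v, hv, hvj⟩ := hex.choose_spec
      have hg : g j = hex.choose := dif_pos hex
      rw [← hg] at hvj
      have huv : σ γ u = σ (g j) v := Subtype.ext (huj.trans hvj.symm)
      have hη : σ ((g j)⁻¹ * γ) u = v := by
        rw [S.hσ.mul_act, huv, S.inv_left]
      refine ⟨⟨(g j)⁻¹ * γ, S.stab ha hb hgap hne hu (by rw [hη]; exact hv)⟩, ?_⟩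
      simp only [mem_iUnion]
      exact ⟨j, hj, ρ γ z, hγ, (S.hΓ.mul_act _ _ _ hz).symm⟩

lemma Sys.core (S : Sys Γ ρ σ f) {a b : unitInterval} (hab : a < b) (ha : a ∈ cst f)
    (hb : b ∈ cst f) (hgap : ∀ x ∈ Ioo a b, x ∉ cst f) (h0 : f 0 a = 0) (hB : 0 < f 0 b) :
    False := by
  have hne : f 0 a ≠ f 0 b := by rw [h0]; exact hB.ne
  have hmono : ∀ γ : S.stabGroup a b, StrictMono (σ γ.1) := by
    rintro ⟨γ, h1, h2⟩
    rcases S.mono_or_anti γ with h | h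
    · exact h
    · have h3 := h hab
      rw [h1, h2] at h3
      exact absurd h3 (not_lt.mpr hab.le)
  obtain ⟨t, ht, htc⟩ := analytic_key (fun γ : S.stabGroup a b => ρ γ.1)
    (S.stab_fuchsian hab ha hb hgap hne) (fun γ => σ γ.1)
    ⟨S.hσ.one_act, fun γ δ => S.hσ.mul_act γ.1 δ.1, fun γ => S.hσ.continuous_act γ.1⟩
    f S.hcont S.hharm (fun γ => S.hinv γ.1) hmono hab (fun γ => γ.2.1) (fun γ => γ.2.2) hB
    (fun z hz => (ha z hz).trans h0) (fun z hz => hb z hz)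
    (fun z hz x hx => (S.upper hab ha hb hgap z hz x hx).trans
      (by rw [h0]; exact (max_eq_right hB.le).le))
  have ht0 := htc 0 zero_mem_disc
  refine hgap t ⟨lt_of_le_of_ne ht.1 ?_, lt_of_le_of_ne ht.2 ?_⟩
    (fun z hz => (htc z hz).trans ht0.symm)
  · rintro rfl
    linarith
  · rintro rfl
    linarith

lemma cst_affine {s t : ℝ} (hs : s ≠ 0) : cst (fun z x => s * f z x + t) = cst f := by
  ext x
  simp [cst, hs]

theorem Sys.main (S : Sys Γ ρ σ f) (x₀ : unitInterval) : x₀ ∈ cst f := by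
  by_contra hx₀
  obtain ⟨a, ⟨haC, hax⟩, hamax⟩ := ((S.cst_closed.inter isClosed_Iic).isCompact :
    IsCompact (cst f ∩ Iic x₀)).exists_isGreatest ⟨0, S.endpoint (Or.inl rfl),
      unitInterval.nonneg'⟩
  obtain ⟨b, ⟨hbC, hbx⟩, hbmin⟩ := ((S.cst_closed.inter isClosed_Ici).isCompact :
    IsCompact (cst f ∩ Ici x₀)).exists_isLeast ⟨1, S.endpoint (Or.inr rfl),
      unitInterval.le_one'⟩
  have hax' : a < x₀ := lt_of_le_of_ne hax (by rintro rfl; exact hx₀ haC)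
  have hbx' : x₀ < b := lt_of_le_of_ne hbx (by rintro rfl; exact hx₀ hbC)
  have hab := hax'.trans hbx'
  have hgap : ∀ x ∈ Ioo a b, x ∉ cst f := by
    intro x hx hxC
    rcases le_total x x₀ with h | h
    · exact absurd (hamax ⟨hxC, h⟩) (not_le.mpr hx.1)
    · exact absurd (hbmin ⟨hxC, h⟩) (not_le.mpr hx.2)
  have aff : ∀ s t : ℝ, s ≠ 0 → s * f 0 a + t = 0 → 0 < s * f 0 b + t → False := by
    intro s t hs h1 h2
    have e := cst_affine (f := f) (t := t) hs
    exact (S.affine s t).core hab (by rw [e]; exact haC) (by rw [e]; exact hbC)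
      (by rw [e]; exact hgap) h1 h2
  rcases lt_trichotomy (f 0 a) (f 0 b) with h | h | h
  · exact aff 1 (-f 0 a) one_ne_zero (by ring) (by linarith)
  · apply hx₀
    have hm : x₀ ∈ Icc a b := ⟨hax, hbx⟩
    have e := cst_affine (f := f) (s := -1) (t := 0) (by norm_num)
    have key : ∀ z ∈ unitDisc, f z x₀ = f 0 a := by
      intro z hz
      have h1 := S.upper hab haC hbC hgap z hz x₀ hm
      have h2 := (S.affine (-1) 0).upper hab (by rw [e]; exact haC) (by rw [e]; exact hbC)
        (by rw [e]; exact hgap) z hz x₀ hm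
      rw [← h, max_self] at h1 h2
      linarith
    intro z hz
    rw [key z hz, key 0 zero_mem_disc]
  · exact aff (-1) (f 0 a) (by norm_num) (by ring) (by linarith)

end LF

/-- **Theorem 1.2 (interval-fiber case).** Every `Γ`-invariant leafwise harmonic function on
`𝔻 × [0,1]`, for a cocompact Fuchsian group `Γ` acting on `[0,1]` by homeomorphisms, is
independent of the disc variable. -/
theorem liouville_foliated_interval_bundle
    {Γ : Type*} [Group Γ] (ρ : Γ → ℂ → ℂ) (hΓ : IsCocompactFuchsian Γ ρ)
    (σ : Γ → unitInterval → unitInterval) (hσ : IsActionByHomeomorphisms Γ unitInterval σ)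
    (f : ℂ → unitInterval → ℝ)
    (hcont : ContinuousOn (fun p : ℂ × unitInterval => f p.1 p.2)
      (unitDisc ×ˢ (univ : Set unitInterval)))
    (hharm : ∀ x : unitInterval, HarmonicOnSet (fun z => f z x) unitDisc)
    (hinv : ∀ γ : Γ, ∀ z ∈ unitDisc, ∀ x : unitInterval, f (ρ γ z) (σ γ x) = f z x) :
    ∀ z ∈ unitDisc, ∀ x : unitInterval, f z x = f 0 x := by
  exact fun z hz x => LF.Sys.main ⟨hΓ, hσ, hcont, hharm, hinv⟩ x z hz
end
end
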